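/- arXiv:2008.07059 — 6 statements merged into one kernel-verified Lean document; each statement's English description precedes it below -/
import Mathlib

section
/- Let G be a connected simple graph on N ≥ 2 vertices with m edges and vertex degrees d_1, …, d_N, and let 0 = λ_1 ≤ λ_2 ≤ … ≤ λ_N be the eigenvalues (with multiplicity) of its normalized Laplacian ℒ(G). Then (∏_{i=1}^{N} d_i) · (∏_{k=2}^{N} λ_k) = 2m · τ(G), where τ(G) is the number of spanning trees of G. -/
open Polynomial

open scoped Classical in
/-- The normalized Laplacian `ℒ(G) = I − D^{−1/2} A D^{−1/2}` of a graph, given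
entrywise: `1` on the diagonal, `−1/√(dᵢ dⱼ)` at adjacent pairs, `0` otherwise. -/
noncomputable def normLap {V : Type*} [Fintype V] (G : SimpleGraph V) : Matrix V V ℝ :=
  Matrix.of fun i j =>
    if i = j then 1
    else if G.Adj i j then -(1 / Real.sqrt ((G.degree i : ℝ) * (G.degree j))) else 0

/-- `τ(G)`: the number of spanning trees of `G`, i.e. the number of spanning
subgraphs of `G` that are trees. -/
noncomputable def spanningTreeCount {V : Type*} (G : SimpleGraph V) : ℕ :=
  Nat.card {H : G.Subgraph // H.IsSpanning ∧ H.coe.IsTree}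


open Matrix in
/-- Parent-function matrix. -/
lemma det_parent_eq_one {V : Type*} [Fintype V] [DecidableEq V] (r : V) (f : V → V)
    (hf : ∀ v, ∃ k, f^[k] v = r) :
    (Matrix.of fun v => if v = r then (Pi.single r 1 : V → ℝ)
      else Pi.single v 1 - Pi.single (f v) 1).det = 1 := by
  set P : Matrix V V ℝ := Matrix.of fun v => if v = r then 0 else Pi.single (f v) 1 with hP
  have hM : (Matrix.of fun v => if v = r then (Pi.single r 1 : V → ℝ)
      else Pi.single v 1 - Pi.single (f v) 1) = Matrix.scalar V 1 - P := by
    ext v w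
    by_cases h : v = r
    · subst h
      simp [hP, Matrix.one_apply, Pi.single_apply, eq_comm]
    · simp [hP, h, Matrix.one_apply, Pi.single_apply, eq_comm (a := w)]
  have hPx : ∀ (x : V → ℝ) v, (P *ᵥ x) v = if v = r then 0 else x (f v) := by
    intro x v
    by_cases h : v = r <;> simp [hP, Matrix.mulVec, h]
  have hpow : ∀ k j, j < k → ∀ v, f^[j] v = r → ∀ x : V → ℝ, ((P ^ k) *ᵥ x) v = 0 := by
    intro k
    induction k with
    | zero => intro j hj; omega
    | succ k ih =>
      intro j hj v hv x
      rw [pow_succ', ← Matrix.mulVec_mulVec, hPx]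
      split_ifs with h
      · rfl
      · cases j with
        | zero => exact absurd hv h
        | succ j => exact ih j (by omega) (f v) (by simpa using hv) x
  have hnil : IsNilpotent P := by
    choose j hj using hf
    refine ⟨Finset.univ.sup j + 1, ?_⟩
    ext v w
    have := hpow (Finset.univ.sup j + 1) (j v)
      (Nat.lt_succ_of_le (Finset.le_sup (Finset.mem_univ v))) v (hj v) (Pi.single w 1)
    simpa using this
  have h1 := (Matrix.isNilpotent_charpoly_sub_pow_of_isNilpotent hnil).eq_zero
  rw [hM, ← Matrix.eval_charpoly, sub_eq_zero.1 h1]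
  simp

open Matrix in
lemma det_parent_eq_zero {V : Type*} [Fintype V] [DecidableEq V] (r : V) (f : V → V)
    (hr : f r = r) (hf : ¬ ∀ v, ∃ k, f^[k] v = r) :
    (Matrix.of fun v => if v = r then (Pi.single r 1 : V → ℝ)
      else Pi.single v 1 - Pi.single (f v) 1).det = 0 := by
  classical
  rw [← Matrix.exists_mulVec_eq_zero_iff]
  have key : ∀ v, (∃ k, f^[k] (f v) = r) ↔ (∃ k, f^[k] v = r) := by
    intro v
    constructor
    · rintro ⟨k, hk⟩
      exact ⟨k + 1, by simpa using hk⟩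
    · rintro ⟨k, hk⟩
      refine ⟨k, ?_⟩
      rw [← Function.iterate_succ_apply, Function.iterate_succ_apply', hk, hr]
  refine ⟨fun v => if ∃ k, f^[k] v = r then 0 else 1, ?_, ?_⟩
  · push Not at hf
    obtain ⟨v, hv⟩ := hf
    intro h
    have := congrFun h v
    simp [hv] at this
  · ext v
    by_cases h : v = r
    · have : ∃ k, f^[k] r = r := ⟨0, rfl⟩
      simp [Matrix.mulVec, h, this]
    · simp only [Matrix.mulVec, Matrix.of_apply, h, if_false]
      change (Pi.single v 1 - Pi.single (f v) 1 : V → ℝ) ⬝ᵥ _ = 0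
      simp [sub_dotProduct, key]

/-- The choices of neighbours at all non-root vertices. -/
def parentChoices {V : Type*} [Fintype V] [DecidableEq V] (G : SimpleGraph V)
    [DecidableRel G.Adj] (r v : V) : Finset V :=
  if v = r then {r} else G.neighborFinset v

lemma mem_parentChoices {V : Type*} [Fintype V] [DecidableEq V] (G : SimpleGraph V)
    [DecidableRel G.Adj] (r : V) (f : V → V) :
    f ∈ Fintype.piFinset (parentChoices G r) ↔ f r = r ∧ ∀ v, v ≠ r → G.Adj v (f v) := by
  simp only [Fintype.mem_piFinset, parentChoices]
  constructor
  · intro h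
    refine ⟨by simpa using h r, fun v hv => by simpa [hv] using h v⟩
  · rintro ⟨h1, h2⟩ v
    by_cases hv : v = r
    · simp [hv, h1]
    · simp [hv, h2 v hv]

open scoped Classical in
lemma det_reduced {V : Type*} [Fintype V] [DecidableEq V] (G : SimpleGraph V)
    [DecidableRel G.Adj] (r : V) :
    ((G.lapMatrix ℝ).updateRow r (Pi.single r 1)).det =
      (((Fintype.piFinset (parentChoices G r)).filter
        (fun f => ∀ v, ∃ k, f^[k] v = r)).card : ℝ) := by
  have h1 : (G.lapMatrix ℝ).updateRow r (Pi.single r 1) = fun v => ∑ w ∈ parentChoices G r v,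
      (if v = r then (Pi.single r 1 : V → ℝ) else Pi.single v 1 - Pi.single w 1) := by
    ext v u
    by_cases hv : v = r
    · subst hv
      simp [parentChoices]
    · simp only [parentChoices, hv, if_false, Matrix.updateRow_ne hv, Finset.sum_apply]
      by_cases hu : u = v
      · subst hu
        simp [SimpleGraph.lapMatrix, SimpleGraph.degMatrix, Pi.single_apply]
      · simp [SimpleGraph.lapMatrix, SimpleGraph.degMatrix, Pi.single_apply, hu, Ne.symm hu,
          SimpleGraph.adjMatrix_apply]
  have h2 := (Matrix.detRowAlternating (n := V) (R := ℝ)).toMultilinearMap.map_sum_finset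
    (fun v w => (if v = r then (Pi.single r 1 : V → ℝ) else Pi.single v 1 - Pi.single w 1))
    (parentChoices G r)
  rw [h1]
  refine h2.trans ?_
  rw [Finset.card_filter, Nat.cast_sum]
  refine Finset.sum_congr rfl fun f hf => ?_
  rw [mem_parentChoices] at hf
  split_ifs with h
  · rw [Nat.cast_one]
    exact det_parent_eq_one r f h
  · rw [Nat.cast_zero]
    exact det_parent_eq_zero r f hf.1 h

/-- Graph of a parent function. -/
def parentGraph {V : Type*} (r : V) (f : V → V) : SimpleGraph V :=
  SimpleGraph.fromRel fun v w => v ≠ r ∧ f v = w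

lemma parentGraph_adj {V : Type*} {r : V} {f : V → V} {v w : V} : (parentGraph r f).Adj v w ↔
    v ≠ w ∧ ((v ≠ r ∧ f v = w) ∨ (w ≠ r ∧ f w = v)) := Iff.rfl

lemma parentGraph_isTree {V : Type*} [Fintype V] (r : V) (f : V → V)
    (hne : ∀ v, v ≠ r → f v ≠ v)
    (hf : ∀ v, ∃ k, f^[k] v = r) : (parentGraph r f).IsTree := by
  classical
  have hreach : ∀ k v, f^[k] v = r → (parentGraph r f).Reachable v r := by
    intro k
    induction k with
    | zero => rintro v rfl; exact SimpleGraph.Reachable.refl _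
    | succ k ih =>
      intro v hv
      by_cases h : v = r
      · subst h; exact SimpleGraph.Reachable.refl _
      · have : (parentGraph r f).Adj v (f v) := parentGraph_adj.2 ⟨(hne v h).symm, Or.inl ⟨h, rfl⟩⟩
        exact this.reachable.trans (ih _ (by simpa using hv))
  have hconn : (parentGraph r f).Connected := by
    have : Nonempty V := ⟨r⟩
    refine ⟨fun v w => ?_⟩
    obtain ⟨k, hk⟩ := hf v
    obtain ⟨l, hl⟩ := hf w
    exact (hreach k v hk).trans (hreach l w hl).symm
  rw [SimpleGraph.isTree_iff_connected_and_card]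
  refine ⟨hconn, le_antisymm ?_ hconn.card_vert_le_card_edgeSet_add_one⟩
  have hsub : (parentGraph r f).edgeFinset ⊆ (Finset.univ.erase r).image (fun v => s(v, f v)) := by
    intro e
    induction e with
    | _ v w =>
      simp only [SimpleGraph.mem_edgeFinset, SimpleGraph.mem_edgeSet, parentGraph_adj,
        Finset.mem_image, Finset.mem_erase, Finset.mem_univ, and_true]
      rintro ⟨-, ⟨h1, h2⟩ | ⟨h1, h2⟩⟩
      · exact ⟨v, h1, by rw [h2]⟩
      · exact ⟨w, h1, by rw [h2, Sym2.eq_swap]⟩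
  have hc := (Finset.card_le_card hsub).trans Finset.card_image_le
  rw [Finset.card_erase_of_mem (Finset.mem_univ r), Finset.card_univ] at hc
  have hpos : 0 < Fintype.card V := Fintype.card_pos_iff.2 ⟨r⟩
  rw [Nat.card_eq_fintype_card, Nat.card_eq_fintype_card, ← SimpleGraph.edgeFinset_card]
  omega

lemma parentGraph_inj {V : Type*} (r : V) (f g : V → V) (hfr : f r = r) (hgr : g r = r)
    (hfn : ∀ v, v ≠ r → f v ≠ v)
    (hf : ∀ v, ∃ k, f^[k] v = r) (h : parentGraph r f = parentGraph r g) : f = g := by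
  have key : ∀ k v, f^[k] v = r → f v = g v := by
    intro k
    induction k with
    | zero => rintro v rfl; exact hfr.trans hgr.symm
    | succ k ih =>
      intro v hv
      by_cases hvr : v = r
      · subst hvr; exact hfr.trans hgr.symm
      · have hadj : (parentGraph r f).Adj v (f v) :=
          parentGraph_adj.2 ⟨(hfn v hvr).symm, Or.inl ⟨hvr, rfl⟩⟩
        rw [h, parentGraph_adj] at hadj
        rcases hadj with ⟨-, ⟨-, h2⟩ | ⟨h1, h2⟩⟩
        · exact h2.symm
        · exfalso
          have h3 : f (f v) = v := by
            rw [ih (f v) (by simpa using hv), h2]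
          have h4 : ∀ k, f^[k] v = v ∨ f^[k] v = f v := by
            intro k
            induction k with
            | zero => exact Or.inl rfl
            | succ k ih =>
              rw [Function.iterate_succ_apply']
              rcases ih with h | h <;> rw [h]
              · exact Or.inr rfl
              · exact Or.inl h3
          rcases h4 (k + 1) with h | h <;> rw [hv] at h
          · exact hvr h.symm
          · exact h1 h.symm
  funext v
  obtain ⟨k, hk⟩ := hf v
  exact key k v hk

lemma parentGraph_surj {V : Type*} [Fintype V] (r : V) (T : SimpleGraph V) (hT : T.IsTree) :
    ∃ f : V → V, f r = r ∧ (∀ v, v ≠ r → T.Adj v (f v)) ∧ (∀ v, ∃ k, f^[k] v = r) ∧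
      parentGraph r f = T := by
  classical
  have hex : ∀ v, ∃ w, (v = r → w = r) ∧ (v ≠ r → T.Adj v w ∧ T.dist w r < T.dist v r) := by
    intro v
    by_cases hv : v = r
    · exact ⟨r, fun _ => rfl, fun h => absurd hv h⟩
    · obtain ⟨p, hp⟩ := hT.connected.exists_walk_length_eq_dist v r
      cases p with
      | nil => exact absurd rfl hv
      | @cons _ w _ hadj q =>
        refine ⟨w, fun h => absurd h hv, fun _ => ⟨hadj, ?_⟩⟩
        have := SimpleGraph.dist_le q
        rw [SimpleGraph.Walk.length_cons] at hp
        omega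
  choose f hf1 hf2 using hex
  have hreach : ∀ n v, T.dist v r ≤ n → ∃ k, f^[k] v = r := by
    intro n
    induction n with
    | zero =>
      intro v hv
      by_cases h : v = r
      · exact ⟨0, h⟩
      · have := (hf2 v h).2
        omega
    | succ n ih =>
      intro v hv
      by_cases h : v = r
      · exact ⟨0, h⟩
      · have := (hf2 v h).2
        obtain ⟨k, hk⟩ := ih (f v) (by omega)
        exact ⟨k + 1, by simpa using hk⟩
  have hreach' : ∀ v, ∃ k, f^[k] v = r := fun v => hreach _ v le_rfl
  refine ⟨f, hf1 r rfl, fun v hv => (hf2 v hv).1, hreach', ?_⟩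
  have htree := parentGraph_isTree r f (fun v hv => (hf2 v hv).1.ne') hreach'
  have hle : parentGraph r f ≤ T := by
    intro v w hvw
    rcases parentGraph_adj.1 hvw with ⟨-, ⟨h1, h2⟩ | ⟨h1, h2⟩⟩
    · rw [← h2]; exact (hf2 v h1).1
    · rw [← h2]; exact (hf2 w h1).1.symm
  exact ((SimpleGraph.isTree_iff_minimal_connected.1 hT).eq_of_le htree.connected hle)

open scoped Classical in
lemma card_parent {V : Type*} [Fintype V] [DecidableEq V] (G : SimpleGraph V)
    [DecidableRel G.Adj] (r : V) :
    ((Fintype.piFinset (parentChoices G r)).filter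
        (fun f => ∀ v, ∃ k, f^[k] v = r)).card = spanningTreeCount G := by
  rw [spanningTreeCount, ← Fintype.card_coe, ← Nat.card_eq_fintype_card]
  have hmem : ∀ f : V → V, f ∈ (Fintype.piFinset (parentChoices G r)).filter
      (fun f => ∀ v, ∃ k, f^[k] v = r) →
      (f r = r ∧ ∀ v, v ≠ r → G.Adj v (f v)) ∧ ∀ v, ∃ k, f^[k] v = r := by
    intro f hf
    rw [Finset.mem_filter, mem_parentChoices] at hf
    exact hf
  have hle : ∀ f : V → V, (∀ v, v ≠ r → G.Adj v (f v)) → parentGraph r f ≤ G := by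
    intro f hf v w hvw
    rcases parentGraph_adj.1 hvw with ⟨-, ⟨h1, h2⟩ | ⟨h1, h2⟩⟩
    · rw [← h2]; exact hf v h1
    · rw [← h2]; exact (hf w h1).symm
  have hspan : ∀ f : V → V, ∀ h : parentGraph r f ≤ G,
      (SimpleGraph.toSubgraph (parentGraph r f) h).spanningCoe = parentGraph r f := by
    intro f h
    ext v w
    rfl
  let Φ : {f // f ∈ (Fintype.piFinset (parentChoices G r)).filter
      (fun f => ∀ v, ∃ k, f^[k] v = r)} → {H : G.Subgraph // H.IsSpanning ∧ H.coe.IsTree} :=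
    fun f => ⟨SimpleGraph.toSubgraph (parentGraph r f.1) (hle f.1 (hmem f.1 f.2).1.2),
      SimpleGraph.toSubgraph.isSpanning _ _, by
        rw [← ((SimpleGraph.Subgraph.spanningCoeEquivCoeOfSpanning _
          (SimpleGraph.toSubgraph.isSpanning _ _)).isTree_iff), hspan]
        exact parentGraph_isTree r f.1 (fun v hv => ((hmem f.1 f.2).1.2 v hv).ne')
          (hmem f.1 f.2).2⟩
  refine Nat.card_eq_of_bijective Φ ⟨?_, ?_⟩
  · rintro ⟨f, hf⟩ ⟨g, hg⟩ h
    have h1 := congrArg (fun H => SimpleGraph.Subgraph.spanningCoe H.1) h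
    simp only [Φ, hspan] at h1
    exact Subtype.ext (parentGraph_inj r f g (hmem f hf).1.1 (hmem g hg).1.1
      (fun v hv => ((hmem f hf).1.2 v hv).ne') (hmem f hf).2 h1)
  · rintro ⟨H, hs, ht⟩
    rw [← (SimpleGraph.Subgraph.spanningCoeEquivCoeOfSpanning _ hs).isTree_iff] at ht
    obtain ⟨f, h1, h2, h3, h4⟩ := parentGraph_surj r _ ht
    refine ⟨⟨f, ?_⟩, ?_⟩
    · rw [Finset.mem_filter, mem_parentChoices]
      exact ⟨⟨h1, fun v hv => H.spanningCoe_le (h2 v hv)⟩, h3⟩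
    · apply Subtype.ext
      apply SimpleGraph.Subgraph.ext
      · exact (SimpleGraph.Subgraph.isSpanning_iff.1 hs).symm
      · funext v w
        exact congrFun (congrFun (congrArg SimpleGraph.Adj h4) v) w

open Matrix in
lemma adjugate_lap {V : Type*} [Fintype V] [DecidableEq V] (G : SimpleGraph V)
    [DecidableRel G.Adj] (i j : V) :
    (G.lapMatrix ℝ).adjugate i j = spanningTreeCount G := by
  classical
  rw [Matrix.adjugate_apply, ← card_parent G j, ← det_reduced G j, ← sub_eq_zero]
  have h : (Pi.single i 1 : V → ℝ) = (Pi.single i 1 - Pi.single j 1) + Pi.single j 1 := by simp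
  rw [h, Matrix.det_updateRow_add, add_sub_cancel_right, ← Matrix.exists_mulVec_eq_zero_iff]
  refine ⟨fun _ => 1, fun h => by simpa using congrFun h i, ?_⟩
  ext v
  by_cases hv : v = j
  · subst hv
    simp only [Matrix.mulVec, Matrix.updateRow_self]
    change (Pi.single i 1 - Pi.single v 1 : V → ℝ) ⬝ᵥ _ = 0
    simp [sub_dotProduct]
  · have := congrFun (SimpleGraph.lapMatrix_mulVec_const_eq_zero (R := ℝ) G) v
    simp only [Matrix.mulVec, Matrix.updateRow_ne hv] at this ⊢
    exact this

open Matrix in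
lemma lap_eq_normLap {V : Type*} [Fintype V] [DecidableEq V] (G : SimpleGraph V)
    [DecidableRel G.Adj] (hd : ∀ v, 0 < G.degree v) (t : ℝ) :
    G.lapMatrix ℝ + t • G.degMatrix ℝ = Matrix.diagonal (fun v => Real.sqrt (G.degree v)) *
      (Matrix.scalar V t + normLap G) * Matrix.diagonal (fun v => Real.sqrt (G.degree v)) := by
  ext v w
  have hdv : (0 : ℝ) < G.degree v := by exact_mod_cast hd v
  have hdw : (0 : ℝ) < G.degree w := by exact_mod_cast hd w
  rw [Matrix.mul_diagonal, Matrix.diagonal_mul]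
  have hn : normLap G v w = if v = w then 1
    else if G.Adj v w then -(1 / Real.sqrt ((G.degree v : ℝ) * (G.degree w))) else 0 := by
    simp only [normLap, Matrix.of_apply]
    congr!
  have hs := Real.mul_self_sqrt hdv.le
  have h1 := (Real.sqrt_pos.2 hdv).ne'
  have h2 := (Real.sqrt_pos.2 hdw).ne'
  rw [Matrix.add_apply, Matrix.add_apply, hn]
  by_cases h : v = w
  · subst h
    simp [SimpleGraph.lapMatrix, SimpleGraph.degMatrix]
    linear_combination -(1 + t) * hs
  · by_cases ha : G.Adj v w
    · simp [SimpleGraph.lapMatrix, SimpleGraph.degMatrix, h, ha]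
      field_simp
    · simp [SimpleGraph.lapMatrix, SimpleGraph.degMatrix, h, ha]

lemma det_lap_add {V : Type*} [Fintype V] [DecidableEq V] (G : SimpleGraph V)
    [DecidableRel G.Adj] (hd : ∀ v, 0 < G.degree v)
    (lam : Fin (Fintype.card V) → ℝ)
    (hchar : (normLap G).charpoly = ∏ k, (X - C (lam k))) (t : ℝ) :
    (G.lapMatrix ℝ + t • G.degMatrix ℝ).det =
      (∏ v : V, (G.degree v : ℝ)) * ∏ k, (t + lam k) := by
  have h1 := congrArg (Polynomial.eval (-t)) hchar
  rw [Matrix.eval_charpoly, Polynomial.eval_prod] at h1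
  have h2 : Matrix.scalar V (-t) - normLap G = -(Matrix.scalar V t + normLap G) := by
    rw [map_neg]; abel
  have h3 : ∀ k, Polynomial.eval (-t) (X - C (lam k)) = -1 * (t + lam k) := by
    intro k; simp; ring
  simp only [h3] at h1
  rw [h2, Matrix.det_neg, Finset.prod_mul_distrib, Finset.prod_const, Finset.card_univ,
    Fintype.card_fin] at h1
  have h4 := mul_left_cancel₀ (pow_ne_zero _ (by norm_num)) h1
  rw [lap_eq_normLap G hd, Matrix.det_mul, Matrix.det_mul, h4, Matrix.det_diagonal,
    mul_right_comm, ← Finset.prod_mul_distrib]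
  congr 1
  exact Finset.prod_congr rfl fun v _ => Real.mul_self_sqrt (by positivity)

open Matrix in
lemma det_lap_add' {V : Type*} [Fintype V] [DecidableEq V] (G : SimpleGraph V)
    [DecidableRel G.Adj] (r : V) (t : ℝ) :
    (G.lapMatrix ℝ + t • G.degMatrix ℝ).det =
      t * ((G.lapMatrix ℝ + t • G.degMatrix ℝ).adjugate *ᵥ fun v => (G.degree v : ℝ)) r := by
  set A := G.lapMatrix ℝ + t • G.degMatrix ℝ with hA
  have h1 : A *ᵥ (fun _ => 1) = t • fun v => (G.degree v : ℝ) := by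
    rw [hA, Matrix.add_mulVec, SimpleGraph.lapMatrix_mulVec_const_eq_zero, zero_add,
      Matrix.smul_mulVec]
    congr 1
    ext v
    simp [SimpleGraph.degMatrix_mulVec_apply]
  have h2 : A.adjugate *ᵥ (A *ᵥ (fun _ => 1)) = A.det • (fun _ => 1) := by
    rw [Matrix.mulVec_mulVec, Matrix.adjugate_mul, Matrix.smul_mulVec, Matrix.one_mulVec]
  rw [h1, Matrix.mulVec_smul] at h2
  simpa using (congrFun h2 r).symm

lemma det_lap_add_pos {V : Type*} [Fintype V] [DecidableEq V] (G : SimpleGraph V)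
    [DecidableRel G.Adj] (hd : ∀ v, 0 < G.degree v) (t : ℝ) (ht : 0 < t) :
    0 < (G.lapMatrix ℝ + t • G.degMatrix ℝ).det := by
  have hD : (G.degMatrix ℝ).PosDef := by
    rw [SimpleGraph.degMatrix, Matrix.posDef_diagonal_iff]
    exact fun v => by exact_mod_cast hd v
  exact ((hD.smul ht).posSemidef_add (G.posSemidef_lapMatrix ℝ)).det_pos

/-- Let `G` be a connected graph on `N ≥ 2` vertices with `m` edges and let
`0 = λ_1 ≤ λ_2 ≤ … ≤ λ_N` be the eigenvalues (with multiplicity) of its normalized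
Laplacian. Then `(∏ᵢ dᵢ) ⬝ (∏_{k=2}^{N} λ_k) = 2 m τ(G)`. -/
theorem prod_degree_mul_prod_eigenvalues_eq_two_mul_spanningTreeCount
    {V : Type*} [Fintype V] [DecidableEq V] (G : SimpleGraph V) [DecidableRel G.Adj]
    (hG : G.Connected) (hN : 2 ≤ Fintype.card V)
    (lam : Fin (Fintype.card V) → ℝ) (hmono : Monotone lam)
    (hchar : (normLap G).charpoly = ∏ k, (X - C (lam k))) :
    (∏ v : V, (G.degree v : ℝ)) *
      (∏ k ∈ Finset.univ.filter (fun k : Fin (Fintype.card V) => k.val ≠ 0), lam k)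
      = 2 * (Nat.card G.edgeSet) * (spanningTreeCount G) := by
  have hnt : Nontrivial V := Fintype.one_lt_card_iff_nontrivial.1 hN
  have hd : ∀ v, 0 < G.degree v := fun v => hG.preconnected.degree_pos_of_nontrivial v
  obtain ⟨r⟩ := hG.nonempty
  have hDpos : 0 < ∏ v : V, (G.degree v : ℝ) :=
    Finset.prod_pos fun v _ => by exact_mod_cast hd v
  have hdet := det_lap_add G hd lam hchar
  have hnonneg : ∀ k, 0 ≤ lam k := by
    intro k
    by_contra hk
    push Not at hk
    have h1 := det_lap_add_pos G hd (-lam k) (by linarith)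
    rw [hdet, Finset.prod_eq_zero (Finset.mem_univ k) (by ring), mul_zero] at h1
    exact lt_irrefl _ h1
  let z : Fin (Fintype.card V) := ⟨0, by omega⟩
  have hz : lam z = 0 := by
    have h0 := hdet 0
    rw [det_lap_add' G r, zero_mul] at h0
    have h1 := (mul_eq_zero.1 h0.symm).resolve_left hDpos.ne'
    obtain ⟨k, -, hk⟩ := Finset.prod_eq_zero_iff.1 h1
    have h2 : lam z ≤ lam k := hmono (Fin.mk_le_of_le_val (Nat.zero_le _))
    exact le_antisymm (by linarith) (hnonneg z)
  have hfilter : Finset.univ.filter (fun k : Fin (Fintype.card V) => k.val ≠ 0) =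
      Finset.univ.erase z := by
    ext k
    simp only [Finset.mem_filter, Finset.mem_univ, true_and, Finset.mem_erase, and_true, ne_eq,
      Fin.ext_iff, z]
  rw [hfilter]
  have hne : ∀ t : ℝ, t ≠ 0 → (∏ v : V, (G.degree v : ℝ)) * ∏ k ∈ Finset.univ.erase z, (t + lam k) =
      ((G.lapMatrix ℝ + t • G.degMatrix ℝ).adjugate.mulVec fun v => (G.degree v : ℝ)) r := by
    intro t ht
    have h1 := hdet t
    rw [det_lap_add' G r, ← Finset.mul_prod_erase _ _ (Finset.mem_univ z), hz, add_zero] at h1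
    apply mul_left_cancel₀ ht
    rw [h1]; ring
  have hc1 : Continuous fun t : ℝ =>
      (∏ v : V, (G.degree v : ℝ)) * ∏ k ∈ Finset.univ.erase z, (t + lam k) := by fun_prop
  have hc2 : Continuous fun t : ℝ =>
      ((G.lapMatrix ℝ + t • G.degMatrix ℝ).adjugate.mulVec fun v => (G.degree v : ℝ)) r := by
    have h1 : Continuous fun t : ℝ => (G.lapMatrix ℝ + t • G.degMatrix ℝ) := by fun_prop
    exact (continuous_apply r).comp (h1.matrix_adjugate.matrix_mulVec continuous_const)
  have heq := Continuous.ext_on (dense_compl_singleton (0 : ℝ)) hc1 hc2 (fun t ht => hne t ht)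
  have h0 := congrFun heq 0
  simp only [zero_add, zero_smul, add_zero] at h0
  rw [h0]
  simp only [Matrix.mulVec, dotProduct, adjugate_lap]
  rw [← Finset.mul_sum, ← Nat.cast_sum, G.sum_degrees_eq_twice_card_edges,
    Nat.card_eq_fintype_card, ← SimpleGraph.edgeFinset_card]
  push_cast
  ring
end

section
/- Let n ≥ 2, let 0 = α_1 < α_2 ≤ … ≤ α_{n+1} be the eigenvalues (with multiplicity) of M, and let 0 < β_1 ≤ β_2 ≤ … ≤ β_{n+1} be the eigenvalues (with multiplicity) of N. Then Kf*(B_n²) = 4(7n+3) · ( 4·(5/6) + (2n−2)·(7/8) + (1/2)∑_{i=2}^{n+1} 1/α_i + (1/2)∑_{j=1}^{n+1} 1/β_j ). -/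
open Polynomial

/-- The tridiagonal matrix `M` (of size `(n+1) × (n+1)`). -/
noncomputable def Mmat (n : ℕ) : Matrix (Fin (n+1)) (Fin (n+1)) ℝ :=
  Matrix.of fun i j =>
    if i = j then (if i.val = 0 ∨ i.val = n then 1/5 else 2/7)
    else if i.val + 1 = j.val ∨ j.val + 1 = i.val then
      (if min i.val j.val = 0 ∨ max i.val j.val = n then -(1/Real.sqrt 35) else -(1/7))
    else 0

/-- The tridiagonal matrix `N` (of size `(n+1) × (n+1)`). -/
noncomputable def Nmat (n : ℕ) : Matrix (Fin (n+1)) (Fin (n+1)) ℝ :=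
  Matrix.of fun i j =>
    if i = j then (if i.val = 0 ∨ i.val = n then 3/5 else 4/7)
    else if i.val + 1 = j.val ∨ j.val + 1 = i.val then
      (if min i.val j.val = 0 ∨ max i.val j.val = n then -(1/Real.sqrt 35) else -(1/7))
    else 0

/-- The linear polyomino chain `B_n`. -/
def Bgraph (n : ℕ) : SimpleGraph (Fin (n+1) × Bool) :=
  SimpleGraph.fromRel (fun x y => (x.2 = y.2 ∧ x.1.val + 1 = y.1.val) ∨ (x.1 = y.1))

/-- The strong prism `G ⊠ K₂`. -/
def strongPrism {V : Type*} (G : SimpleGraph V) : SimpleGraph (V × Bool) :=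
  SimpleGraph.fromRel (fun x y => x.1 = y.1 ∨ G.Adj x.1 y.1)

open scoped Classical in
lemma charpoly_bool {V : Type*} [Fintype V] (P Q : Matrix V V ℝ)
    (L : Matrix (V × Bool) (V × Bool) ℝ)
    (hL : ∀ x s y t, L (x, s) (y, t) = if s = t then P x y else Q x y) :
    L.charpoly = (P + Q).charpoly * (P - Q).charpoly := by
  let e : V × Bool ≃ V ⊕ V := (Equiv.prodComm V Bool).trans (Equiv.boolProdEquivSum V)
  have h1 : Matrix.reindex e e L = Matrix.fromBlocks P Q Q P := by
    ext x y
    rcases x with x | x <;> rcases y with y | y <;> simp [e, hL, Equiv.boolProdEquivSum]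
  let U : (Matrix (V ⊕ V) (V ⊕ V) ℝ)ˣ :=
    ⟨Matrix.fromBlocks 1 0 (-1) 1, Matrix.fromBlocks 1 0 1 1, by
      simp [Matrix.fromBlocks_multiply], by simp [Matrix.fromBlocks_multiply]⟩
  have hU : U.val * Matrix.fromBlocks P Q Q P * U⁻¹.val
      = Matrix.fromBlocks (P + Q) Q 0 (P - Q) := by
    show Matrix.fromBlocks 1 0 (-1) 1 * Matrix.fromBlocks P Q Q P * Matrix.fromBlocks 1 0 1 1 = _
    simp only [Matrix.fromBlocks_multiply]
    congr 1 <;> simp <;> abel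
  rw [← Matrix.charpoly_reindex e L, h1, ← Matrix.charpoly_fromBlocks_zero₂₁ (P + Q) Q (P - Q), ← hU]
  have := Matrix.charpoly_units_conj U (Matrix.fromBlocks P Q Q P)
  rw [← Matrix.coe_units_inv] at this
  convert this.symm

lemma charpoly_two_smul {m : ℕ} (A B : Matrix (Fin m) (Fin m) ℝ) (a : Fin m → ℝ)
    (hA : A.charpoly = ∏ i, (X - C (a i))) (hB : ∀ i j, B i j = 2 * A i j) :
    B.charpoly = ∏ i, (X - C (2 * a i)) := by
  apply Polynomial.funext
  intro t
  have h := congrArg (Polynomial.eval (t / 2)) hA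
  rw [Matrix.eval_charpoly] at h
  rw [Matrix.eval_charpoly]
  have h2 : Matrix.scalar (Fin m) t - B = (2 : ℝ) • (Matrix.scalar (Fin m) (t / 2) - A) := by
    ext i j
    by_cases hij : i = j
    · subst hij; simp [hB]; ring
    · simp [hB, hij]
  rw [h2, Matrix.det_smul, h]
  simp only [Polynomial.eval_prod, Polynomial.eval_sub, Polynomial.eval_X, Polynomial.eval_C]
  rw [Finset.card_univ.symm, ← Finset.prod_const, ← Finset.prod_mul_distrib]
  exact Finset.prod_congr rfl fun i _ => by ring

lemma root_nonneg {m : ℕ} (A : Matrix (Fin m) (Fin m) ℝ) (a : Fin m → ℝ) (s : Fin m → ℝ)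
    (hA : A.charpoly = ∏ i, (X - C (a i))) (hs : ∀ i, 0 < s i)
    (hoff : ∀ i j, i ≠ j → A i j ≤ 0) (hrow : ∀ i, 0 ≤ ∑ j, A i j * s j) (i : Fin m) :
    0 ≤ a i := by
  by_contra hneg
  push Not at hneg
  have h := congrArg (Polynomial.eval (a i)) hA
  rw [Matrix.eval_charpoly, Polynomial.eval_prod,
    Finset.prod_eq_zero (Finset.mem_univ i) (by simp)] at h
  have hdet : ((Matrix.scalar (Fin m) (a i) - A) * Matrix.diagonal s).det = 0 := by
    rw [Matrix.det_mul, h, zero_mul]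
  refine det_ne_zero_of_sum_row_lt_diag ?_ hdet
  intro k
  have hk := hrow k
  rw [← Finset.add_sum_erase _ _ (Finset.mem_univ k)] at hk
  have h1 : ∑ j ∈ Finset.univ.erase k,
      ‖((Matrix.scalar (Fin m) (a i) - A) * Matrix.diagonal s) k j‖
      = - ∑ j ∈ Finset.univ.erase k, A k j * s j := by
    rw [← Finset.sum_neg_distrib]
    apply Finset.sum_congr rfl
    intro j hj
    have hkj : k ≠ j := (Finset.ne_of_mem_erase hj).symm
    rw [Matrix.mul_diagonal, Real.norm_eq_abs]
    simp only [Matrix.sub_apply, Matrix.scalar_apply, Matrix.diagonal_apply_ne _ hkj, zero_sub]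
    rw [abs_of_nonneg (mul_nonneg (neg_nonneg.2 (hoff k j hkj)) (hs j).le)]
    ring
  rw [h1, Matrix.mul_diagonal, Real.norm_eq_abs]
  simp only [Matrix.sub_apply, Matrix.scalar_apply, Matrix.diagonal_apply_eq]
  have h2 := neg_le_abs ((a i - A k k) * s k)
  have h3 := mul_neg_of_neg_of_pos hneg (hs k)
  nlinarith

lemma tri_sum (n : ℕ) (hn : 2 ≤ n) (i : Fin (n+1)) (a b : ℝ) :
    (∑ j : Fin (n+1), if i = j then a
      else if i.val + 1 = j.val ∨ j.val + 1 = i.val then b else 0)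
      = if i.val = 0 ∨ i.val = n then a + b else a + 2 * b := by
  have h : ∀ j : Fin (n+1), (if i = j then a
      else if i.val + 1 = j.val ∨ j.val + 1 = i.val then b else 0)
      = (if i = j then a else 0) + (if i.val + 1 = j.val then b else 0)
        + (if j.val + 1 = i.val then b else 0) := by
    intro j
    simp only [Fin.ext_iff]
    split_ifs <;> first | omega | simp
  have h1 : (∑ j : Fin (n+1), if i.val + 1 = j.val then b else 0) = if i.val = n then 0 else b := by
    split_ifs with hi
    · exact Finset.sum_eq_zero fun j _ => if_neg (by omega)
    · rw [Finset.sum_eq_single ⟨i.val + 1, by omega⟩]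
      · simp
      · intro j _ hj
        exact if_neg fun hh => hj (Fin.ext hh.symm)
      · simp
  have h2 : (∑ j : Fin (n+1), if j.val + 1 = i.val then b else 0) = if i.val = 0 then 0 else b := by
    split_ifs with hi
    · exact Finset.sum_eq_zero fun j _ => if_neg (by omega)
    · rw [Finset.sum_eq_single ⟨i.val - 1, by omega⟩]
      · exact if_pos (by simp; omega)
      · intro j _ hj
        refine if_neg fun hh => hj (Fin.ext ?_)
        simp; omega
      · simp
  rw [Finset.sum_congr rfl fun j _ => h j, Finset.sum_add_distrib, Finset.sum_add_distrib, h1, h2]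
  rw [Finset.sum_ite_eq]
  simp only [Finset.mem_univ, if_true]
  split_ifs <;> first | omega | ring

/-- The degree (in the strong prism) of a vertex in column `i`. -/
noncomputable def dg (n : ℕ) (i : Fin (n+1)) : ℝ := if i.val = 0 ∨ i.val = n then 5 else 7

lemma dg_pos (n : ℕ) (i : Fin (n+1)) : 0 < dg n i := by
  unfold dg; split_ifs <;> norm_num

lemma adj_iff (n : ℕ) (i j : Fin (n+1)) (b c s t : Bool) :
    (strongPrism (Bgraph n)).Adj ((i, b), s) ((j, c), t) ↔
      (i = j ∧ ¬ (b = c ∧ s = t)) ∨ (b = c ∧ (i.val + 1 = j.val ∨ j.val + 1 = i.val)) := by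
  simp only [strongPrism, Bgraph, SimpleGraph.fromRel_adj, Prod.mk.injEq, Fin.ext_iff, ne_eq]
  constructor
  · grind
  · grind

open scoped Classical in
lemma degree_eq (n : ℕ) (hn : 2 ≤ n) (i : Fin (n+1)) (b s : Bool) :
    ((strongPrism (Bgraph n)).degree ((i, b), s) : ℝ) = dg n i := by
  have h : ((strongPrism (Bgraph n)).degree ((i, b), s) : ℝ)
      = ∑ y, if (strongPrism (Bgraph n)).Adj ((i, b), s) y then (1 : ℝ) else 0 := by
    rw [← SimpleGraph.card_neighborFinset_eq_degree, SimpleGraph.neighborFinset_eq_filter]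
    simp
  rw [h, Fintype.sum_prod_type, Fintype.sum_prod_type]
  have h2 : ∀ j : Fin (n+1), (∑ c : Bool, ∑ t : Bool,
      if (strongPrism (Bgraph n)).Adj ((i, b), s) ((j, c), t) then (1 : ℝ) else 0)
      = if i = j then 3 else if i.val + 1 = j.val ∨ j.val + 1 = i.val then 2 else 0 := by
    intro j
    simp only [adj_iff, Fintype.sum_bool]
    by_cases hij : i = j
    · subst hij
      cases b <;> cases s <;> simp <;> norm_num
    · by_cases ha : i.val + 1 = j.val ∨ j.val + 1 = i.val
      · cases b <;> cases s <;> simp [hij, ha] <;> norm_num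
      · cases b <;> cases s <;> simp [hij, ha]
  rw [Finset.sum_congr rfl fun j _ => h2 j, tri_sum n hn, dg]
  norm_num

lemma Mmat_apply (n : ℕ) (hn : 2 ≤ n) (i j : Fin (n+1)) :
    Mmat n i j = if i = j then (1 - 3 / dg n i) / 2
      else if i.val + 1 = j.val ∨ j.val + 1 = i.val then -(1 / √(dg n i * dg n j)) else 0 := by
  unfold Mmat dg
  rw [Matrix.of_apply]
  by_cases hij : i = j
  · simp only [if_pos hij]; split_ifs <;> norm_num
  · simp only [if_neg hij]
    by_cases ha : i.val + 1 = j.val ∨ j.val + 1 = i.val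
    · simp only [if_pos ha]
      have h49 : √((7:ℝ) * 7) = 7 := Real.sqrt_mul_self (by norm_num)
      split_ifs <;> first | omega | (rw [h49]) | norm_num
    · simp only [if_neg ha]

lemma Nmat_apply (n : ℕ) (hn : 2 ≤ n) (i j : Fin (n+1)) :
    Nmat n i j = if i = j then (1 + 1 / dg n i) / 2
      else if i.val + 1 = j.val ∨ j.val + 1 = i.val then -(1 / √(dg n i * dg n j)) else 0 := by
  unfold Nmat dg
  rw [Matrix.of_apply]
  by_cases hij : i = j
  · simp only [if_pos hij]; split_ifs <;> norm_num
  · simp only [if_neg hij]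
    by_cases ha : i.val + 1 = j.val ∨ j.val + 1 = i.val
    · simp only [if_pos ha]
      have h49 : √((7:ℝ) * 7) = 7 := Real.sqrt_mul_self (by norm_num)
      split_ifs <;> first | omega | (rw [h49]) | norm_num
    · simp only [if_neg ha]

lemma row_aux (n : ℕ) (hn : 2 ≤ n) (a : ℝ) (i : Fin (n+1)) :
    (∑ j, (if i = j then a else if i.val + 1 = j.val ∨ j.val + 1 = i.val then
      -(1 / √(dg n i * dg n j)) else 0) * √(dg n j))
      = if i.val = 0 ∨ i.val = n then a * √(dg n i) + -(1 / √(dg n i))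
        else a * √(dg n i) + 2 * -(1 / √(dg n i)) := by
  rw [← tri_sum n hn]
  refine Finset.sum_congr rfl fun j _ => ?_
  have hi := Real.sqrt_pos.2 (dg_pos n i)
  have hj := Real.sqrt_pos.2 (dg_pos n j)
  rw [Real.sqrt_mul (dg_pos n i).le]
  split_ifs with h1 h2
  · rw [h1]
  · field_simp
  · simp

lemma Mrow (n : ℕ) (hn : 2 ≤ n) (i : Fin (n+1)) : ∑ j, Mmat n i j * √(dg n j) = 0 := by
  rw [Finset.sum_congr rfl fun j _ => by rw [Mmat_apply n hn], row_aux n hn]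
  have hi := Real.sqrt_pos.2 (dg_pos n i)
  have hsq := Real.sq_sqrt (dg_pos n i).le
  have hd : dg n i = if i.val = 0 ∨ i.val = n then 5 else 7 := rfl
  split_ifs at hd ⊢ with h <;> rw [hd] at hi hsq ⊢ <;> field_simp <;> rw [hsq] <;> norm_num

lemma Nrow (n : ℕ) (hn : 2 ≤ n) (i : Fin (n+1)) : 0 ≤ ∑ j, Nmat n i j * √(dg n j) := by
  rw [← Mrow n hn i]
  refine Finset.sum_le_sum fun j _ => mul_le_mul_of_nonneg_right ?_ (Real.sqrt_nonneg _)
  rw [Mmat_apply n hn, Nmat_apply n hn]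
  have hi := dg_pos n i
  split_ifs with h1
  · have : 0 < 1 / dg n i := by positivity
    rw [show 3 / dg n i = 3 * (1 / dg n i) by ring]
    linarith
  · exact le_rfl
  · exact le_rfl

lemma Lcharpoly (n : ℕ) (hn : 2 ≤ n) (α β : Fin (n+1) → ℝ)
    (hα : (Mmat n).charpoly = ∏ i, (X - C (α i)))
    (hβ : (Nmat n).charpoly = ∏ j, (X - C (β j))) :
    (normLap (strongPrism (Bgraph n))).charpoly =
      (∏ i, (X - C (2 * α i))) * (∏ i, (X - C (2 * β i))) *
        ∏ x : Fin (n+1) × Bool, (X - C (1 + 1 / dg n x.1)) := by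
  classical
  let E : Fin (n+1) → Fin (n+1) → ℝ := fun i j =>
    if i.val + 1 = j.val ∨ j.val + 1 = i.val then -(1 / √(dg n i * dg n j)) else 0
  let P : Matrix (Fin (n+1) × Bool) (Fin (n+1) × Bool) ℝ := fun x y =>
    if x.1 = y.1 then (if x.2 = y.2 then 1 else - (1 / dg n x.1))
    else if x.2 = y.2 then E x.1 y.1 else 0
  let Q : Matrix (Fin (n+1) × Bool) (Fin (n+1) × Bool) ℝ := fun x y =>
    if x.1 = y.1 then - (1 / dg n x.1)
    else if x.2 = y.2 then E x.1 y.1 else 0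
  have hL := charpoly_bool P Q (normLap (strongPrism (Bgraph n))) (by
    rintro ⟨i, b⟩ s ⟨j, c⟩ t
    have hss : √(dg n i * dg n i) = dg n i := Real.sqrt_mul_self (dg_pos n i).le
    simp only [normLap, Matrix.of_apply, degree_eq n hn, adj_iff, P, Q, E, Prod.mk.injEq]
    by_cases hij : i = j
    · subst hij
      by_cases hbc : b = c <;> by_cases hst : s = t <;> simp [hbc, hst, hss]
    · by_cases hbc : b = c <;> by_cases hst : s = t <;> simp [hbc, hst, hij])
  have hPQ : P - Q = Matrix.diagonal fun x => 1 + 1 / dg n x.1 := by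
    ext x y
    obtain ⟨i, b⟩ := x
    obtain ⟨j, c⟩ := y
    rw [Matrix.diagonal_apply]
    rw [Matrix.sub_apply]
    simp only [P, Q, Prod.mk.injEq]
    by_cases hij : i = j <;> by_cases hbc : b = c <;> simp [hij, hbc]
  let PB : Matrix (Fin (n+1)) (Fin (n+1)) ℝ := fun i j =>
    if i = j then 1 - 1 / dg n i else 2 * E i j
  let QB : Matrix (Fin (n+1)) (Fin (n+1)) ℝ := fun i j =>
    if i = j then - (2 / dg n i) else 0
  have hLB := charpoly_bool PB QB (P + Q) (by
    intro i b j c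
    rw [Matrix.add_apply]
    simp only [P, Q, PB, QB]
    by_cases hij : i = j <;> by_cases hbc : b = c <;> simp [hij, hbc] <;> ring)
  have e1 := charpoly_two_smul (Mmat n) (PB + QB) α hα (by
    intro i j
    rw [Mmat_apply n hn]
    rw [Matrix.add_apply]
    simp only [PB, QB, E]
    split_ifs <;> ring)
  have e2 := charpoly_two_smul (Nmat n) (PB - QB) β hβ (by
    intro i j
    rw [Nmat_apply n hn]
    rw [Matrix.sub_apply]
    simp only [PB, QB, E]
    split_ifs <;> ring)
  have e3 : (P - Q).charpoly = ∏ x : Fin (n+1) × Bool, (X - C (1 + 1 / dg n x.1)) := by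
    rw [hPQ, Matrix.charpoly_diagonal]
  have hX : (P + Q).charpoly = (PB + QB).charpoly * (PB - QB).charpoly := by convert hLB
  have hY : (normLap (strongPrism (Bgraph n))).charpoly = (P + Q).charpoly * (P - Q).charpoly := by
    convert hL
  rw [← e1, ← e2, ← e3, ← hX, ← hY]

lemma map_eq_of_prod_eq {ι κ : Type*} [Fintype ι] [Fintype κ] (f : ι → ℝ) (g : κ → ℝ)
    (h : ∏ i, (X - C (f i)) = ∏ j, (X - C (g j))) :
    (Finset.univ : Finset ι).val.map f = (Finset.univ : Finset κ).val.map g := by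
  have key : ∀ {τ : Type _} [Fintype τ] (u : τ → ℝ),
      (∏ i, (X - C (u i))).roots = (Finset.univ : Finset τ).val.map u := by
    intro τ _ u
    rw [← Polynomial.roots_multiset_prod_X_sub_C (Multiset.map u Finset.univ.val), Multiset.map_map]
    rfl
  have key2 : ∀ {τ : Type _} [Fintype τ] (u : τ → ℝ),
      (∏ i, (X - C (u i))).roots = (Finset.univ : Finset τ).val.map u := by
    intro τ _ u
    rw [← Polynomial.roots_multiset_prod_X_sub_C (Multiset.map u Finset.univ.val), Multiset.map_map]
    rfl
  rw [← key, ← key2, h]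

lemma first_zero {m : ℕ} (a : Fin (m+1) → ℝ) (hm : Monotone a) (h0 : ∀ i, 0 ≤ a i)
    (hz : ∃ i, a i = 0) : a 0 = 0 := by
  obtain ⟨i, hi⟩ := hz
  exact le_antisymm (hi ▸ hm (Fin.zero_le i)) (h0 0)

lemma sum_filter_eq {m : ℕ} (a : Fin (m+1) → ℝ) (h : a 0 = 0) :
    (∑ k ∈ Finset.univ.filter (fun k : Fin (m+1) => k.val ≠ 0), 1 / a k) = ∑ k, 1 / a k := by
  rw [Finset.sum_filter]
  refine Finset.sum_congr rfl fun k _ => ?_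
  split_ifs with hk
  · rfl
  · push Not at hk
    rw [show k = 0 from Fin.ext hk, h]; simp

lemma sum_dg (n : ℕ) (hn : 2 ≤ n) :
    ∑ x : Fin (n+1) × Bool, 1 / (1 + 1 / dg n x.1)
      = 4 * (5/6) + (2 * (n : ℝ) - 2) * (7/8) := by
  rw [Fintype.sum_prod_type]
  have h : ∀ i : Fin (n+1), (∑ _c : Bool, 1 / (1 + 1 / dg n i))
      = 7/4 + ((if i = 0 then (-1/12 : ℝ) else 0) + if i = Fin.last n then (-1/12 : ℝ) else 0) := by
    intro i
    simp only [dg, Fintype.sum_bool, Fin.ext_iff, Fin.val_last, Fin.val_zero]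
    split_ifs <;> first | omega | norm_num
  rw [Finset.sum_congr rfl fun i _ => h i, Finset.sum_add_distrib, Finset.sum_add_distrib]
  simp
  ring

/-- `Kf*(B_n²) = 4(7n+3) ( 4·(5/6) + (2n−2)·(7/8) + ½ ∑_{i=2}^{n+1} 1/αᵢ + ½ ∑_{j=1}^{n+1} 1/βⱼ )`,
where `Kf*` is the degree-Kirchhoff index `2m ∑_{k=2}^{N} 1/λ_k` computed from the
ordered normalized Laplacian eigenvalues `0 = λ_1 ≤ … ≤ λ_N` of `B_n²`, the `αᵢ` are
the ordered eigenvalues of `M`, and the `βⱼ` are the ordered eigenvalues of `N`. -/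
theorem kfStar_strongPrism_eq_of_eigenvalues (n : ℕ) (hn : 2 ≤ n)
    (lam : Fin (4*n+4) → ℝ) (hlammono : Monotone lam)
    (hlam : (normLap (strongPrism (Bgraph n))).charpoly = ∏ k, (X - C (lam k)))
    (α : Fin (n+1) → ℝ) (hαmono : Monotone α)
    (hα : (Mmat n).charpoly = ∏ i, (X - C (α i)))
    (β : Fin (n+1) → ℝ) (hβmono : Monotone β)
    (hβ : (Nmat n).charpoly = ∏ j, (X - C (β j))) :
    2 * (2 * (7 * (n : ℝ) + 3)) *
        (∑ k ∈ Finset.univ.filter (fun k : Fin (4*n+4) => k.val ≠ 0), 1 / lam k)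
      = 4 * (7 * (n : ℝ) + 3) *
          (4 * (5/6) + (2 * (n : ℝ) - 2) * (7/8)
            + (1/2) * (∑ i ∈ Finset.univ.filter (fun i : Fin (n+1) => i.val ≠ 0), 1 / α i)
            + (1/2) * (∑ j : Fin (n+1), 1 / β j)) := by
  have hαnn : ∀ i, 0 ≤ α i := root_nonneg (Mmat n) α (fun j => √(dg n j)) hα
    (fun i => Real.sqrt_pos.2 (dg_pos n i))
    (fun i j hij => by
      rw [Mmat_apply n hn, if_neg hij]
      split_ifs
      · exact neg_nonpos.2 (by positivity)
      · exact le_rfl)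
    (fun i => (Mrow n hn i).ge)
  have hβnn : ∀ i, 0 ≤ β i := root_nonneg (Nmat n) β (fun j => √(dg n j)) hβ
    (fun i => Real.sqrt_pos.2 (dg_pos n i))
    (fun i j hij => by
      rw [Nmat_apply n hn, if_neg hij]
      split_ifs
      · exact neg_nonpos.2 (by positivity)
      · exact le_rfl)
    (Nrow n hn)
  have hαz : ∃ i, α i = 0 := by
    have hdet : (Mmat n).det = 0 := by
      apply Matrix.exists_mulVec_eq_zero_iff.1
      refine ⟨fun j => √(dg n j), fun h => ?_, ?_⟩
      · exact (Real.sqrt_pos.2 (dg_pos n 0)).ne' (congrFun h 0)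
      · ext i
        exact Mrow n hn i
    have h := congrArg (Polynomial.eval 0) hα
    rw [Matrix.eval_charpoly, Polynomial.eval_prod] at h
    simp only [map_zero, zero_sub, Matrix.det_neg, hdet, mul_zero] at h
    obtain ⟨i, -, hi⟩ := Finset.prod_eq_zero_iff.1 h.symm
    exact ⟨i, by simpa using hi⟩
  have hα0 := first_zero α hαmono hαnn hαz
  let g : (Fin (n+1) ⊕ Fin (n+1)) ⊕ (Fin (n+1) × Bool) → ℝ :=
    Sum.elim (Sum.elim (fun i => 2 * α i) (fun i => 2 * β i)) (fun x => 1 + 1 / dg n x.1)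
  have hg : ∏ k, (X - C (lam k)) = ∏ y, (X - C (g y)) := by
    rw [← hlam, Lcharpoly n hn α β hα hβ, Fintype.prod_sum_type, Fintype.prod_sum_type]
    rfl
  have hmap := map_eq_of_prod_eq lam g hg
  have hgnn : ∀ y, 0 ≤ g y := by
    rintro ((i | i) | x)
    · exact mul_nonneg zero_le_two (hαnn i)
    · exact mul_nonneg zero_le_two (hβnn i)
    · have := dg_pos n x.1
      show 0 ≤ 1 + 1 / dg n x.1
      positivity
  have hlnn : ∀ k, 0 ≤ lam k := by
    intro k
    have : lam k ∈ (Finset.univ : Finset (Fin (4*n+4))).val.map lam :=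
      Multiset.mem_map_of_mem _ (Finset.mem_univ k)
    rw [hmap] at this
    obtain ⟨y, -, hy⟩ := Multiset.mem_map.1 this
    exact hy ▸ hgnn y
  have hlz : ∃ k, lam k = 0 := by
    have : (0 : ℝ) ∈ Finset.univ.val.map g :=
      Multiset.mem_map.2 ⟨Sum.inl (Sum.inl 0), Finset.mem_univ _, by simp [g, hα0]⟩
    rw [← hmap] at this
    obtain ⟨y, -, hy⟩ := Multiset.mem_map.1 this
    exact ⟨y, hy⟩
  have hl0 : lam 0 = 0 := first_zero (m := 4*n+3) lam hlammono hlnn hlz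
  have hS : ∑ k, 1 / lam k = ∑ y, 1 / g y := by
    have := congrArg (fun s => (Multiset.map (fun r : ℝ => 1 / r) s).sum) hmap
    simp only [Multiset.map_map] at this
    exact this
  have hS2 : (∑ k ∈ Finset.univ.filter (fun k : Fin (4*n+4) => k.val ≠ 0), 1 / lam k)
      = ∑ k, 1 / lam k := sum_filter_eq (m := 4*n+3) lam hl0
  have hA : ∑ i, 1 / (2 * α i) = (1/2) * ∑ i, 1 / α i := by
    rw [Finset.mul_sum]
    exact Finset.sum_congr rfl fun i _ => by rw [one_div_mul_one_div]
  have hB : ∑ i, 1 / (2 * β i) = (1/2) * ∑ i, 1 / β i := by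
    rw [Finset.mul_sum]
    exact Finset.sum_congr rfl fun i _ => by rw [one_div_mul_one_div]
  rw [hS2, hS, sum_filter_eq α hα0, Fintype.sum_sum_type, Fintype.sum_sum_type]
  simp only [g, Sum.elim_inl, Sum.elim_inr]
  rw [sum_dg n hn, hA, hB]
  ring
end

section
/- Let n ≥ 2 and let 0 < β_1 ≤ β_2 ≤ … ≤ β_{n+1} be the eigenvalues (with multiplicity) of N. Then ∑_{j=1}^{n+1} 1/β_j = ( √3(7n−9)·[(2+√3)^{n+1} + (2−√3)^{n+1}] − 4·[(2+√3)^n − (2−√3)^n] ) / ( 6·[(2+√3)^{n+1} − (2−√3)^{n+1}] ) + 9/2. -/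
open Polynomial

def useq : ℕ → ℝ
  | 0 => 1
  | 1 => 3
  | (k+2) => 4 * useq (k+1) - useq k

lemma useq_wron (k m : ℕ) :
    useq (k+1) * useq (m+1) - useq k * useq m = 3 * useq (k+m+1) - useq (k+m) := by
  induction k generalizing m with
  | zero => simp [useq]
  | succ k ih =>
    have h := ih (m+1)
    have e1 : k + (m+1) = k+1+m := by ring
    rw [e1] at h
    rw [← h]
    simp only [useq]
    ring

noncomputable def wgt (n i : ℕ) : ℝ := if i = 0 ∨ i = n then Real.sqrt 35 / 7 else 1

def Tm (n i k : ℕ) : ℝ :=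
  (if k = i then (if i = 0 ∨ i = n then 3 else 4) else 0)
    + ((if k = i+1 then -1 else 0) + (if k + 1 = i then -1 else 0))

def Hm (n k j : ℕ) : ℝ := useq (min k j) * useq (n - max k j)

lemma wgt_pos (n i : ℕ) : 0 < wgt n i := by
  unfold wgt; split_ifs <;> positivity

lemma Nmat_wgt (n : ℕ) (hn : 2 ≤ n) (i k : Fin (n+1)) :
    Nmat n i k * wgt n k = Tm n i k / (7 * wgt n i) := by
  have hr : Real.sqrt 35 * Real.sqrt 35 = 35 := Real.mul_self_sqrt (by norm_num)
  have hp : 0 < Real.sqrt 35 := by positivity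
  rw [eq_div_iff (by have := wgt_pos n i; positivity)]
  obtain ⟨i, hi⟩ := i
  obtain ⟨k, hk⟩ := k
  simp only [Nmat, Matrix.of_apply, Fin.mk.injEq, Tm, wgt]
  by_cases h1 : i = k
  · subst h1
    by_cases h2 : i = 0 ∨ i = n
    · simp [h2]; nlinarith
    · simp [h2]
  · by_cases h3 : i + 1 = k
    · subst h3
      by_cases h4 : i = 0
      · subst h4
        have : ¬ (1 = n) := by omega
        simp [this]; field_simp
      · by_cases h5 : i + 1 = n
        · have : ¬ (i = n) := by omega
          simp [h4, h5, this]; field_simp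
          all_goals try simp [show ¬ (n = i) by omega, show ¬ (n + 1 = i) by omega]
          all_goals try omega
        · have : ¬ (i = n) := by omega
          simp [h4, h5, this]
          try omega
    · by_cases h3' : k + 1 = i
      · subst h3'
        by_cases h4 : k = 0
        · subst h4
          have : ¬ (1 = n) := by omega
          simp [this]; field_simp
        · by_cases h5 : k + 1 = n
          · have : ¬ (k = n) := by omega
            simp [h4, h5, this]; field_simp
            all_goals try simp [show ¬ (n = k) by omega, show ¬ (k = n + 1) by omega]
            all_goals try omega
          · have : ¬ (k = n) := by omega
            simp [h4, h5, this]
            try omega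
      · simp [h1, h3, h3', Ne.symm h1, show ¬ (k = i) by omega, show ¬ (k = i+1) by omega]

lemma Tm_sum (n i : ℕ) (hi : i ≤ n) (f : ℕ → ℝ) :
    ∑ k ∈ Finset.range (n+1), Tm n i k * f k =
      (if i = 0 ∨ i = n then 3 else 4) * f i + ((if i < n then - f (i+1) else 0)
        + (if 0 < i then - f (i-1) else 0)) := by
  simp only [Tm, add_mul, Finset.sum_add_distrib, ite_mul, zero_mul]
  congr 1
  · rw [Finset.sum_ite_eq' (Finset.range (n+1)) i]; simp [show i < n+1 by omega]
  congr 1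
  · rw [Finset.sum_ite_eq' (Finset.range (n+1)) (i+1)]; simp
  · rcases i with _ | i
    · simp
    · simp only [Nat.add_right_cancel_iff]
      rw [Finset.sum_ite_eq' (Finset.range (n+1)) i]; simp; omega

lemma TH (n : ℕ) (hn : 2 ≤ n) (i j : ℕ) (hi : i ≤ n) (hj : j ≤ n) :
    ∑ k ∈ Finset.range (n+1), Tm n i k * Hm n k j =
      if i = j then 3 * useq n - useq (n-1) else 0 := by
  rw [Tm_sum n i hi]
  simp only [Hm]
  rcases i with _ | i
  · rcases j with _ | j
    · obtain ⟨m, rfl⟩ : ∃ m, n = m + 1 := ⟨n-1, by omega⟩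
      simp [useq]; ring
    · simp [useq, show 0 < n by omega, show 1 ⊔ (j+1) = j+1 by omega]
  by_cases hin : i + 1 = n
  · subst hin
    rcases eq_or_lt_of_le hj with rfl | h
    · simp [useq]; ring
    · simp [show ¬ (i + 1 = j) by omega, show min (i+1) j = j by omega,
        show min i j = j by omega, show max (i+1) j = i+1 by omega, show max i j = i by omega,
        show i + 1 - i = 1 by omega, useq]
      ring
  · obtain ⟨m, rfl⟩ : ∃ m, n = i + 1 + m + 1 := ⟨n - i - 2, by omega⟩
    rw [if_neg (by omega), if_pos (by omega), if_pos (by omega)]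
    simp only [Nat.add_sub_cancel]
    rcases lt_trichotomy (i+1) j with h | h | h
    · rw [if_neg (by omega), show min (i+1) j = i+1 by omega, show min (i+1+1) j = i+2 by omega,
        show min i j = i by omega, show max (i+1) j = j by omega, show max (i+1+1) j = j by omega,
        show max i j = j by omega]
      simp only [useq]; ring
    · subst h
      have hw := useq_wron (i+1) m
      rw [if_pos rfl, ← hw, show min (i+1) (i+1) = i+1 by omega,
        show min (i+1+1) (i+1) = i+1 by omega,
        show min i (i+1) = i by omega, show max (i+1) (i+1) = i+1 by omega,
        show max (i+1+1) (i+1) = i+2 by omega,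
        show max i (i+1) = i+1 by omega, show i + 1 + m + 1 - (i+1) = m+1 by omega,
        show i + 1 + m + 1 - (i+2) = m by omega]
      simp only [useq]; ring
    · rw [if_neg (by omega), show min (i+1) j = j by omega, show min (i+1+1) j = j by omega,
        show min i j = j by omega, show max (i+1) j = i+1 by omega,
        show max (i+1+1) j = i+2 by omega,
        show max i j = i by omega, show i + 1 + m + 1 - (i+1) = m+1 by omega,
        show i + 1 + m + 1 - (i+2) = m by omega, show i + 1 + m + 1 - i = m+2 by omega]
      simp only [useq]; ring

lemma useq_closed (k : ℕ) : useq k =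
    (1/2 + Real.sqrt 3 / 6) * (2 + Real.sqrt 3)^k + (1/2 - Real.sqrt 3 / 6) * (2 - Real.sqrt 3)^k := by
  have hs : Real.sqrt 3 ^ 2 = 3 := Real.sq_sqrt (by norm_num)
  induction k using useq.induct with
  | case1 => simp [useq]; ring
  | case2 => simp only [useq]; ring_nf; rw [hs]; norm_num
  | case3 k h1 h2 =>
    simp only [useq]
    rw [h1, h2]
    have ha : (2 + Real.sqrt 3)^(k+2) = (2 + Real.sqrt 3)^k * (4 * (2 + Real.sqrt 3) - 1) := by
      rw [pow_add]; congr 1; linear_combination hs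
    have hb : (2 - Real.sqrt 3)^(k+2) = (2 - Real.sqrt 3)^k * (4 * (2 - Real.sqrt 3) - 1) := by
      rw [pow_add]; congr 1; linear_combination hs
    rw [ha, hb]; ring

lemma W_closed (n : ℕ) (hn : 2 ≤ n) : 3 * useq n - useq (n-1) =
    ((2 + Real.sqrt 3)^(n+1) - (2 - Real.sqrt 3)^(n+1)) * (Real.sqrt 3 / 3) := by
  have hs : Real.sqrt 3 ^ 2 = 3 := Real.sq_sqrt (by norm_num)
  obtain ⟨m, rfl⟩ : ∃ m, n = m + 1 := ⟨n-1, by omega⟩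
  simp only [Nat.add_sub_cancel, useq_closed, pow_succ]
  generalize (2 + Real.sqrt 3)^m = x
  generalize (2 - Real.sqrt 3)^m = y
  generalize Real.sqrt 3 = s at *
  have h3 : s ^ 3 = 3 * s := by rw [pow_succ, hs]
  ring_nf
  rw [h3, hs]; ring

lemma ab_pos (n : ℕ) : 0 < (2 + Real.sqrt 3)^(n+1) - (2 - Real.sqrt 3)^(n+1) := by
  have h3 : 0 < Real.sqrt 3 := by positivity
  have h2 : Real.sqrt 3 < 2 := by
    rw [Real.sqrt_lt' (by norm_num)]; norm_num
  have := pow_lt_pow_left₀ (show 2 - Real.sqrt 3 < 2 + Real.sqrt 3 by linarith) (by linarith)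
    (show n + 1 ≠ 0 by omega)
  linarith

lemma conv_closed (n : ℕ) : ∑ i ∈ Finset.range (n+1), useq i * useq (n-i) =
    (n+1) * ((1/2 + Real.sqrt 3 / 6)^2 * (2 + Real.sqrt 3)^n
      + (1/2 - Real.sqrt 3 / 6)^2 * (2 - Real.sqrt 3)^n)
    + 1/3 * (((2 + Real.sqrt 3)^(n+1) - (2 - Real.sqrt 3)^(n+1)) * (Real.sqrt 3 / 6)) := by
  have hs : Real.sqrt 3 ^ 2 = 3 := Real.sq_sqrt (by norm_num)
  have g := geom_sum₂_mul (2 + Real.sqrt 3) (2 - Real.sqrt 3) (n+1)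
  have g2 := geom_sum₂_mul (2 - Real.sqrt 3) (2 + Real.sqrt 3) (n+1)
  simp only [Nat.add_sub_cancel] at g g2
  have e : ∀ i ∈ Finset.range (n+1), useq i * useq (n-i) =
      ((1/2 + Real.sqrt 3 / 6)^2 * (2 + Real.sqrt 3)^n
      + (1/2 - Real.sqrt 3 / 6)^2 * (2 - Real.sqrt 3)^n)
      + 1/6 * ((2 + Real.sqrt 3)^i * (2 - Real.sqrt 3)^(n-i))
      + 1/6 * ((2 - Real.sqrt 3)^i * (2 + Real.sqrt 3)^(n-i)) := by
    intro i hi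
    have hi' : i ≤ n := by simpa [Nat.lt_succ_iff] using hi
    rw [useq_closed, useq_closed]
    have p1 := pow_add (2 + Real.sqrt 3) i (n-i)
    have p2 := pow_add (2 - Real.sqrt 3) i (n-i)
    rw [Nat.add_sub_cancel' hi'] at p1 p2
    rw [p1, p2]
    generalize (2 + Real.sqrt 3)^i = x
    generalize (2 - Real.sqrt 3)^i = y
    generalize (2 + Real.sqrt 3)^(n-i) = z
    generalize (2 - Real.sqrt 3)^(n-i) = t
    linear_combination (-(1/36) * x * t - 1/36 * y * z) * hs
  rw [Finset.sum_congr rfl e]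
  simp only [Finset.sum_add_distrib, ← Finset.mul_sum, Finset.sum_const, Finset.card_range,
    nsmul_eq_mul]
  push_cast
  generalize (∑ i ∈ Finset.range (n+1), (2 + Real.sqrt 3)^i * (2 - Real.sqrt 3)^(n-i)) = S at *
  generalize (∑ i ∈ Finset.range (n+1), (2 - Real.sqrt 3)^i * (2 + Real.sqrt 3)^(n-i)) = S' at *
  have hS : S = ((2 + Real.sqrt 3)^(n+1) - (2 - Real.sqrt 3)^(n+1)) * (Real.sqrt 3 / 6) := by
    rw [← g]; linear_combination (-S/3) * hs
  have hS' : S' = ((2 + Real.sqrt 3)^(n+1) - (2 - Real.sqrt 3)^(n+1)) * (Real.sqrt 3 / 6) := by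
    linear_combination (-S'/3) * hs - Real.sqrt 3 / 6 * g2
  rw [hS, hS']; ring

noncomputable def Gmat (n : ℕ) : Matrix (Fin (n+1)) (Fin (n+1)) ℝ :=
  Matrix.of fun k j => 7 * wgt n k * wgt n j * Hm n k j / (3 * useq n - useq (n-1))

lemma W_pos (n : ℕ) (hn : 2 ≤ n) : 0 < 3 * useq n - useq (n-1) := by
  rw [W_closed n hn]
  have := ab_pos n
  positivity

lemma N_mul_G (n : ℕ) (hn : 2 ≤ n) : Nmat n * Gmat n = 1 := by
  ext i j
  have hW := W_pos n hn
  have hwi := wgt_pos n i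
  rw [Matrix.mul_apply]
  have e : ∀ k : Fin (n+1), Nmat n i k * Gmat n k j =
      (fun k : ℕ => wgt n j / wgt n i / (3 * useq n - useq (n-1)) * (Tm n i k * Hm n k j)) k := by
    intro k
    have h := Nmat_wgt n hn i k
    simp only [Gmat, Matrix.of_apply]
    rw [show Nmat n i k * (7 * wgt n k * wgt n j * Hm n k j / (3 * useq n - useq (n-1)))
      = (Nmat n i k * wgt n k) * (7 * wgt n j * Hm n k j / (3 * useq n - useq (n-1))) by ring, h]
    field_simp
  rw [Finset.sum_congr rfl (fun k _ => e k),
    Fin.sum_univ_eq_sum_range (fun k : ℕ => wgt n j / wgt n i / (3 * useq n - useq (n-1)) * (Tm n i k * Hm n k j)),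
    ← Finset.mul_sum, TH n hn i j (by omega) (by omega), Matrix.one_apply]
  by_cases h : i = j
  · subst h; simp; field_simp
  · have : ¬ (i.val = j.val) := fun h' => h (Fin.ext h')
    simp [h, this]

lemma trace_G (n : ℕ) (hn : 2 ≤ n) : (Gmat n).trace =
    (7 * (∑ i ∈ Finset.range (n+1), useq i * useq (n-i)) - 4 * useq n)
      / (3 * useq n - useq (n-1)) := by
  have hr : Real.sqrt 35 ^ 2 = 35 := Real.sq_sqrt (by norm_num)
  have hw : ∀ i, wgt n i * wgt n i = 1 - (if i = 0 then 2/7 else 0) - (if i = n then 2/7 else 0) := by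
    intro i
    unfold wgt
    by_cases h : i = 0
    · simp [h, show ¬ (0 = n) by omega]; ring_nf; rw [hr]; norm_num
    · by_cases h2 : i = n
      · simp [h2, show ¬ (n = 0) by omega]; ring_nf; rw [hr]; norm_num
      · simp [h, h2]
  have e : (Gmat n).trace = ∑ i ∈ Finset.range (n+1),
      (useq i * useq (n-i) - (if i = 0 then 2/7 * (useq i * useq (n-i)) else 0)
        - (if i = n then 2/7 * (useq i * useq (n-i)) else 0)) * (7 / (3 * useq n - useq (n-1))) := by
    rw [← Fin.sum_univ_eq_sum_range, Matrix.trace]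
    refine Finset.sum_congr rfl fun i _ => ?_
    simp only [Gmat, Matrix.diag_apply, Matrix.of_apply, Hm, min_self, max_self]
    rw [show 7 * wgt n i * wgt n i * (useq i * useq (n - i)) / (3 * useq n - useq (n-1))
      = (wgt n i * wgt n i) * (useq i * useq (n-i)) * (7 / (3 * useq n - useq (n-1))) by ring, hw]
    congr 1
    split_ifs <;> ring
  rw [e, ← Finset.sum_mul]
  simp only [Finset.sum_sub_distrib]
  rw [Finset.sum_ite_eq', Finset.sum_ite_eq']
  simp [useq]
  ring

lemma rev_prod {ι : Type*} (s : Finset ι) (β : ι → ℝ) :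
    (∏ j ∈ s, (X - C (β j))).reverse = ∏ j ∈ s, (1 - C (β j) * X) := by
  classical
  induction s using Finset.induction_on with
  | empty => simp [← C_1, -map_one]
  | insert a s ha ih =>
    rw [Finset.prod_insert ha, Finset.prod_insert ha, reverse_mul_of_domain, ih]
    congr 1
    rw [sub_eq_add_neg, ← C_neg, reverse_add_C]
    have hX : (X : ℝ[X]).reverse = 1 := by
      have := reverse_mul_X (1 : ℝ[X])
      rw [one_mul, ← C_1, reverse_C] at this
      exact this
    rw [hX]; simp [sub_eq_add_neg]

lemma trace_inv {m : ℕ} (A : Matrix (Fin m) (Fin m) ℝ) (hA : IsUnit A)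
    (β : Fin m → ℝ) (hpos : ∀ j, 0 < β j) (h : A.charpoly = ∏ j, (X - C (β j))) :
    A⁻¹.trace = ∑ j, 1 / β j := by
  have hdet : A.det = ∏ j, β j := by
    rw [Matrix.det_eq_sign_charpoly_coeff, h, coeff_zero_eq_eval_zero, eval_prod]
    simp [Finset.prod_neg, ← mul_assoc, ← mul_pow]
  have hc : A⁻¹.charpoly = ∏ j, (X - C (1 / β j)) := by
    rw [Matrix.charpoly_inv A hA, ← Matrix.reverse_charpoly, h, rev_prod, hdet,
      Ring.inverse_eq_inv', ← Finset.prod_inv_distrib, map_prod, Fintype.card,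
      ← Finset.prod_const, ← Finset.prod_mul_distrib, ← Finset.prod_mul_distrib]
    refine Finset.prod_congr rfl fun j _ => ?_
    have : C (β j)⁻¹ * C (β j) = 1 := by
      rw [← C_mul, inv_mul_cancel₀ (hpos j).ne', C_1]
    rw [one_div]
    linear_combination X * this
  have hs : A⁻¹.charpoly.Splits := by
    rw [hc]; exact Splits.prod fun j _ => Splits.X_sub_C _
  have e : ((Finset.univ.val.map fun j => 1 / β j).map fun a => X - C a).prod
      = ∏ j, (X - C (1 / β j)) := by
    rw [Multiset.map_map]; rfl
  rw [Matrix.trace_eq_sum_roots_charpoly_of_splits hs, hc, ← e, roots_multiset_prod_X_sub_C]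
  rfl

/-- Let `0 < β_1 ≤ β_2 ≤ … ≤ β_{n+1}` be the eigenvalues (with multiplicity) of `N`.
Then `∑_{j=1}^{n+1} 1/β_j` equals the stated closed form. -/
theorem sum_inv_eigenvalues_Nmat (n : ℕ) (hn : 2 ≤ n)
    (β : Fin (n+1) → ℝ) (hmono : Monotone β) (hpos : ∀ j, 0 < β j)
    (hchar : (Nmat n).charpoly = ∏ j, (X - C (β j))) :
    (∑ j : Fin (n+1), 1 / β j)
      = (Real.sqrt 3 * (7 * (n : ℝ) - 9)
            * ((2 + Real.sqrt 3)^(n+1) + (2 - Real.sqrt 3)^(n+1))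
          - 4 * ((2 + Real.sqrt 3)^n - (2 - Real.sqrt 3)^n))
        / (6 * ((2 + Real.sqrt 3)^(n+1) - (2 - Real.sqrt 3)^(n+1)))
        + 9/2 := by
  have hNG := N_mul_G n hn
  have hinv : (Nmat n)⁻¹ = Gmat n := Matrix.inv_eq_right_inv hNG
  have hu : IsUnit (Nmat n) := (Matrix.isUnit_iff_isUnit_det _).2 (Matrix.isUnit_det_of_right_inverse hNG)
  have ht := trace_inv (Nmat n) hu β hpos hchar
  rw [← ht, hinv, trace_G n hn, conv_closed, W_closed n hn, useq_closed]
  have hab := ab_pos n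
  have hs : Real.sqrt 3 ^ 2 = 3 := Real.sq_sqrt (by norm_num)
  have hsp : 0 < Real.sqrt 3 := by positivity
  rw [div_add_div _ _ (show 6 * ((2 + Real.sqrt 3)^(n+1) - (2 - Real.sqrt 3)^(n+1)) ≠ 0 by positivity) (two_ne_zero), div_eq_div_iff (by positivity) (by positivity)]
  simp only [pow_succ] at *
  generalize (2 + Real.sqrt 3)^n = x at *
  generalize (2 - Real.sqrt 3)^n = y at *
  generalize Real.sqrt 3 = s at *
  have h3 : s ^ 3 = 3 * s := by rw [pow_succ, pow_two]; linear_combination s * hs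
  have h4 : s ^ 4 = 9 := by linear_combination (s^2 + 3) * hs
  have h5 : s ^ 5 = 9 * s := by linear_combination (s^3 + 3 * s) * hs
  ring_nf
  simp only [h3, h4, h5, show s^2 = 3 by linear_combination hs]
  ring
end

section
/- Let n ≥ 2. Then the degree-Kirchhoff index of the strong prism B_n² of the linear polyomino chain with n squares satisfies Kf*(B_n²) = ( √3(7n−9)(7n+3)·[(2+√3)^{n+1} + (2−√3)^{n+1}] − 4(7n+3)·[(2+√3)^n − (2−√3)^n] ) / ( 3·[(2+√3)^{n+1} − (2−√3)^{n+1}] ) + (49/3)n³ + 70n² + 141n + 46. -/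
open Polynomial

open Matrix in
theorem aux_trace {V : Type*} [Fintype V] [DecidableEq V] (M : Matrix V V ℝ) (hM : M.IsHermitian)
    (φ ψ : V → ℝ) (G : Matrix V V ℝ) (hφ : φ ⬝ᵥ φ = 1) (hMφ : M *ᵥ φ = 0)
    (hGM : G * M = 1 - vecMulVec φ ψ) :
    ∑ i, (hM.eigenvalues i)⁻¹ = G.trace - φ ⬝ᵥ (G *ᵥ φ) := by
  set G' := G - vecMulVec (G *ᵥ φ) φ with hG'
  have h1 : G'.trace = G.trace - φ ⬝ᵥ (G *ᵥ φ) := by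
    rw [hG', trace_sub, trace_vecMulVec, dotProduct_comm]
  have hsym : ∀ v : V → ℝ, φ ⬝ᵥ (M *ᵥ v) = 0 := by
    intro v
    have hMT : Mᵀ = M := by
      have := hM.eq
      rwa [conjTranspose_eq_transpose_of_trivial] at this
    rw [dotProduct_mulVec, ← mulVec_transpose, hMT, hMφ, zero_dotProduct]
  have hG'v : ∀ v : V → ℝ, G' *ᵥ v = G *ᵥ v - (φ ⬝ᵥ v) • (G *ᵥ φ) := by
    intro v
    rw [hG', sub_mulVec, vecMulVec_mulVec]
    ext i; simp [mul_comm]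
  have hGMv : ∀ v : V → ℝ, G *ᵥ (M *ᵥ v) = v - (ψ ⬝ᵥ v) • φ := by
    intro v
    rw [mulVec_mulVec, hGM, sub_mulVec, vecMulVec_mulVec, one_mulVec]
    ext i; simp [mul_comm]
  rw [← h1]
  have h2 : G'.trace = ∑ i, (hM.eigenvectorBasis i).ofLp ⬝ᵥ (G' *ᵥ (hM.eigenvectorBasis i).ofLp) := by
    have := LinearMap.trace_eq_sum_inner (Matrix.toEuclideanLin G') hM.eigenvectorBasis
    have h3 : LinearMap.trace ℝ _ (Matrix.toEuclideanLin G') = G'.trace := by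
      rw [LinearMap.trace_eq_matrix_trace ℝ (PiLp.basisFun 2 ℝ V)]
      congr 1
      ext i j
      simp [LinearMap.toMatrix_apply, Matrix.toLpLin_apply]
    rw [← h3, this]
    refine Finset.sum_congr rfl fun i _ => ?_
    simp [EuclideanSpace.inner_eq_star_dotProduct, Matrix.toLpLin_apply, dotProduct_comm]
  rw [h2]
  refine Finset.sum_congr rfl fun i _ => ?_
  set v := (hM.eigenvectorBasis i).ofLp with hv
  have hev : M *ᵥ v = (hM.eigenvalues i) • v := hM.mulVec_eigenvectorBasis i
  have hvv : v ⬝ᵥ v = 1 := by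
    have := hM.eigenvectorBasis.orthonormal.1 i
    have h4 : inner ℝ (hM.eigenvectorBasis i) (hM.eigenvectorBasis i) = (1:ℝ) := by
      rw [real_inner_self_eq_norm_sq, this]; norm_num
    rw [EuclideanSpace.inner_eq_star_dotProduct] at h4
    simpa only [star_trivial] using h4
  set μ := hM.eigenvalues i
  have h5 := hGMv v
  rw [hev, mulVec_smul] at h5
  rw [hG'v]
  by_cases hμ : μ = 0
  · rw [hμ, zero_smul] at h5
    have h6 : v = (ψ ⬝ᵥ v) • φ := (sub_eq_zero.mp h5.symm)
    set c := ψ ⬝ᵥ v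
    rw [hμ, h6, mulVec_smul, dotProduct_smul c φ φ, hφ]
    simp
  · have h7 : φ ⬝ᵥ v = 0 := by
      have := hsym v
      rw [hev, dotProduct_smul, smul_eq_mul] at this
      exact (mul_eq_zero.mp this).resolve_left hμ
    rw [h7, zero_smul, sub_zero]
    have h8 := congrArg (fun w => v ⬝ᵥ w) h5
    simp only [dotProduct_smul, dotProduct_sub, smul_eq_mul, hvv, dotProduct_comm v φ, h7] at h8
    field_simp
    linarith

open Matrix in
theorem aux_lam {V : Type*} [Fintype V] [DecidableEq V] (M : Matrix V V ℝ) (hM : M.PosSemidef)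
    (φ : V → ℝ) (hφ : φ ≠ 0) (hMφ : M *ᵥ φ = 0) (N : ℕ) (lam : Fin (N+1) → ℝ)
    (hmono : Monotone lam) (hchar : M.charpoly = ∏ k, (X - C (lam k))) :
    ∑ k ∈ Finset.univ.filter (fun k : Fin (N+1) => k.val ≠ 0), 1 / lam k
      = ∑ i, (hM.isHermitian.eigenvalues i)⁻¹ := by
  have hroots : Multiset.map lam Finset.univ.val
      = Multiset.map hM.isHermitian.eigenvalues Finset.univ.val := by
    have h1 := hM.isHermitian.roots_charpoly_eq_eigenvalues
    rw [hchar, Polynomial.roots_prod _ _ (by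
      simp [Finset.prod_ne_zero_iff, Polynomial.X_sub_C_ne_zero])] at h1
    simpa using h1
  have hsum : ∑ k, 1 / lam k = ∑ i, (hM.isHermitian.eigenvalues i)⁻¹ := by
    have := congrArg (fun s => (Multiset.map (fun x : ℝ => x⁻¹) s).sum) hroots
    simp only [Multiset.map_map] at this
    simp only [one_div]
    exact this
  have hnn : ∀ k, 0 ≤ lam k := by
    intro k
    have : lam k ∈ Multiset.map hM.isHermitian.eigenvalues Finset.univ.val := by
      rw [← hroots]; exact Multiset.mem_map_of_mem _ (Finset.mem_univ k)
    obtain ⟨i, -, hi⟩ := Multiset.mem_map.mp this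
    rw [← hi]; exact hM.eigenvalues_nonneg i
  have hdet : M.det = 0 := Matrix.exists_mulVec_eq_zero_iff.mp ⟨φ, hφ, hMφ⟩
  have h0 : lam 0 = 0 := by
    have h2 : M.charpoly.eval 0 = 0 := by
      rw [Matrix.eval_charpoly]
      simp [Matrix.det_neg, hdet]
    rw [hchar, Polynomial.eval_prod, Finset.prod_eq_zero_iff] at h2
    obtain ⟨k, -, hk⟩ := h2
    have hk' : lam k = 0 := by simpa using hk
    exact le_antisymm (hk' ▸ hmono (Fin.zero_le k)) (hnn 0)
  rw [← hsum, Finset.sum_filter]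
  refine Finset.sum_congr rfl fun k _ => ?_
  by_cases hk : k.val = 0
  · have : k = 0 := Fin.ext hk
    simp [this, h0]
  · simp [hk]

open Matrix in
open scoped Classical in
theorem aux_graph {V : Type*} [Fintype V] [DecidableEq V] (G : SimpleGraph V)
    (d : V → ℝ) (hd : ∀ v, d v = ∑ w, if G.Adj v w then (1:ℝ) else 0) (hpos : ∀ v, 0 < d v)
    [Nonempty V]
    (H : V → V → ℝ) (τ : V → ℝ)
    (hH : ∀ x y, d y * H x y - ∑ z, (if G.Adj y z then H x z else 0)
      = (if x = y then 1 else 0) - τ y)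
    (N : ℕ) (lam : Fin (N+1) → ℝ)
    (hmono : Monotone lam) (hchar : (normLap G).charpoly = ∏ k, (X - C (lam k))) :
    ∑ k ∈ Finset.univ.filter (fun k : Fin (N+1) => k.val ≠ 0), 1 / lam k
      = ∑ x, d x * H x x - (∑ x, ∑ y, d x * d y * H x y) / ∑ x, d x := by
  have hdeg : ∀ v, (G.degree v : ℝ) = d v := by
    intro v; rw [hd, SimpleGraph.degree_eq_sum_if_adj]
  have hs : ∀ v, 0 < √(d v) := fun v => Real.sqrt_pos.mpr (hpos v)
  have hss : ∀ v, √(d v) * √(d v) = d v := fun v => Real.mul_self_sqrt (hpos v).le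
  have hent : ∀ x y, normLap G x y
      = (√(d x))⁻¹ * ((if x = y then d y else 0) - if G.Adj y x then 1 else 0) * (√(d y))⁻¹ := by
    intro x y
    have h1 := hs x
    have h2 := hs y
    simp only [normLap, Matrix.of_apply, hdeg]
    rw [Real.sqrt_mul (hpos x).le]
    by_cases hxy : x = y
    · subst hxy
      simp
      nth_rewrite 2 [← hss x]
      field_simp
    · simp only [hxy, if_false, G.adj_comm y x]
      split_ifs
      · field_simp; ring
      · simp
  have hM : normLap G = (diagonal fun v => (√(d v))⁻¹)ᴴ * G.lapMatrix ℝ * diagonal fun v => (√(d v))⁻¹ := by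
    ext x y
    rw [hent]
    simp [Matrix.mul_diagonal, Matrix.diagonal_mul, SimpleGraph.lapMatrix, SimpleGraph.degMatrix,
      SimpleGraph.adjMatrix_apply, Matrix.diagonal_apply, hdeg, G.adj_comm y x, Matrix.diagonal_conjTranspose]
    left
    by_cases hxy : x = y
    · subst hxy; simp
    · simp [hxy]
  have hpsd : (normLap G).PosSemidef := by
    rw [hM]; exact (G.posSemidef_lapMatrix ℝ).conjTranspose_mul_mul_same _
  set T := ∑ x, d x with hT
  have hTpos : 0 < T := Finset.sum_pos (fun v _ => hpos v) Finset.univ_nonempty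
  have hsT : 0 < √T := Real.sqrt_pos.mpr hTpos
  have hsTT : √T * √T = T := Real.mul_self_sqrt hTpos.le
  set φ : V → ℝ := fun v => √(d v) / √T with hφdef
  have hφ1 : φ ⬝ᵥ φ = 1 := by
    simp only [dotProduct, hφdef]
    have : ∀ v, √(d v) / √T * (√(d v) / √T) = d v / T := by
      intro v; rw [div_mul_div_comm, hss, hsTT]
    simp only [this]
    rw [← Finset.sum_div, ← hT, div_self hTpos.ne']
  have hφ0 : φ ≠ 0 := by
    rintro h; rw [h] at hφ1; simp at hφ1
  have hMφ : normLap G *ᵥ φ = 0 := by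
    ext x
    simp only [mulVec, dotProduct, hent, hφdef, Pi.zero_apply]
    have : ∀ y, (√(d x))⁻¹ * ((if x = y then d y else 0) - if G.Adj y x then (1:ℝ) else 0)
        * (√(d y))⁻¹ * (√(d y) / √T)
        = (√(d x))⁻¹ / √T * ((if x = y then d y else 0) - if G.Adj x y then (1:ℝ) else 0) := by
      intro y
      have := (hs y).ne'
      rw [G.adj_comm y x]
      field_simp
    simp only [this]
    rw [← Finset.mul_sum, Finset.sum_sub_distrib, ← hd]
    simp
  set ψ : V → ℝ := fun y => √T * τ y * (√(d y))⁻¹ with hψ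
  set K : Matrix V V ℝ := of fun x y => √(d x) * H x y * √(d y) with hK
  have hKM : K * normLap G = 1 - vecMulVec φ ψ := by
    ext x y
    simp only [mul_apply, hK, of_apply, hent, Matrix.sub_apply, one_apply, vecMulVec_apply, hφdef, hψ]
    have h1 : ∀ z, √(d x) * H x z * √(d z) * ((√(d z))⁻¹ *
        ((if z = y then d y else 0) - if G.Adj y z then (1:ℝ) else 0) * (√(d y))⁻¹)
        = √(d x) * (√(d y))⁻¹ * ((if z = y then d y * H x z else 0)
          - if G.Adj y z then H x z else 0) := by
      intro z
      have := (hs z).ne'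
      have := (hs y).ne'
      split_ifs <;> field_simp <;> ring
    simp only [h1]
    rw [← Finset.mul_sum, Finset.sum_sub_distrib, Finset.sum_ite_eq' Finset.univ y]
    simp only [Finset.mem_univ, if_true]
    rw [hH]
    have := (hs y).ne'
    by_cases hxy : x = y
    · subst hxy; simp only [if_true]; field_simp
    · simp only [hxy, if_false]; field_simp; ring
  rw [aux_lam (normLap G) hpsd φ hφ0 hMφ N lam hmono hchar,
    aux_trace (normLap G) hpsd.isHermitian φ ψ K hφ1 hMφ hKM]
  congr 1
  · simp only [trace, diag, hK, of_apply]
    refine Finset.sum_congr rfl fun x _ => ?_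
    nth_rewrite 3 [← hss x]; ring
  · simp only [dotProduct, mulVec, hK, of_apply, hφdef, Finset.mul_sum, Finset.sum_div]
    refine Finset.sum_congr rfl fun x _ => Finset.sum_congr rfl fun y _ => ?_
    have e1 : √(d x) / √T * (√(d x) * H x y * √(d y) * (√(d y) / √T))
        = (√(d x) * √(d x)) * (√(d y) * √(d y)) * H x y / (√T * √T) := by
      field_simp
    rw [e1, hss, hss, hsTT]

theorem aux_adj (n : ℕ) (j k : Fin (n+1)) (s s' t t' : Bool) :
    (strongPrism (Bgraph n)).Adj ((j, s), t) ((k, s'), t') ↔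
      (k = j ∧ ¬ (s' = s ∧ t' = t)) ∨ (s' = s ∧ k.val + 1 = j.val) ∨ (s' = s ∧ j.val + 1 = k.val) := by
  simp only [strongPrism, Bgraph, SimpleGraph.fromRel_adj, Prod.mk.injEq, ne_eq, Fin.ext_iff]
  grind

theorem aux_sumB (n : ℕ) (j : Fin (n+1)) (h : ℕ → ℝ) :
    (∑ k : Fin (n+1), if k.val + 1 = j.val then h k.val else 0)
      = if 0 < j.val then h (j.val - 1) else 0 := by
  split_ifs with hj
  · rw [Finset.sum_eq_single (⟨j.val - 1, by omega⟩ : Fin (n+1))]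
    · rw [if_pos]; simp only; omega
    · intro b _ hb
      rw [if_neg]
      intro h'; apply hb; ext; simp only; omega
    · simp
  · apply Finset.sum_eq_zero
    intro k _
    rw [if_neg]; omega

theorem aux_sumC (n : ℕ) (j : Fin (n+1)) (h : ℕ → ℝ) :
    (∑ k : Fin (n+1), if j.val + 1 = k.val then h k.val else 0)
      = if j.val < n then h (j.val + 1) else 0 := by
  split_ifs with hj
  · rw [Finset.sum_eq_single (⟨j.val + 1, by omega⟩ : Fin (n+1))]
    · simp
    · intro b _ hb
      rw [if_neg]
      intro h'; apply hb; ext; simp only; omega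
    · simp
  · apply Finset.sum_eq_zero
    intro k _
    rw [if_neg]; omega

open scoped Classical in
theorem aux_nbr (n : ℕ) (f : ℕ → Bool → Bool → ℝ) (j : Fin (n+1)) (s t : Bool) :
    (∑ z : (Fin (n+1) × Bool) × Bool, if (strongPrism (Bgraph n)).Adj ((j, s), t) z
        then f z.1.1.val z.1.2 z.2 else 0)
      = f j s (!t) + f j (!s) t + f j (!s) (!t)
        + (if 0 < j.val then f (j.val - 1) s t + f (j.val - 1) s (!t) else 0)
        + (if j.val < n then f (j.val + 1) s t + f (j.val + 1) s (!t) else 0) := by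
  have key : ∀ (k : Fin (n+1)) (s' t' : Bool),
      (if (strongPrism (Bgraph n)).Adj ((j, s), t) ((k, s'), t') then f k.val s' t' else 0)
      = (if k = j then (if s' = s ∧ t' = t then 0 else f k.val s' t') else 0)
        + (if k.val + 1 = j.val then (if s' = s then f k.val s' t' else 0) else 0)
        + (if j.val + 1 = k.val then (if s' = s then f k.val s' t' else 0) else 0) := by
    intro k s' t'
    simp only [aux_adj, Fin.ext_iff]
    by_cases h1 : k.val = j.val
    · have h2 : ¬ (k.val + 1 = j.val) := by omega
      have h3 : ¬ (j.val + 1 = k.val) := by omega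
      by_cases h4 : s' = s ∧ t' = t <;> simp [h1, h4]
    · by_cases h2 : k.val + 1 = j.val
      · have h3 : ¬ (j.val + 1 = k.val) := by omega
        simp [h1, h2, h3]
      · by_cases h3 : j.val + 1 = k.val <;> simp [h1, h2, h3]
  simp only [Fintype.sum_prod_type, key, Fintype.sum_bool]
  have e : ∀ k : Fin (n+1), 
      (((if k = j then (if true = s ∧ true = t then 0 else f k.val true true) else 0)
        + (if k.val + 1 = j.val then (if true = s then f k.val true true else 0) else 0)
        + (if j.val + 1 = k.val then (if true = s then f k.val true true else 0) else 0)
        + ((if k = j then (if true = s ∧ false = t then 0 else f k.val true false) else 0)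
        + (if k.val + 1 = j.val then (if true = s then f k.val true false else 0) else 0)
        + (if j.val + 1 = k.val then (if true = s then f k.val true false else 0) else 0)))
      + ((if k = j then (if false = s ∧ true = t then 0 else f k.val false true) else 0)
        + (if k.val + 1 = j.val then (if false = s then f k.val false true else 0) else 0)
        + (if j.val + 1 = k.val then (if false = s then f k.val false true else 0) else 0)
        + ((if k = j then (if false = s ∧ false = t then 0 else f k.val false false) else 0)
        + (if k.val + 1 = j.val then (if false = s then f k.val false false else 0) else 0)
        + (if j.val + 1 = k.val then (if false = s then f k.val false false else 0) else 0))))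
      = (if k = j then f k.val s (!t) + f k.val (!s) t + f k.val (!s) (!t) else 0)
        + (if k.val + 1 = j.val then f k.val s t + f k.val s (!t) else 0)
        + (if j.val + 1 = k.val then f k.val s t + f k.val s (!t) else 0) := by
    intro k
    cases s <;> cases t <;> simp <;> split_ifs <;> ring
  simp only [e]
  rw [Finset.sum_add_distrib, Finset.sum_add_distrib,
    aux_sumB n j (fun k => f k s t + f k s (!t)), aux_sumC n j (fun k => f k s t + f k s (!t)),
    Finset.sum_ite_eq' Finset.univ j]
  simp

/-- The solution of the recursion `a (k+2) = 4 a (k+1) - a k` with `a 0 = 1`, `a 1 = 3`. -/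
noncomputable def aSeq : ℕ → ℝ
  | 0 => 1
  | 1 => 3
  | (k+2) => 4 * aSeq (k+1) - aSeq k

theorem aSeq_wronsk (j : ℕ) : ∀ k : ℕ,
    aSeq (j+1) * aSeq (k+1) - aSeq j * aSeq k = aSeq (j+k+2) - aSeq (j+k+1) := by
  induction j with
  | zero => intro k; simp only [zero_add, aSeq]; ring
  | succ j ih =>
    intro k
    have h := ih (k+1)
    have e1 : j + (k+1) + 2 = j + 1 + k + 2 := by ring
    have e2 : j + (k+1) + 1 = j + 1 + k + 1 := by ring
    rw [e1, e2] at h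
    rw [← h]
    simp only [aSeq]
    ring

theorem aSeq_closed (k : ℕ) : aSeq k = (1 + 1/√3)/2 * (2+√3)^k + (1 - 1/√3)/2 * (2-√3)^k ∧
    aSeq (k+1) = (1 + 1/√3)/2 * (2+√3)^(k+1) + (1 - 1/√3)/2 * (2-√3)^(k+1) := by
  have h3 : √3 * √3 = 3 := Real.mul_self_sqrt (by norm_num)
  have h0 : √3 ≠ 0 := by positivity
  induction k with
  | zero =>
    constructor
    · simp [aSeq]; ring
    · simp [aSeq]; field_simp; ring
  | succ k ih =>
    refine ⟨ih.2, ?_⟩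
    rw [aSeq, ih.1, ih.2]
    linear_combination (-(1 + 1/√3)/2 * (2+√3)^k - (1 - 1/√3)/2 * (2-√3)^k) * h3

theorem aSeq_diff (n : ℕ) :
    aSeq (n+1) - aSeq n = ((2+√3)^(n+1) - (2-√3)^(n+1)) / √3 := by
  have h3 : √3 * √3 = 3 := Real.mul_self_sqrt (by norm_num)
  have h0 : √3 ≠ 0 := by positivity
  rw [(aSeq_closed n).1, (aSeq_closed n).2]
  field_simp
  linear_combination ((2+√3)^n - (2-√3)^n) * h3

theorem pow_diff_pos (n : ℕ) : 0 < (2+√3)^(n+1) - (2-√3)^(n+1) := by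
  have h0 : 0 < √3 := by positivity
  have h2 : √3 < 2 := by
    rw [Real.sqrt_lt' (by norm_num)]; norm_num
  have := pow_lt_pow_left₀ (show 2 - √3 < 2 + √3 by linarith) (by linarith) (Nat.succ_ne_zero n)
  simpa using this

theorem aSeq_W_pos (n : ℕ) : 0 < aSeq (n+1) - aSeq n := by
  rw [aSeq_diff]; exact div_pos (pow_diff_pos n) (by positivity)

/-- The Green function of the antisymmetric block. -/
noncomputable def hN (n i j : ℕ) : ℝ :=
  if i ≤ j then aSeq i * aSeq (n - j) else aSeq j * aSeq (n - i)

/-- The normalized Green function of the antisymmetric block. -/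
noncomputable def hS (n i j : ℕ) : ℝ := hN n i j / (2 * (aSeq (n+1) - aSeq n))

/-- The kernel of the symmetric block. -/
noncomputable def hA (i j : ℕ) : ℝ := - |(i:ℝ) - j| / 4

/-- Degrees. -/
noncomputable def dd (n i : ℕ) : ℝ := 3 + (if 0 < i then 2 else 0) + (if i < n then 2 else 0)

theorem hN_green (n i j : ℕ) (hn : 1 ≤ n) (hi : i ≤ n) (hj : j ≤ n) :
    (dd n j + 1) * hN n i j - (if 0 < j then 2 * hN n i (j-1) else 0)
      - (if j < n then 2 * hN n i (j+1) else 0)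
      = if i = j then 2 * (aSeq (n+1) - aSeq n) else 0 := by
  unfold hN dd
  rcases lt_trichotomy i j with h | h | h
  · -- `i < j`
    obtain ⟨m, rfl⟩ := Nat.exists_eq_add_of_le hj
    obtain ⟨j, rfl⟩ : ∃ k, j = k + 1 := ⟨j - 1, by omega⟩
    have e1 : j + 1 + m - (j + 1) = m := by omega
    have e2 : j + 1 + m - (j + 1 - 1) = m + 1 := by omega
    have e3 : j + 1 + m - (j + 1 + 1) = m - 1 := by omega
    have g1 : i ≤ j + 1 - 1 := by omega
    have g2 : i ≤ j + 1 + 1 := by omega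
    rw [e1, e2, e3, if_pos h.le, if_pos g1, if_pos g2, if_neg h.ne]
    rcases m with _ | m
    · simp [aSeq]; ring
    · simp [aSeq]; ring
  · subst h
    rw [if_pos rfl]
    obtain ⟨m, rfl⟩ := Nat.exists_eq_add_of_le hi
    have e1 : i + m - i = m := by omega
    have e3 : i + m - (i + 1) = m - 1 := by omega
    rw [e1, e3, if_pos le_rfl, if_pos (Nat.le_succ i)]
    rcases i with _ | i
    · obtain ⟨m, rfl⟩ : ∃ k, m = k + 1 := ⟨m - 1, by omega⟩
      simp [aSeq]; ring
    · have e4 : ¬ (i + 1 ≤ i + 1 - 1) := by omega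
      rw [if_neg e4]
      rcases m with _ | m
      · simp [aSeq]; ring
      · have w := aSeq_wronsk (i+1) m
        have e5 : i + 1 + (m + 1) + 1 = i + 1 + m + 2 := by ring
        have e6 : i + 1 + (m + 1) = i + 1 + m + 1 := by ring
        rw [e5, e6, ← w]
        simp [aSeq]; ring
  · -- `j < i`
    obtain ⟨m, rfl⟩ := Nat.exists_eq_add_of_le hi
    have e1 : i + m - i = m := by omega
    have g0 : ¬ i ≤ j := by omega
    have g1 : ¬ i ≤ j - 1 := by omega
    have g3 : (if i ≤ j + 1 then aSeq i * aSeq (i + m - (j+1)) else aSeq (j+1) * aSeq (i + m - i))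
      = aSeq (j+1) * aSeq m := by
      split_ifs with g
      · have : i = j + 1 := by omega
        rw [this]; congr 2; omega
      · rw [e1]
    have g4 : j < i + m := by omega
    rw [g3, if_neg g0, if_neg g1, if_neg h.ne', e1, if_pos g4, if_pos g4]
    rcases j with _ | j
    · simp [aSeq]; ring
    · simp [aSeq]; ring

theorem hS_green (n i j : ℕ) (hn : 1 ≤ n) (hi : i ≤ n) (hj : j ≤ n) :
    (dd n j + 1) * hS n i j - (if 0 < j then 2 * hS n i (j-1) else 0)
      - (if j < n then 2 * hS n i (j+1) else 0) = if i = j then 1 else 0 := by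
  have hW := (aSeq_W_pos n).ne'
  have h := hN_green n i j hn hi hj
  have h2 : (if i = j then (1:ℝ) else 0)
      = (if i = j then 2 * (aSeq (n+1) - aSeq n) else 0) / (2 * (aSeq (n+1) - aSeq n)) := by
    split_ifs
    · field_simp
    · simp
  rw [h2, ← h]
  unfold hS
  split_ifs <;> ring

theorem hA_green (n i j : ℕ) (hn : 1 ≤ n) (hi : i ≤ n) (hj : j ≤ n) :
    (if 0 < j then hA i j - hA i (j-1) else 0) + (if j < n then hA i j - hA i (j+1) else 0)
     = (if i = j then 1/2 else 0) - ((if j = 0 then 1 else 0) + (if j = n then 1 else 0)) / 4 := by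
  unfold hA
  have up : |(i:ℝ) - ((j+1 : ℕ):ℝ)| = if i ≤ j then |(i:ℝ) - j| + 1 else |(i:ℝ) - j| - 1 := by
    push_cast
    split_ifs with h
    · have : (i:ℝ) ≤ j := by exact_mod_cast h
      rw [abs_of_nonpos (by linarith), abs_of_nonpos (by linarith)]; ring
    · have : (j:ℝ) + 1 ≤ i := by exact_mod_cast (by omega : j + 1 ≤ i)
      rw [abs_of_nonneg (by linarith), abs_of_nonneg (by linarith)]; ring
  have down : 0 < j → |(i:ℝ) - ((j-1 : ℕ):ℝ)| = if j ≤ i then |(i:ℝ) - j| + 1 else |(i:ℝ) - j| - 1 := by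
    intro h0
    obtain ⟨j, rfl⟩ : ∃ k, j = k + 1 := ⟨j - 1, by omega⟩
    simp only [Nat.add_sub_cancel]
    push_cast
    split_ifs with h
    · have : (j:ℝ) + 1 ≤ i := by exact_mod_cast h
      rw [abs_of_nonneg (by linarith), abs_of_nonneg (by linarith)]; ring
    · have : (i:ℝ) ≤ j := by exact_mod_cast (by omega : i ≤ j)
      rw [abs_of_nonpos (by linarith), abs_of_nonpos (by linarith)]; ring
  rw [up]
  by_cases h0 : 0 < j
  · rw [down h0]
    split_ifs <;> first | omega | ring
  · split_ifs <;> first | omega | ring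

/-- The sign character. -/
noncomputable def sg (s s' : Bool) : ℝ := if s = s' then 1 else -1

/-- Generalized inverse of the Laplacian. -/
noncomputable def HH (n i : ℕ) (s t : Bool) (j : ℕ) (s' t' : Bool) : ℝ :=
  (if i = j ∧ s = s' then sg t t' / (2 * (dd n j + 1)) else 0)
    + (hA i j + sg s s' * hS n i j) / 4

theorem dd_pos (n i : ℕ) : 0 < dd n i := by
  unfold dd; split_ifs <;> norm_num

theorem HH_green (n : ℕ) (hn : 1 ≤ n) (i j : ℕ) (hi : i ≤ n) (hj : j ≤ n) (s t s' t' : Bool) :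
    dd n j * HH n i s t j s' t' -
      (HH n i s t j s' (!t') + HH n i s t j (!s') t' + HH n i s t j (!s') (!t')
        + (if 0 < j then HH n i s t (j - 1) s' t' + HH n i s t (j - 1) s' (!t') else 0)
        + (if j < n then HH n i s t (j + 1) s' t' + HH n i s t (j + 1) s' (!t') else 0))
      = (if i = j ∧ s = s' ∧ t = t' then 1 else 0)
        - ((if j = 0 then 1 else 0) + (if j = n then 1 else 0)) / 8 := by
  have hs := hS_green n i j hn hi hj
  have ha := hA_green n i j hn hi hj
  have hp := dd_pos n j
  have hp1 : dd n j + 1 ≠ 0 := by linarith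
  have hdd : dd n j = 3 + (if 0 < j then 2 else 0) + (if j < n then 2 else 0) := rfl
  have hsum : ∀ k, HH n i s t k s' t' + HH n i s t k s' (!t')
      = (hA i k + sg s s' * hS n i k) / 2 := by
    intro k
    unfold HH
    have : sg t (!t') = - sg t t' := by cases t <;> cases t' <;> simp [sg]
    rw [this]
    split_ifs <;> ring
  have hsum2 : HH n i s t j (!s') t' + HH n i s t j (!s') (!t')
      = (hA i j - sg s s' * hS n i j) / 2 := by
    unfold HH
    have : sg t (!t') = - sg t t' := by cases t <;> cases t' <;> simp [sg]
    have h2 : sg s (!s') = - sg s s' := by cases s <;> cases s' <;> simp [sg]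
    rw [this, h2]
    split_ifs <;> ring
  have h3 : HH n i s t j s' (!t') = (hA i j + sg s s' * hS n i j) / 2 - HH n i s t j s' t' := by
    rw [← hsum]; ring
  have h4 : (dd n j + 1) * HH n i s t j s' t' = (if i = j ∧ s = s' then sg t t' / 2 else 0)
      + (dd n j + 1) * ((hA i j + sg s s' * hS n i j) / 4) := by
    unfold HH
    split_ifs
    · field_simp
    · ring
  rw [hsum, hsum]
  have h5 : (if i = j ∧ s = s' ∧ t = t' then (1:ℝ) else 0)
     = (if i = j ∧ s = s' then sg t t' / 2 else 0) + (if i = j then 1 else 0) / 4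
        + sg s s' * (if i = j then 1 else 0) / 4 := by
    by_cases hij : i = j
    · cases s <;> cases s' <;> cases t <;> cases t' <;> simp [sg, hij] <;> norm_num
    · simp [hij]
  have e1 : ∀ q : ℝ, dd n j * q = (dd n j + 1) * q - q := fun q => by ring
  rw [e1, h4, add_assoc (HH n i s t j s' (!t')), hsum2, h3, h5, ← hs]
  have ha' : (if i = j then (1:ℝ) else 0) = 2 * ((if 0 < j then hA i j - hA i (j-1) else 0)
      + (if j < n then hA i j - hA i (j+1) else 0)) +
      ((if j = 0 then 1 else 0) + (if j = n then 1 else 0)) / 2 := by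
    rw [ha]; split_ifs <;> ring
  have e2 : (if i = j ∧ s = s' then sg t t' / 2 else (0:ℝ)) = (if i = j ∧ s = s' then sg t t' / 2 else 0) := rfl
  generalize (if i = j ∧ s = s' then sg t t' / 2 else (0:ℝ)) = Z
  rw [hs] 
  generalize hδ : (if i = j then (1:ℝ) else 0) = δ at *
  rw [hdd] at hs ⊢
  have hs' := congrArg (fun q => sg s s' * q) hs
  clear hs ha e1 e2 h5 h4 h3 hsum hsum2 hp hp1 hdd hδ
  split_ifs at * <;> linarith

/-- Weighted sums against the degrees. -/
theorem dd_sum (n : ℕ) (g : ℕ → ℝ) :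
    ∑ i ∈ Finset.range (n+1), dd n i * g i
      = 7 * (∑ i ∈ Finset.range (n+1), g i) - 2 * g 0 - 2 * g n := by
  have h : ∀ i ∈ Finset.range (n+1), dd n i * g i
      = 7 * g i - (if i = 0 then 2 * g i else 0) - (if i = n then 2 * g i else 0) := by
    intro i hi
    have := Finset.mem_range.mp hi
    unfold dd
    split_ifs <;> first | omega | ring
  rw [Finset.sum_congr rfl h, Finset.sum_sub_distrib, Finset.sum_sub_distrib, ← Finset.mul_sum,
    Finset.sum_ite_eq', Finset.sum_ite_eq']
  simp

theorem dd_sum_one (n : ℕ) : ∑ i ∈ Finset.range (n+1), dd n i = 7 * n + 3 := by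
  have := dd_sum n (fun _ => 1)
  simp at this
  rw [this]; ring

theorem dd_sum_frac (n : ℕ) (hn : 1 ≤ n) :
    ∑ i ∈ Finset.range (n+1), dd n i * (2 / (dd n i + 1)) = 7/4 * (n - 1) + 10/3 := by
  have h : ∀ i ∈ Finset.range (n+1), dd n i * (2 / (dd n i + 1))
      = 7/4 - (if i = 0 then 1/12 else 0) - (if i = n then 1/12 else 0) := by
    intro i hi
    have := Finset.mem_range.mp hi
    unfold dd
    split_ifs <;> first | omega | norm_num
  rw [Finset.sum_congr rfl h, Finset.sum_sub_distrib, Finset.sum_sub_distrib,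
    Finset.sum_ite_eq', Finset.sum_ite_eq']
  simp
  ring

theorem abs_sum (n i : ℕ) (hi : i ≤ n) : ∑ j ∈ Finset.range (n+1), |(i:ℝ) - j|
    = i * (i+1) / 2 + (n - i) * (n - i + 1) / 2 := by
  induction n, hi using Nat.le_induction with
  | base =>
    have : ∀ m, m ≤ i + 1 → ∑ j ∈ Finset.range m, |(i:ℝ) - j| = m * i - m * (m - 1) / 2 := by
      intro m
      induction m with
      | zero => simp
      | succ m ih =>
        intro hm
        rw [Finset.sum_range_succ, ih (by omega), abs_of_nonneg]
        · push_cast; ring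
        · have : (m:ℝ) ≤ i := by exact_mod_cast (by omega : m ≤ i)
          linarith
    rw [this _ le_rfl]; push_cast; ring
  | succ n hn ih =>
    rw [Finset.sum_range_succ, ih, abs_of_nonpos]
    · push_cast; ring
    · have : (i:ℝ) ≤ n := by exact_mod_cast hn
      push_cast; linarith

theorem dist_sum (n : ℕ) :
    ∑ i ∈ Finset.range (n+1), ∑ j ∈ Finset.range (n+1), dd n i * dd n j * |(i:ℝ) - j|
      = 49 * (n * (n+1) * (n+2) / 3) - 14 * n * (n+1) - 14 * n * (n + 1) + 8 * n := by
  have h1 : ∀ i ∈ Finset.range (n+1), ∑ j ∈ Finset.range (n+1), dd n i * dd n j * |(i:ℝ) - j|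
      = dd n i * (7 * ((i:ℝ) * (i+1) / 2 + (n - i) * (n - i + 1) / 2) - 2 * n) := by
    intro i hi
    have hi' : i ≤ n := by have := Finset.mem_range.mp hi; omega
    have hi2 : (i:ℝ) ≤ n := by exact_mod_cast hi'
    simp only [mul_assoc]
    rw [← Finset.mul_sum, dd_sum n (fun j => |(i:ℝ) - j|), abs_sum n i hi',
      abs_of_nonneg (by simp), abs_of_nonpos (by linarith)]
    push_cast; ring
  rw [Finset.sum_congr rfl h1,
    dd_sum n (fun i => 7 * ((i:ℝ) * (i+1) / 2 + (n - i) * (n - i + 1) / 2) - 2 * n)]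
  have h2 : ∀ (x : ℝ) (m : ℕ), ∑ i ∈ Finset.range m,
      (7 * ((i:ℝ) * (i+1) / 2 + (x - i) * (x - i + 1) / 2) - 2 * x)
      = 7 * (m * (m-1) * (2*m-1) / 6 - x * (m * (m-1) / 2) + m * x * (x+1) / 2) - 2 * x * m := by
    intro x m
    induction m with
    | zero => simp
    | succ m ih => rw [Finset.sum_range_succ, ih]; push_cast; ring
  rw [h2]
  push_cast; ring

theorem conv_sum (n : ℕ) : ∑ i ∈ Finset.range (n+1), aSeq i * aSeq (n - i)
    = (n+1) * (((1 + 1/√3)/2)^2 * (2+√3)^n + ((1 - 1/√3)/2)^2 * (2-√3)^n)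
      + 1/3 * (((2+√3)^(n+1) - (2-√3)^(n+1)) / (2*√3)) := by
  have h3 : √3 * √3 = 3 := Real.mul_self_sqrt (by norm_num)
  have h0 : √3 ≠ 0 := by positivity
  set α := 2 + √3 with hα
  set β := 2 - √3 with hβ
  set c := (1 + 1/√3)/2
  set e := (1 - 1/√3)/2
  have hce : 2 * (c * e) = 1/3 := by
    have : 2 * (c * e) = (1 - 1 / (√3 * √3)) / 2 := by
      simp only [c, e]; field_simp; ring
    rw [this, h3]; norm_num
  have h : ∀ i ∈ Finset.range (n+1), aSeq i * aSeq (n - i)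
      = (c^2 * α^n + e^2 * β^n) + c * e * (α^i * β^(n-i)) + c * e * (β^i * α^(n-i)) := by
    intro i hi
    have hi' : i ≤ n := by have := Finset.mem_range.mp hi; omega
    rw [(aSeq_closed i).1, (aSeq_closed (n-i)).1]
    have e1 : α^n = α^i * α^(n-i) := by rw [← pow_add]; congr 1; omega
    have e2 : β^n = β^i * β^(n-i) := by rw [← pow_add]; congr 1; omega
    rw [e1, e2]; simp only [c, e, α, β]; ring
  rw [Finset.sum_congr rfl h, Finset.sum_add_distrib, Finset.sum_add_distrib, ← Finset.mul_sum,
    ← Finset.mul_sum]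
  have g1 := geom_sum₂_mul α β (n+1)
  have g2 := geom_sum₂_mul β α (n+1)
  have hd : α - β = 2 * √3 := by simp only [α, β]; ring
  simp only [Nat.add_sub_cancel] at g1 g2
  have g1' : ∑ i ∈ Finset.range (n+1), α^i * β^(n-i) = (α^(n+1) - β^(n+1)) / (2 * √3) := by
    rw [eq_div_iff (by positivity), ← hd, ← g1]
  have g2' : ∑ i ∈ Finset.range (n+1), β^i * α^(n-i) = (α^(n+1) - β^(n+1)) / (2 * √3) := by
    rw [eq_div_iff (by positivity), ← hd]
    have : β - α = - (α - β) := by ring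
    rw [this] at g2
    simp at g2 ⊢
    linarith
  rw [g1', g2', ← hce]
  simp only [Finset.sum_const, Finset.card_range, nsmul_eq_mul]
  push_cast
  ring

theorem aux_total (n : ℕ) (hn : 1 ≤ n) (S : ℝ)
    (hS' : S = ∑ i ∈ Finset.range (n+1), dd n i * (2 / (dd n i + 1))
        + ∑ i ∈ Finset.range (n+1), dd n i * hS n i i
        + (∑ i ∈ Finset.range (n+1), ∑ j ∈ Finset.range (n+1), dd n i * dd n j * |(i:ℝ) - j|)
          / (4 * (7 * n + 3))) :
    2 * (2 * (7 * (n : ℝ) + 3)) * S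
      = (Real.sqrt 3 * (7 * (n : ℝ) - 9) * (7 * (n : ℝ) + 3)
            * ((2 + Real.sqrt 3)^(n+1) + (2 - Real.sqrt 3)^(n+1))
          - 4 * (7 * (n : ℝ) + 3) * ((2 + Real.sqrt 3)^n - (2 - Real.sqrt 3)^n))
        / (3 * ((2 + Real.sqrt 3)^(n+1) - (2 - Real.sqrt 3)^(n+1)))
        + 49/3 * (n : ℝ)^3 + 70 * (n : ℝ)^2 + 141 * (n : ℝ) + 46 := by
  have h7 : (7 * (n:ℝ) + 3) ≠ 0 := by positivity
  have h3 : √3 ^ 2 = 3 := Real.sq_sqrt (by norm_num)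
  have h0 : √3 ≠ 0 := by positivity
  have hp := (pow_diff_pos n).ne'
  have e1 : ∀ i, hS n i i = aSeq i * aSeq (n - i) / (2 * (aSeq (n+1) - aSeq n)) := by
    intro i; simp [hS, hN]
  have e2 : ∑ i ∈ Finset.range (n+1), dd n i * hS n i i
      = (7 * (∑ i ∈ Finset.range (n+1), aSeq i * aSeq (n - i)) - 4 * aSeq n)
        / (2 * (aSeq (n+1) - aSeq n)) := by
    rw [dd_sum n (fun i => hS n i i)]
    simp only [e1]
    rw [← Finset.sum_div]
    simp [aSeq]; ring
  rw [hS', dd_sum_frac n hn, dist_sum, e2, conv_sum, aSeq_diff, (aSeq_closed n).1]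
  rw [pow_succ (2 + √3) n, pow_succ (2 - √3) n] at hp ⊢
  clear hS' e1 e2
  generalize (2 + √3)^n = P at *
  generalize (2 - √3)^n = Q at *
  generalize √3 = r at *
  generalize (n:ℝ) = x at *
  field_simp
  have h4 : r^3 = 3 * r := by rw [pow_succ, h3]
  have h5 : r^4 = 9 := by rw [show r^4 = (r^2)^2 by ring, h3]; norm_num
  have h6 : r^5 = 9 * r := by rw [pow_succ, h5]
  ring_nf
  simp only [h3, h4, h5, h6]
  ring

/-- Closed formula for the degree-Kirchhoff index of `B_n²`: with
`0 = λ_1 ≤ λ_2 ≤ … ≤ λ_{4n+4}` the ordered eigenvalues (with multiplicity) of the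
normalized Laplacian of `B_n²`, which has `2(7n+3)` edges, the degree-Kirchhoff index
`Kf*(B_n²) = 2m ∑_{k=2}^{4n+4} 1/λ_k` equals the stated closed form. -/
theorem kfStar_strongPrism_closed_form (n : ℕ) (hn : 2 ≤ n)
    (lam : Fin (4*n+4) → ℝ) (hmono : Monotone lam)
    (hchar : (normLap (strongPrism (Bgraph n))).charpoly = ∏ k, (X - C (lam k))) :
    2 * (2 * (7 * (n : ℝ) + 3)) *
        (∑ k ∈ Finset.univ.filter (fun k : Fin (4*n+4) => k.val ≠ 0), 1 / lam k)
      = (Real.sqrt 3 * (7 * (n : ℝ) - 9) * (7 * (n : ℝ) + 3)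
            * ((2 + Real.sqrt 3)^(n+1) + (2 - Real.sqrt 3)^(n+1))
          - 4 * (7 * (n : ℝ) + 3) * ((2 + Real.sqrt 3)^n - (2 - Real.sqrt 3)^n))
        / (3 * ((2 + Real.sqrt 3)^(n+1) - (2 - Real.sqrt 3)^(n+1)))
        + 49/3 * (n : ℝ)^3 + 70 * (n : ℝ)^2 + 141 * (n : ℝ) + 46 := by
  
  classical
  have hn1 : 1 ≤ n := by omega
  let d : (Fin (n+1) × Bool) × Bool → ℝ := fun x => dd n x.1.1.val
  let H : (Fin (n+1) × Bool) × Bool → (Fin (n+1) × Bool) × Bool → ℝ :=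
    fun x y => HH n x.1.1.val x.1.2 x.2 y.1.1.val y.1.2 y.2
  let τ : (Fin (n+1) × Bool) × Bool → ℝ := fun y =>
    ((if y.1.1.val = 0 then 1 else 0) + (if y.1.1.val = n then 1 else 0)) / 8
  have key := aux_graph (strongPrism (Bgraph n)) d
    (by
      rintro ⟨⟨j, s⟩, t⟩
      have h := aux_nbr n (fun _ _ _ => 1) j s t
      convert h.symm using 1
      simp only [d, dd]
      split_ifs <;> norm_num)
    (fun x => dd_pos n _) H τ
    (by
      rintro ⟨⟨i, s⟩, t⟩ ⟨⟨j, s'⟩, t'⟩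
      have h := aux_nbr n (fun k a b => HH n i.val s t k a b) j s' t'
      have g := HH_green n hn1 i.val j.val (by omega) (by omega) s t s' t'
      have e : (if (((i, s), t) : (Fin (n+1) × Bool) × Bool) = ((j, s'), t') then (1:ℝ) else 0)
          = (if i.val = j.val ∧ s = s' ∧ t = t' then 1 else 0) := by
        simp only [Prod.mk.injEq, Fin.ext_iff, and_assoc]
      rw [e]
      simp only [H, d, τ]
      rw [← g, ← h])
    (4*n+3) lam hmono hchar
  apply aux_total n hn1
  refine key.trans ?_
  have t1 : ∑ x, d x = 4 * (7 * n + 3) := by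
    rw [← dd_sum_one n, ← Fin.sum_univ_eq_sum_range, Finset.mul_sum]
    simp only [Fintype.sum_prod_type, Fintype.sum_bool, d]
    refine Finset.sum_congr rfl fun i _ => ?_
    ring
  have t2 : ∑ x, d x * H x x = ∑ i ∈ Finset.range (n+1), dd n i * (2 / (dd n i + 1))
        + ∑ i ∈ Finset.range (n+1), dd n i * hS n i i := by
    rw [← Finset.sum_add_distrib,
      ← Fin.sum_univ_eq_sum_range (fun i => dd n i * (2 / (dd n i + 1)) + dd n i * hS n i i)]
    simp only [Fintype.sum_prod_type, Fintype.sum_bool, d, H]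
    refine Finset.sum_congr rfl fun i _ => ?_
    have hp := dd_pos n i.val
    have hp1 : dd n i.val + 1 ≠ 0 := by linarith
    simp [HH, sg, hA]
    field_simp
    ring
  have t3 : ∑ x, ∑ y, d x * d y * H x y
      = - ∑ i ∈ Finset.range (n+1), ∑ j ∈ Finset.range (n+1), dd n i * dd n j * |(i:ℝ) - j| := by
    rw [← Fin.sum_univ_eq_sum_range
      (fun i => ∑ j ∈ Finset.range (n+1), dd n i * dd n j * |(i:ℝ) - j|), ← Finset.sum_neg_distrib]
    simp only [Fintype.sum_prod_type, Fintype.sum_bool, d, H]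
    refine Finset.sum_congr rfl fun i _ => ?_
    rw [← Fin.sum_univ_eq_sum_range (fun j => dd n i * dd n j * |(i:ℝ) - j|),
      ← Finset.sum_neg_distrib]
    simp only [← Finset.sum_add_distrib]
    refine Finset.sum_congr rfl fun j _ => ?_
    simp only [HH, sg, hA]
    generalize 2 * (dd n j.val + 1) = w
    by_cases hij : i.val = j.val <;> simp [hij] <;> ring
  rw [t1, t2, t3]
  ring
end

section
/- Let n ≥ 2. Then the number of spanning trees of the strong prism B_n² of the linear polyomino chain with n squares satisfies τ(B_n²) = 27 · 2^{8n−3} · √3 · [ (2+√3)^{n+1} − (2−√3)^{n+1} ] (an equality of real numbers, the left side being the natural number τ(B_n²) cast to ℝ). -/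
open Matrix in
lemma bt_det_circ {V : Type*} [Fintype V] [DecidableEq V] (M : Matrix (V × Bool) (V × Bool) ℝ)
    (A B : Matrix V V ℝ) (h : ∀ x s y t, M (x, s) (y, t) = if s = t then A x y else B x y) :
    M.det = (A + B).det * (A - B).det := by
  let e : V × Bool ≃ V ⊕ V := (Equiv.prodComm V Bool).trans (Equiv.boolProdEquivSum V)
  have h1 : M.det = (fromBlocks A B B A).det := by
    rw [← Matrix.det_submatrix_equiv_self e.symm]
    congr 1
    ext i j
    rcases i with i | i <;> rcases j with j | j <;>
      simp [e, Equiv.boolProdEquivSum, h]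
  have h2 : fromBlocks 1 1 0 1 * fromBlocks A B B A * fromBlocks 1 (-1) 0 1
      = fromBlocks (A + B) 0 B (A - B) := by
    simp [fromBlocks_multiply]
    constructor <;> abel
  have h3 := congrArg Matrix.det h2
  rw [det_mul, det_mul, det_fromBlocks_zero₂₁, det_fromBlocks_zero₂₁, det_fromBlocks_zero₁₂] at h3
  rw [h1]
  simpa using h3

open Matrix in
lemma bt_det_addJ {V : Type*} [Fintype V] [DecidableEq V] (L : Matrix V V ℝ) (r : V) (c : ℝ)
    (hr : ∀ i, ∑ j, L i j = 0) (hc : ∀ j, ∑ i, L i j = 0) :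
    (Matrix.of fun i j => L i j + c).det
      = c * (Fintype.card V : ℝ) ^ 2 * (L.updateRow r (Pi.single r 1)).det := by
  set N : ℝ := (Fintype.card V : ℝ) with hN
  set D := L.updateRow r (Pi.single r 1) with hD
  set X : Matrix V V ℝ := Matrix.of fun i j => L i j + c with hX
  have hdet : ∀ u v : V → ℝ, (1 + vecMulVec u v).det = 1 + v ⬝ᵥ u := by
    intro u v
    rw [← det_one_add_replicateCol_mul_replicateRow (ι := Unit) u v]
    congr 2
    ext i j
    simp [vecMulVec, Matrix.mul_apply]
  let e : V → ℝ := Pi.single r 1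
  let o : V → ℝ := fun _ => 1
  have hoo : ∑ i : V, (1:ℝ) = N := by simp [hN]
  have key : (1 + vecMulVec e (o - e)) * X
      = (1 + vecMulVec (c • o + (N * c - c - 1) • e) e) * (D * (1 + vecMulVec o (o - e))) := by
    have hDU : D * (1 + vecMulVec o (o - e)) = L.updateRow r o := by
      rw [Matrix.mul_add, Matrix.mul_one]
      ext i j
      by_cases hi : i = r
      · subst hi
        simp [D, Matrix.mul_apply, vecMulVec, o, e, Pi.single_apply]
      · simp [D, Matrix.mul_apply, vecMulVec, o, e, Pi.single_apply, hi,
          ← Finset.sum_mul, hr]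
    rw [hDU, Matrix.add_mul, Matrix.add_mul, Matrix.one_mul, Matrix.one_mul]
    ext i j
    have hcol : ∑ k, X k j = N * c := by
      simp [X, Finset.sum_add_distrib, hc, hN]
    by_cases hi : i = r
    · subst hi
      simp [Matrix.mul_apply, vecMulVec, o, e, Pi.single_apply, sub_mul,
        hcol]
      ring
    · simp [Matrix.mul_apply, vecMulVec, o, e, Pi.single_apply, hi, X]
  have h3 := congrArg Matrix.det key
  rw [det_mul, det_mul, det_mul, hdet, hdet, hdet] at h3
  have a1 : (o - e) ⬝ᵥ e = 0 := by simp [o, e]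
  have a2 : e ⬝ᵥ (c • o + (N * c - c - 1) • e) = N * c - 1 := by simp [o, e]; ring
  have a3 : (o - e) ⬝ᵥ o = N - 1 := by simp [o, e, dotProduct, hN]
  rw [a1, a2, a3] at h3
  rw [show X.det = (1 + 0) * X.det by ring, h3]
  ring

lemma bt_det_hess (n : ℕ) (A : Matrix (Fin (n+1)) (Fin (n+1)) ℝ) (y : Fin (n+1) → ℝ) (c : ℝ)
    (h1 : ∀ i j : Fin (n+1), i.val + 1 = j.val → A i j = -1)
    (h2 : ∀ i j : Fin (n+1), i.val + 1 < j.val → A i j = 0)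
    (hy : y 0 = 1) (hA : ∀ i, ∑ j, y j * A i j = if i = Fin.last n then c else 0) :
    A.det = c := by
  have h := Matrix.det_updateCol_sum A 0 y
  rw [hy, one_smul] at h
  rw [← h, Matrix.det_succ_column_zero, Finset.sum_eq_single (Fin.last n)]
  · have : (Matrix.submatrix (A.updateCol 0 fun k => ∑ i, y i • A k i)
        (Fin.last n).succAbove Fin.succ).det = (-1) ^ n := by
      rw [Matrix.det_of_isLowerTriangular]
      · rw [Finset.prod_congr rfl (g := fun _ => (-1 : ℝ))]
        · simp
        · intro i _
          simp
          apply h1; simp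
      · intro i j hij
        simp only [OrderDual.toDual_lt_toDual] at hij
        simp
        apply h2; simp; exact hij
    rw [this]
    simp only [Matrix.updateCol_self, smul_eq_mul, hA]
    simp only [Fin.val_last, if_true]
    rw [mul_comm, ← mul_assoc, ← mul_pow]; simp
  · intro i _ hi
    simp [Matrix.updateCol_self, hA, hi]
  · simp

lemma bt_count_eq {V : Type*} (G : SimpleGraph V) :
    spanningTreeCount G = Nat.card {T : SimpleGraph V // T ≤ G ∧ T.IsTree} := by
  unfold spanningTreeCount
  refine Nat.card_congr
    { toFun := fun H => ⟨H.1.spanningCoe, H.1.spanningCoe_le, ?_⟩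
      invFun := fun T => ⟨SimpleGraph.toSubgraph T.1 T.2.1, ?_, ?_⟩
      left_inv := ?_
      right_inv := ?_ }
  · exact (H.1.spanningCoeEquivCoeOfSpanning H.2.1).isTree_iff.2 H.2.2
  · exact SimpleGraph.toSubgraph.isSpanning T.1 T.2.1
  · exact ((SimpleGraph.toSubgraph T.1 T.2.1).spanningCoeEquivCoeOfSpanning
      (SimpleGraph.toSubgraph.isSpanning T.1 T.2.1)).isTree_iff.1 (by exact T.2.2)
  · rintro ⟨H, hs, ht⟩
    apply Subtype.ext
    apply SimpleGraph.Subgraph.ext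
    · exact (SimpleGraph.Subgraph.isSpanning_iff.1 hs).symm
    · rfl
  · rintro ⟨T, h⟩
    rfl

/-- every vertex is sent to the root by iterating `f` -/
def btGood {V : Type*} (r : V) (f : V → V) : Prop := ∀ v, ∃ k, f^[k] v = r

/-- graph of a parent function -/
def btGraph {V : Type*} (f : V → V) : SimpleGraph V := SimpleGraph.fromRel (fun v w => f v = w)

lemma btGraph_adj {V : Type*} (f : V → V) (v w : V) :
    (btGraph f).Adj v w ↔ v ≠ w ∧ (f v = w ∨ f w = v) := by
  simp [btGraph]

lemma btGood_conn {V : Type*} (r : V) (f : V → V) (h : btGood r f) : (btGraph f).Connected := by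
  have key : ∀ k v, f^[k] v = r → (btGraph f).Reachable v r := by
    intro k
    induction k with
    | zero => intro v hv; simp at hv; subst hv; rfl
    | succ k ih =>
      intro v hv
      rw [Function.iterate_succ_apply] at hv
      by_cases hvv : v = f v
      · rw [← hvv] at hv; exact ih v hv
      · have : (btGraph f).Adj v (f v) := by rw [btGraph_adj]; exact ⟨hvv, Or.inl rfl⟩
        exact this.reachable.trans (ih _ hv)
  have : Nonempty V := ⟨r⟩
  refine SimpleGraph.Connected.mk ?_
  intro v w
  obtain ⟨k, hk⟩ := h v
  obtain ⟨l, hl⟩ := h w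
  exact (key k v hk).trans (key l w hl).symm

lemma btGood_tree {V : Type*} [Finite V] (r : V) (f : V → V) (hr : f r = r) (h : btGood r f) :
    (btGraph f).IsTree := by
  have hc := btGood_conn r f h
  rw [SimpleGraph.isTree_iff_connected_and_card]
  refine ⟨hc, le_antisymm ?_ hc.card_vert_le_card_edgeSet_add_one⟩
  have hsub : (btGraph f).edgeSet ⊆ Set.image (fun v => s(v, f v)) ({r}ᶜ : Set V) := by
    intro e
    induction e with
    | _ v w =>
      rw [SimpleGraph.mem_edgeSet, btGraph_adj]
      rintro ⟨hne, h1 | h1⟩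
      · refine ⟨v, ?_, by simp [h1]⟩
        rintro rfl
        exact hne (hr.symm.trans h1)
      · refine ⟨w, ?_, by simp [h1, Sym2.eq_swap]⟩
        rintro rfl
        exact hne (h1.symm.trans hr)
  have h1 : Nat.card (btGraph f).edgeSet ≤ ({r}ᶜ : Set V).ncard := by
    rw [Nat.card_coe_set_eq]
    exact (Set.ncard_le_ncard hsub (Set.toFinite _)).trans (Set.ncard_image_le (Set.toFinite _))
  have h2 := Set.ncard_add_ncard_compl ({r} : Set V)
  rw [Set.ncard_singleton] at h2
  omega

lemma btGood_two {V : Type*} (r : V) (f : V → V) (hr : f r = r) (h : btGood r f) (v : V)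
    (hv : f (f v) = v) : v = r := by
  obtain ⟨k, hk⟩ := h v
  have h2 : ∀ k, f^[k] v = r → v = r := by
    intro k
    induction k using Nat.strong_induction_on with
    | _ k ih =>
      intro hk
      match k, ih, hk with
      | 0, _, hk => exact hk
      | 1, _, hk =>
        simp at hk
        rw [hk, hr] at hv
        exact hv.symm
      | k+2, ih, hk =>
        rw [Function.iterate_succ_apply, Function.iterate_succ_apply, hv] at hk
        exact ih k (by omega) hk
  exact h2 k hk

lemma btGraph_inj {V : Type*} (r : V) (f g : V → V) (hf : f r = r) (hg : g r = r)
    (h : btGood r f) (h' : btGood r g) (hfix : ∀ v, v ≠ r → f v ≠ v)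
    (he : btGraph f = btGraph g) : f = g := by
  by_contra hne
  have step : ∀ v, f v ≠ g v → f (f v) ≠ g (f v) := by
    intro v hv
    have hvr : v ≠ r := by rintro rfl; exact hv (hf.trans hg.symm)
    have ha : (btGraph f).Adj v (f v) := by
      rw [btGraph_adj]; exact ⟨(hfix v hvr).symm, Or.inl rfl⟩
    rw [he, btGraph_adj] at ha
    rcases ha.2 with h1 | h1
    · exact absurd h1.symm hv
    · rw [h1]
      intro h2
      exact hvr (btGood_two r f hf h v h2)
  obtain ⟨v, hv⟩ := Function.ne_iff.1 hne
  have all : ∀ k, f (f^[k] v) ≠ g (f^[k] v) := by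
    intro k
    induction k with
    | zero => exact hv
    | succ k ih => rw [Function.iterate_succ_apply']; exact step _ ih
  obtain ⟨k, hk⟩ := h v
  apply all k
  rw [hk, hf, hg]

lemma btGraph_surj {V : Type*} (r : V) (T : SimpleGraph V) (hT : T.IsTree) :
    ∃ f : V → V, f r = r ∧ (∀ v, v ≠ r → T.Adj v (f v)) ∧ btGood r f ∧ btGraph f = T := by
  have hc := hT.connected
  have hex : ∀ v, v ≠ r → ∃ w, T.Adj v w ∧ T.dist w r < T.dist v r := by
    intro v hv
    obtain ⟨p, hp⟩ := hc.exists_walk_length_eq_dist v r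
    cases p with
    | nil => exact absurd rfl hv
    | cons hadj q =>
      refine ⟨_, hadj, ?_⟩
      rw [← hp, SimpleGraph.Walk.length_cons]
      have := SimpleGraph.dist_le q
      omega
  classical
  choose! F hF using hex
  let f : V → V := fun v => if v = r then r else F v
  have hfr : f r = r := by simp [f]
  have hfv : ∀ v, v ≠ r → f v = F v := fun v hv => by simp [f, hv]
  have hgood : btGood r f := by
    have : ∀ d v, T.dist v r = d → ∃ k, f^[k] v = r := by
      intro d
      induction d using Nat.strong_induction_on with
      | _ d ih =>
        intro v hd
        by_cases hv : v = r
        · exact ⟨0, hv⟩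
        · have h1 := (hF v hv).2
          obtain ⟨k, hk⟩ := ih (T.dist (F v) r) (by omega) (F v) rfl
          exact ⟨k+1, by rw [Function.iterate_succ_apply, hfv v hv, hk]⟩
    exact fun v => this _ v rfl
  refine ⟨f, hfr, fun v hv => by rw [hfv v hv]; exact (hF v hv).1, hgood, ?_⟩
  have hle : btGraph f ≤ T := by
    intro v w
    rw [btGraph_adj]
    have key : ∀ v w, v ≠ w → f v = w → T.Adj v w := by
      intro v w hne h
      by_cases hv : v = r
      · subst hv; exact absurd (hfr.symm.trans h) hne
      · rw [← h, hfv v hv]; exact (hF v hv).1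
    rintro ⟨hne, h | h⟩
    · exact key v w hne h
    · exact (key w v hne.symm h).symm
  have hmin := SimpleGraph.isTree_iff_minimal_connected.1 hT
  exact le_antisymm hle (hmin.2 (btGood_conn r f hgood) hle)

open Matrix Classical in
lemma bt_det_fun {V : Type*} [Fintype V] [DecidableEq V] (r : V) (f : V → V) (hr : f r = r)
    (hfix : ∀ v, v ≠ r → f v ≠ v) :
    (Matrix.of fun v w => if v = r then (Pi.single r 1 : V → ℝ) w
        else (Pi.single v 1 : V → ℝ) w - (Pi.single (f v) 1 : V → ℝ) w).det
      = if btGood r f then 1 else 0 := by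
  set M : Matrix V V ℝ := (Matrix.of fun v w => if v = r then (Pi.single r 1 : V → ℝ) w
        else (Pi.single v 1 : V → ℝ) w - (Pi.single (f v) 1 : V → ℝ) w) with hM
  split_ifs with h
  · let d : V → ℕ := fun v => Nat.find (h v)
    have hd : ∀ v, v ≠ r → d (f v) < d v := by
      intro v hv
      have h1 : f^[d v] v = r := Nat.find_spec (h v)
      have h0 : d v ≠ 0 := by
        intro h0; rw [h0] at h1; exact hv h1
      obtain ⟨k, hk⟩ := Nat.exists_eq_succ_of_ne_zero h0
      rw [hk, Function.iterate_succ_apply] at h1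
      have : d (f v) ≤ k := Nat.find_min' (h (f v)) h1
      omega
    have hbt : BlockTriangular M (OrderDual.toDual ∘ d) := by
      intro v w hvw
      have hvw' : d v < d w := hvw
      have hne : w ≠ v := by rintro rfl; omega
      by_cases hv : v = r
      · subst hv; simp [M, Pi.single_apply, hne]
      · have hne2 : w ≠ f v := by rintro rfl; have := hd v hv; omega
        simp [M, Pi.single_apply, hne, hne2, hv]
    rw [hbt.det]
    apply Finset.prod_eq_one
    intro a _
    have : M.toSquareBlock (OrderDual.toDual ∘ d) a = 1 := by
      ext ⟨v, hv⟩ ⟨w, hw⟩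
      have hdd : d v = d w := by
        have := hv.trans hw.symm
        simpa using this
      rw [Matrix.toSquareBlock_def, Matrix.of_apply, Matrix.one_apply]
      by_cases hvr : v = r
      · subst hvr; simp [M, Pi.single_apply, eq_comm]
      · have hne2 : w ≠ f v := by rintro rfl; have := hd v hvr; omega
        simp [M, Pi.single_apply, hvr, hne2, eq_comm (a := v) (b := w)]
    rw [this, Matrix.det_one]
  · rw [← Matrix.exists_mulVec_eq_zero_iff]
    refine ⟨fun v => if ∃ k, f^[k] v = r then 0 else 1, ?_, ?_⟩
    · intro h0
      apply h
      intro v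
      by_contra hv
      have := congrFun h0 v
      simp only [if_neg hv] at this
      simp at this
    · have hiff : ∀ v, (∃ k, f^[k] (f v) = r) ↔ ∃ k, f^[k] v = r := by
        intro v
        constructor
        · rintro ⟨k, hk⟩; exact ⟨k+1, hk⟩
        · rintro ⟨k, hk⟩
          refine ⟨k, ?_⟩
          rw [← Function.iterate_succ_apply, Function.iterate_succ_apply', hk, hr]
      ext v
      by_cases hv : v = r
      · subst hv
        simp [Matrix.mulVec, dotProduct, M, Pi.single_apply]
        apply Finset.sum_eq_zero
        intro x _
        by_cases hx : x = v
        · subst hx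
          rw [if_pos ⟨0, rfl⟩]
        · simp [hx]
      · simp only [Matrix.mulVec, dotProduct, M, Matrix.of_apply, if_neg hv, sub_mul,
          Finset.sum_sub_distrib, Pi.single_apply, ite_mul, one_mul, zero_mul]
        simp [hiff]

open Matrix Classical in
lemma bt_matrix_tree {V : Type*} [Fintype V] [DecidableEq V] (G : SimpleGraph V)
    [DecidableRel G.Adj] (r : V) :
    ((G.lapMatrix ℝ).updateRow r (Pi.single r 1)).det = (spanningTreeCount G : ℝ) := by
  let A : V → Finset V := fun v => if v = r then {r} else G.neighborFinset v
  let g : V → V → (V → ℝ) := fun v w => if v = r then (Pi.single r 1 : V → ℝ)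
        else (Pi.single v 1 : V → ℝ) - (Pi.single w 1 : V → ℝ)
  have h1 : (G.lapMatrix ℝ).updateRow r (Pi.single r 1) = fun v => ∑ w ∈ A v, g v w := by
    funext v
    by_cases hv : v = r
    · subst hv; simp [A, g]
    · funext w
      simp [A, g, hv, SimpleGraph.lapMatrix, SimpleGraph.degMatrix, Pi.single_apply,
        Matrix.diagonal_apply, SimpleGraph.adjMatrix_apply, eq_comm (a := v) (b := w)]
  have hmem : ∀ f, f ∈ Fintype.piFinset A ↔ f r = r ∧ ∀ v, v ≠ r → G.Adj v (f v) := by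
    intro f
    rw [Fintype.mem_piFinset]
    constructor
    · intro h
      refine ⟨by simpa [A] using h r, fun v hv => by simpa [A, hv] using h v⟩
    · rintro ⟨h0, h⟩ v
      by_cases hv : v = r
      · subst hv; simp [A, h0]
      · simpa [A, hv] using h v hv
  have h2 : ((G.lapMatrix ℝ).updateRow r (Pi.single r 1)).det
      = ∑ f ∈ Fintype.piFinset A, if btGood r f then (1:ℝ) else 0 := by
    rw [h1]
    refine (MultilinearMap.map_sum_finset (Matrix.detRowAlternating (n := V) (R := ℝ)).toMultilinearMap g A).trans ?_
    refine Finset.sum_congr rfl ?_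
    intro f hf
    obtain ⟨hf0, hf1⟩ := (hmem f).1 hf
    rw [← bt_det_fun r f hf0 (fun v hv => (hf1 v hv).ne')]
    change Matrix.det _ = _
    congr 1
    ext v w
    by_cases hv : v = r <;> simp [g, hv]
  rw [h2, Finset.sum_boole, bt_count_eq]
  norm_cast
  rw [← Nat.card_eq_finsetCard]
  refine Nat.card_congr (Equiv.ofBijective
    (fun f => ⟨btGraph f.1, ?_, ?_⟩) ⟨?_, ?_⟩)
  · have hf := f.2
    rw [Finset.mem_filter, hmem] at hf
    intro v w
    rw [btGraph_adj]
    have key : ∀ v w, v ≠ w → f.1 v = w → G.Adj v w := by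
      intro v w hne h
      by_cases hv : v = r
      · subst hv; exact absurd (hf.1.1.symm.trans h) hne
      · rw [← h]; exact hf.1.2 v hv
    rintro ⟨hne, h | h⟩
    · exact key v w hne h
    · exact (key w v hne.symm h).symm
  · have hf := f.2
    rw [Finset.mem_filter, hmem] at hf
    exact btGood_tree r f.1 hf.1.1 hf.2
  · rintro ⟨f, hf⟩ ⟨f', hf'⟩ he
    rw [Finset.mem_filter, hmem] at hf hf'
    apply Subtype.ext
    exact btGraph_inj r f f' hf.1.1 hf'.1.1 hf.2 hf'.2 (fun v hv => (hf.1.2 v hv).ne')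
      (congrArg Subtype.val he)
  · rintro ⟨T, hle, hT⟩
    obtain ⟨f, h1, h2, h3, h4⟩ := btGraph_surj r T hT
    refine ⟨⟨f, ?_⟩, Subtype.ext h4⟩
    rw [Finset.mem_filter, hmem]
    exact ⟨⟨h1, fun v hv => hle (h2 v hv)⟩, h3⟩

lemma bt_prism_adj {V : Type*} (G : SimpleGraph V) (x y : V) (s t : Bool) :
    (strongPrism G).Adj (x, s) (y, t) ↔ (x = y ∧ s ≠ t) ∨ G.Adj x y := by
  unfold strongPrism
  rw [SimpleGraph.fromRel_adj]
  have h1 := G.adj_comm x y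
  have h2 : G.Adj x y → x ≠ y := fun h => h.ne
  simp only [ne_eq, Prod.mk.injEq]
  rw [G.adj_comm y x]
  tauto

lemma bt_prism_deg {V : Type*} [Fintype V] [DecidableEq V] (G : SimpleGraph V)
    [DecidableRel G.Adj] [DecidableRel (strongPrism G).Adj] (x : V) (s : Bool) :
    ((strongPrism G).degree (x, s) : ℝ) = 2 * G.degree x + 1 := by
  rw [SimpleGraph.degree_eq_sum_if_adj, SimpleGraph.degree_eq_sum_if_adj, Fintype.sum_prod_type]
  have : ∀ y, (∑ t : Bool, if (strongPrism G).Adj (x, s) (y, t) then (1:ℝ) else 0)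
      = 2 * (if G.Adj x y then 1 else 0) + if x = y then 1 else 0 := by
    intro y
    simp only [bt_prism_adj]
    by_cases h : x = y
    · subst h; cases s <;> simp
    · by_cases h' : G.Adj x y <;> simp [h, h']
  simp only [this]
  rw [Finset.sum_add_distrib, ← Finset.mul_sum]
  simp

lemma bt_prism_det {V : Type*} [Fintype V] [DecidableEq V] (G : SimpleGraph V)
    [DecidableRel G.Adj] [DecidableRel (strongPrism G).Adj] :
    (Matrix.of fun i j => (strongPrism G).lapMatrix ℝ i j + 1).det
      = 2 ^ Fintype.card V * (Matrix.of fun i j => G.lapMatrix ℝ i j + 1).det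
        * ∏ x, (2 * (G.degree x : ℝ) + 2) := by
  rw [bt_det_circ _
    (Matrix.of fun x y => if x = y then 2 * (G.degree x : ℝ) + 2 else if G.Adj x y then 0 else 1)
    (Matrix.of fun x y => if x = y then 0 else if G.Adj x y then 0 else 1)]
  · congr 1
    · rw [← Matrix.det_smul]
      congr 1
      ext x y
      simp only [Matrix.add_apply, Matrix.of_apply, Matrix.smul_apply, SimpleGraph.lapMatrix,
        SimpleGraph.degMatrix, Matrix.sub_apply, Matrix.diagonal_apply,
        SimpleGraph.adjMatrix_apply, smul_eq_mul]
      by_cases h : x = y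
      · subst h; simp; ring
      · by_cases h' : G.Adj x y <;> simp [h, h']
        norm_num
    · rw [← Matrix.det_diagonal]
      congr 1
      ext x y
      simp only [Matrix.of_apply, Matrix.sub_apply, Matrix.diagonal_apply]
      by_cases h : x = y
      · subst h; simp
      · simp [h]
  · intro x s y t
    simp only [Matrix.of_apply, SimpleGraph.lapMatrix,
        SimpleGraph.degMatrix, Matrix.sub_apply, Matrix.diagonal_apply,
        SimpleGraph.adjMatrix_apply, bt_prism_adj, bt_prism_deg, Prod.mk.injEq]
    by_cases h : x = y
    · subst h
      by_cases hs : s = t <;> simp [hs]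
      ring
    · by_cases h' : G.Adj x y <;> by_cases hs : s = t <;> simp [h, h', hs]

/-- degree in the path -/
noncomputable def btdeg (n i : ℕ) : ℝ := (if i < n then 1 else 0) + (if 0 < i then 1 else 0)

/-- Laplacian of the path -/
noncomputable def btLP (n : ℕ) : Matrix (Fin (n+1)) (Fin (n+1)) ℝ :=
  Matrix.of fun i j => (if i = j then btdeg n i.val else 0)
    - (if i.val + 1 = j.val then 1 else 0) - (if j.val + 1 = i.val then 1 else 0)

lemma bt_sum_next (n : ℕ) (i : Fin (n+1)) (g : ℕ → ℝ) :
    ∑ j : Fin (n+1), (if i.val + 1 = j.val then g j.val else 0)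
      = if i.val < n then g (i.val + 1) else 0 := by
  split_ifs with h
  · rw [Finset.sum_eq_single (⟨i.val + 1, by omega⟩ : Fin (n+1))]
    · simp
    · intro j _ hj
      rw [if_neg]
      intro h'
      exact hj (Fin.ext h'.symm)
    · simp
  · apply Finset.sum_eq_zero
    intro j _
    rw [if_neg]; omega

lemma bt_sum_prev (n : ℕ) (i : Fin (n+1)) (g : ℕ → ℝ) :
    ∑ j : Fin (n+1), (if j.val + 1 = i.val then g j.val else 0)
      = if 0 < i.val then g (i.val - 1) else 0 := by
  split_ifs with h
  · rw [Finset.sum_eq_single (⟨i.val - 1, by omega⟩ : Fin (n+1))]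
    · rw [if_pos]; simp; omega
    · intro j _ hj
      rw [if_neg]
      intro h'
      exact hj (Fin.ext (by simp; omega))
    · simp
  · apply Finset.sum_eq_zero
    intro j _
    rw [if_neg]; omega

lemma btLP_sum (n : ℕ) (i : Fin (n+1)) (y : ℕ → ℝ) :
    ∑ j : Fin (n+1), y j.val * btLP n i j = y i.val * btdeg n i.val
      - (if i.val < n then y (i.val + 1) else 0) - (if 0 < i.val then y (i.val - 1) else 0) := by
  rw [← bt_sum_next n i y, ← bt_sum_prev n i y]
  simp only [btLP, Matrix.of_apply, mul_sub, Finset.sum_sub_distrib]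
  simp

lemma btLP_symm (n : ℕ) (i j : Fin (n+1)) : btLP n i j = btLP n j i := by
  simp only [btLP, Matrix.of_apply]
  by_cases h : i = j
  · subst h; rfl
  · rw [if_neg h, if_neg (Ne.symm h)]; ring

lemma btLP_row (n : ℕ) (i : Fin (n+1)) : ∑ j, btLP n i j = 0 := by
  have := btLP_sum n i (fun _ => 1)
  simp only [one_mul] at this
  rw [this, btdeg]; ring

lemma btLP_detJ (n : ℕ) : (Matrix.of fun i j => btLP n i j + 2).det = 2 * ((n:ℝ) + 1) ^ 2 := by
  rw [bt_det_addJ (btLP n) (Fin.last n) 2 (btLP_row n)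
    (fun j => by simp only [btLP_symm n _ j]; exact btLP_row n j)]
  rw [bt_det_hess n _ (fun _ => 1) 1]
  · simp
  · intro i j h
    have h1 : i ≠ Fin.last n := by rintro rfl; simp at h; omega
    rw [Matrix.updateRow_ne h1]
    have h2 : i ≠ j := by rintro rfl; omega
    simp [btLP, h, h2]; omega
  · intro i j h
    have h1 : i ≠ Fin.last n := by rintro rfl; simp at h; omega
    rw [Matrix.updateRow_ne h1]
    have h2 : i ≠ j := by rintro rfl; omega
    have h3 : i.val + 1 ≠ j.val := by omega
    have h4 : j.val + 1 ≠ i.val := by omega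
    simp [btLP, h2, h3, h4]
  · rfl
  · intro i
    by_cases h : i = Fin.last n
    · subst h
      simp
    · simp only [Matrix.updateRow_ne h, one_mul, btLP_row, if_neg h]

/-- solution of the recurrence -/
noncomputable def bty (i : ℕ) : ℝ :=
  ((1 + √3 / 3) / 2) * (2 + √3) ^ i + ((1 - √3 / 3) / 2) * (2 - √3) ^ i

lemma bty_rec (i : ℕ) : bty (i+2) = 4 * bty (i+1) - bty i := by
  have h : √3 ^ 2 = 3 := Real.sq_sqrt (by norm_num)
  have h1 : (2 + √3) ^ 2 = 4 * (2 + √3) - 1 := by linear_combination h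
  have h2 : (2 - √3) ^ 2 = 4 * (2 - √3) - 1 := by linear_combination h
  unfold bty
  rw [pow_add, pow_add (2 - √3) i 2, h1, h2]
  ring

lemma btLP_det2 (n : ℕ) : (btLP n + (2:ℝ) • 1).det
    = √3 / 3 * ((2 + √3)^(n+1) - (2 - √3)^(n+1)) := by
  have h : √3 ^ 2 = 3 := Real.sq_sqrt (by norm_num)
  have y0 : bty 0 = 1 := by simp [bty]; ring
  have y1 : bty 1 = 3 := by simp [bty]; linear_combination (1/3) * h
  apply bt_det_hess n _ (fun i => bty i.val)
  · intro i j h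
    have h2 : i ≠ j := by rintro rfl; omega
    simp [btLP, h, h2]; omega
  · intro i j h
    have h2 : i ≠ j := by rintro rfl; omega
    have h3 : i.val + 1 ≠ j.val := by omega
    have h4 : j.val + 1 ≠ i.val := by omega
    simp [btLP, h2, h3, h4]
  · simpa using y0
  · intro i
    have h1 : ∑ j, bty j.val * (btLP n + (2:ℝ) • 1) i j
        = (∑ j, bty j.val * btLP n i j) + 2 * bty i.val := by
      simp only [Matrix.add_apply, mul_add, Finset.sum_add_distrib, Matrix.smul_apply,
        Matrix.one_apply]
      simp [mul_comm]
    rw [h1, btLP_sum]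
    have key : ∀ k, bty (k+1) * 3 - bty k = √3 / 3 * ((2 + √3)^(k+2) - (2 - √3)^(k+2)) := by
      intro k
      simp only [bty, pow_add]
      linear_combination (-(√3/3+5/6) * (2+√3)^k + (√3/3 - 5/6) * (2-√3)^k) * h
    simp only [Fin.ext_iff, Fin.val_last]
    obtain ⟨i, hi⟩ := i
    simp only
    by_cases hl : i = n
    · subst hl
      rcases i with _ | k
      · simp [btdeg, y0]; linear_combination (-(2/3)) * h
      · simp [btdeg]
        rw [← key k]; ring
    · have hlt : i < n := by omega
      rcases i with _ | k
      · simp [btdeg, y0, hlt, y1, hl]; norm_num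
      · simp [btdeg, hlt, hl]
        rw [bty_rec k]; ring

lemma bt_B_adj (n : ℕ) (i j : Fin (n+1)) (s t : Bool) :
    (Bgraph n).Adj (i, s) (j, t) ↔
      (s = t ∧ (i.val + 1 = j.val ∨ j.val + 1 = i.val)) ∨ (s ≠ t ∧ i = j) := by
  unfold Bgraph
  rw [SimpleGraph.fromRel_adj]
  simp only [ne_eq, Prod.mk.injEq]
  have h1 : i.val + 1 = j.val → i ≠ j := by rintro h rfl; omega
  have h2 : j.val + 1 = i.val → i ≠ j := by rintro h rfl; omega
  rw [eq_comm (a := t), eq_comm (a := j)]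
  tauto

lemma bt_B_deg (n : ℕ) [DecidableRel (Bgraph n).Adj] (i : Fin (n+1)) (s : Bool) :
    ((Bgraph n).degree (i, s) : ℝ) = btdeg n i.val + 1 := by
  rw [SimpleGraph.degree_eq_sum_if_adj, Fintype.sum_prod_type]
  have : ∀ j : Fin (n+1), (∑ t : Bool, if (Bgraph n).Adj (i, s) (j, t) then (1:ℝ) else 0)
      = (if i.val + 1 = j.val then 1 else 0) + (if j.val + 1 = i.val then 1 else 0)
        + if i = j then 1 else 0 := by
    intro j
    simp only [bt_B_adj]
    by_cases h1 : i.val + 1 = j.val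
    · have h2 : i ≠ j := by rintro rfl; omega
      have h3 : ¬ (j.val + 1 = i.val) := by omega
      cases s <;> simp [h1, h2, h3]
    · by_cases h3 : j.val + 1 = i.val
      · have h2 : i ≠ j := by rintro rfl; omega
        cases s <;> simp [h1, h2, h3]
      · by_cases h2 : i = j <;> cases s <;> simp [h1, h3, h2]
  simp only [this, Finset.sum_add_distrib]
  rw [bt_sum_next n i (fun _ => 1), bt_sum_prev n i (fun _ => 1)]
  simp [btdeg]

lemma bt_B_det (n : ℕ) [DecidableRel (Bgraph n).Adj] :
    (Matrix.of fun i j => (Bgraph n).lapMatrix ℝ i j + 1).det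
      = 2 * ((n:ℝ) + 1) ^ 2 * (√3 / 3 * ((2 + √3)^(n+1) - (2 - √3)^(n+1))) := by
  rw [bt_det_circ _
    (Matrix.of fun i j => btLP n i j + (if i = j then 1 else 0) + 1)
    (Matrix.of fun i j => if i = j then 0 else 1), ← btLP_detJ, ← btLP_det2]
  · congr 2
    · ext i j
      simp only [Matrix.add_apply, Matrix.of_apply]
      split_ifs <;> ring
    · ext i j
      simp only [Matrix.add_apply, Matrix.sub_apply, Matrix.of_apply, Matrix.smul_apply,
        Matrix.one_apply, smul_eq_mul]
      split_ifs <;> ring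
  · intro i s j t
    simp only [Matrix.of_apply, SimpleGraph.lapMatrix,
        SimpleGraph.degMatrix, Matrix.sub_apply, Matrix.diagonal_apply,
        SimpleGraph.adjMatrix_apply, bt_B_adj, bt_B_deg, Prod.mk.injEq, btLP]
    by_cases h : i = j
    · subst h
      by_cases hs : s = t <;> simp [hs]
    · by_cases h1 : i.val + 1 = j.val
      · have h3 : ¬ (j.val + 1 = i.val) := by omega
        by_cases hs : s = t <;> simp [h, hs, h1, h3]
      · by_cases hs : s = t <;> simp [h, hs, h1]

lemma bt_B_prod (n : ℕ) [DecidableRel (Bgraph n).Adj] (hn : 2 ≤ n) :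
    ∏ x, (2 * ((Bgraph n).degree x : ℝ) + 2) = 6 ^ 4 * 8 ^ (2 * (n - 1)) := by
  rw [Fintype.prod_prod_type]
  simp only [bt_B_deg, Fintype.prod_bool]
  obtain ⟨m, rfl⟩ : ∃ m, n = m + 1 := ⟨n - 1, by omega⟩
  rw [Fin.prod_univ_succ, Fin.prod_univ_castSucc]
  have : ∀ i : Fin m, btdeg (m+1) (i.castSucc.succ : Fin (m+2)).val = 2 := by
    intro i
    simp [btdeg]; norm_num
  simp only [this]
  simp [btdeg]
  rw [pow_mul]
  norm_num
  ring

theorem spanningTreeCount_strongPrism_Bgraph (n : ℕ) (hn : 2 ≤ n) :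
    (spanningTreeCount (strongPrism (Bgraph n)) : ℝ)
      = 27 * 2^(8*n-3) * Real.sqrt 3
        * ((2 + Real.sqrt 3)^(n+1) - (2 - Real.sqrt 3)^(n+1)) := by
  classical
  have h1 := bt_det_addJ ((strongPrism (Bgraph n)).lapMatrix ℝ) ((0, false), false) 1
    (fun i => by
      have := congrFun ((strongPrism (Bgraph n)).lapMatrix_mulVec_const_eq_zero (R := ℝ)) i
      simpa [Matrix.mulVec, dotProduct] using this)
    (fun j => by
      have := congrFun ((strongPrism (Bgraph n)).lapMatrix_mulVec_const_eq_zero (R := ℝ)) j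
      rw [← Finset.sum_congr rfl (fun i _ =>
        ((strongPrism (Bgraph n)).isSymm_lapMatrix (R := ℝ)).apply i j)]
      simpa [Matrix.mulVec, dotProduct] using this)
  rw [bt_matrix_tree, bt_prism_det, bt_B_det, bt_B_prod n hn] at h1
  simp only [Fintype.card_prod, Fintype.card_fin, Fintype.card_bool] at h1
  obtain ⟨m, rfl⟩ : ∃ m, n = m + 1 := ⟨n - 1, by omega⟩
  set S := (spanningTreeCount (strongPrism (Bgraph (m+1))) : ℝ)
  set Q := (2 + √3)^(m+1+1) - (2 - √3)^(m+1+1)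
  have hm : ((m:ℝ) + 2) ^ 2 ≠ 0 := by positivity
  have e1 : 8 * (m+1) - 3 = 8 * m + 5 := by omega
  have e2 : m + 1 - 1 = m := by omega
  rw [e1]
  rw [e2] at h1
  push_cast at h1
  have e8 : (8:ℝ) ^ (2 * m) = 2 ^ (6 * m) := by
    rw [show (8:ℝ) = 2 ^ 3 by norm_num, ← pow_mul]; congr 1; ring
  rw [e8] at h1
  apply mul_left_cancel₀ hm
  have : (2:ℝ) ^ ((m + 1 + 1) * 2) = 2 ^ (2 * m) * 16 := by
    rw [show (m+1+1)*2 = 2 * m + 4 by ring, pow_add]; norm_num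
  rw [this] at h1
  rw [show 8 * m + 5 = 2 * m + 6 * m + 5 by ring, pow_add, pow_add]
  linear_combination (-1/16) * h1
end

section
/- As n → ∞, the ratio Kf*(B_n²)/Gut(B_n²) tends to 1/8, i.e., lim_{n→∞} Kf*(B_n²)/Gut(B_n²) = 1/8. -/
open scoped Classical in
/-- The degree-Kirchhoff index `Kf*(G) = 2m ∑_{k=2}^{N} 1/λ_k`, where
`0 = λ_1 < λ_2 ≤ … ≤ λ_N` are the normalized Laplacian eigenvalues of the connected
graph `G` (the roots, with multiplicity, of the characteristic polynomial of
`ℒ(G)`); the zero eigenvalue contributes `1/0 = 0` to the sum. -/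
noncomputable def kfStar {V : Type*} [Fintype V] [DecidableEq V] (G : SimpleGraph V) : ℝ :=
  2 * (Nat.card G.edgeSet) * ((normLap G).charpoly.roots.map (fun t => 1 / t)).sum

open scoped Classical in
/-- The Gutman index `Gut(G) = ∑_{{u,w}} d(u)·d(w)·dist(u,w)`, the sum over all
unordered pairs of distinct vertices (written as half of the ordered double sum,
since `dist u u = 0`). -/
noncomputable def gutmanIndex {V : Type*} [Fintype V] (G : SimpleGraph V) : ℝ :=
  (∑ u : V, ∑ w : V, (G.degree u : ℝ) * (G.degree w) * (G.dist u w)) / 2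

open Matrix
lemma sum_inv_aux {V : Type*} [Fintype V] [DecidableEq V] (U M : Matrix V V ℝ) (l : V → ℝ)
    (h1 : U * Uᵀ = 1) (h2 : Uᵀ * U = 1) (f e : V → ℝ) (he : e ≠ 0)
    (hLe : (U * diagonal l * Uᵀ) *ᵥ e = 0) (hM : (U * diagonal l * Uᵀ) * M = 1 - vecMulVec f e) :
    ∑ k, 1 / l k = M.trace - (e ⬝ᵥ M *ᵥ e) / (e ⬝ᵥ e) := by
  set W := Uᵀ * M * U with hW
  set g := Uᵀ *ᵥ e with hg
  set p := Uᵀ *ᵥ f with hp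
  have eg : e = U *ᵥ g := by rw [hg, mulVec_mulVec, h1, one_mulVec]
  have hWM : M = U * W * Uᵀ := by
    rw [hW]
    calc M = (U * Uᵀ) * M * (U * Uᵀ) := by rw [h1]; simp
      _ = _ := by simp only [Matrix.mul_assoc]
  have htr : M.trace = W.trace := by
    rw [hWM, Matrix.trace_mul_comm, ← Matrix.mul_assoc, h2, Matrix.one_mul]
  have hlg : ∀ k, l k * g k = 0 := by
    intro k
    have : Uᵀ *ᵥ ((U * diagonal l * Uᵀ) *ᵥ e) = 0 := by rw [hLe]; simp
    rw [mulVec_mulVec, ← Matrix.mul_assoc, ← Matrix.mul_assoc, h2, Matrix.one_mul,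
      ← mulVec_mulVec, ← hg] at this
    have := congrFun this k
    simpa [mulVec_diagonal] using this
  have hD : diagonal l * W = 1 - vecMulVec p g := by
    have : Uᵀ * ((U * diagonal l * Uᵀ) * M) * U = Uᵀ * (1 - vecMulVec f e) * U := by rw [hM]
    have e1 : Uᵀ * ((U * diagonal l * Uᵀ) * M) * U = diagonal l * W := by
      calc _ = (Uᵀ * U) * diagonal l * (Uᵀ * M * U) := by simp only [Matrix.mul_assoc]
        _ = _ := by rw [h2, Matrix.one_mul]
    rw [e1] at this
    rw [this, Matrix.mul_sub, Matrix.sub_mul, Matrix.mul_one, h2, mul_vecMulVec, vecMulVec_mul,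
      ← mulVec_transpose]
  have hent : ∀ k m, l k * W k m = (if k = m then 1 else 0) - p k * g m := by
    intro k m
    have := congrFun (congrFun hD k) m
    simpa [diagonal_mul, Matrix.one_apply, vecMulVec_apply] using this
  have hg0 : g ≠ 0 := by
    intro h; apply he; rw [eg, h]; simp
  obtain ⟨k0, hk0⟩ : ∃ k, g k ≠ 0 := by
    by_contra! h; exact hg0 (funext h)
  have hl0 : l k0 = 0 := by
    rcases mul_eq_zero.1 (hlg k0) with h | h
    · exact h
    · exact absurd h hk0
  have hp0 : p k0 ≠ 0 := by
    intro h
    have := hent k0 k0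
    simp [hl0, h] at this
  have hgo : ∀ m, m ≠ k0 → g m = 0 := by
    intro m hm
    have := hent k0 m
    simpa [hl0, hm.symm, hp0] using this
  have hlo : ∀ m, m ≠ k0 → 1 / l m = W m m := by
    intro m hm
    have := hent m m
    simp only [if_true, hgo m hm, mul_zero, sub_zero] at this
    have hne : l m ≠ 0 := by intro h; simp [h] at this
    field_simp
    linarith
  have hgs : g = Pi.single k0 (g k0) := by
    funext m
    by_cases h : m = k0
    · subst h; simp
    · simp [h, hgo m h]
  have hee : e ⬝ᵥ e = g k0 * g k0 := by
    rw [eg, dotProduct_mulVec, ← mulVec_transpose, mulVec_mulVec, h2, one_mulVec]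
    conv_lhs => rw [hgs]
    simp
  have heM : e ⬝ᵥ M *ᵥ e = g k0 * W k0 k0 * g k0 := by
    have : e ⬝ᵥ M *ᵥ e = g ⬝ᵥ W *ᵥ g := by
      rw [hWM, ← mulVec_mulVec, ← hg, dotProduct_mulVec, ← vecMul_vecMul, ← dotProduct_mulVec,
        ← mulVec_transpose, ← hg]
    rw [this]
    conv_lhs => rw [hgs]
    simp [mul_comm]
  rw [heM, hee, htr, Matrix.trace, ← Finset.add_sum_erase _ _ (Finset.mem_univ k0),
    ← Finset.add_sum_erase (Finset.univ) (fun k => W.diag k) (Finset.mem_univ k0)]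
  rw [Finset.sum_congr rfl (fun m hm => hlo m (Finset.ne_of_mem_erase hm))]
  simp only [hl0, diag_apply]
  field_simp
  ring

lemma sum_inv_roots {V : Type*} [Fintype V] [DecidableEq V] (L M : Matrix V V ℝ)
    (hL : L.IsHermitian) (f e : V → ℝ) (he : e ≠ 0) (hLe : L *ᵥ e = 0)
    (hM : L * M = 1 - vecMulVec f e) :
    (L.charpoly.roots.map (fun t => 1 / t)).sum = M.trace - (e ⬝ᵥ M *ᵥ e) / (e ⬝ᵥ e) := by
  have hU := hL.eigenvectorUnitary.2
  have hs : L = (hL.eigenvectorUnitary : Matrix V V ℝ) * diagonal hL.eigenvalues *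
      (hL.eigenvectorUnitary : Matrix V V ℝ)ᵀ := by
    have := hL.spectral_theorem
    rw [Unitary.conjStarAlgAut_apply] at this
    simpa [star_eq_conjTranspose, conjTranspose_eq_transpose_of_trivial] using this
  rw [hL.roots_charpoly_eq_eigenvalues, Multiset.map_map]
  refine Eq.trans ?_ (sum_inv_aux (hL.eigenvectorUnitary : Matrix V V ℝ) M hL.eigenvalues ?_ ?_ f e he ?_ ?_)
  · simp
  · simpa [star_eq_conjTranspose, conjTranspose_eq_transpose_of_trivial] using (Unitary.mem_iff.1 hU).2
  · simpa [star_eq_conjTranspose, conjTranspose_eq_transpose_of_trivial] using (Unitary.mem_iff.1 hU).1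
  · rw [← hs]; exact hLe
  · rw [← hs]; exact hM

open scoped Classical in
lemma normLap_mul_sqrt {V : Type*} [Fintype V] [DecidableEq V] (G : SimpleGraph V) (hd : ∀ u, 0 < G.degree u)
    (u w : V) : normLap G u w * √(G.degree w : ℝ) =
      (1 / √(G.degree u : ℝ)) * ((if u = w then (G.degree u : ℝ) else 0) -
        (if G.Adj u w then 1 else 0)) := by
  have hu : (0 : ℝ) < G.degree u := by exact_mod_cast hd u
  have hw : (0 : ℝ) < G.degree w := by exact_mod_cast hd w
  have hu' := Real.sqrt_pos.2 hu
  have hw' := Real.sqrt_pos.2 hw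
  simp only [normLap, of_apply]
  by_cases h : u = w
  · subst h
    simp only [if_true, SimpleGraph.irrefl, if_false]
    field_simp
    rw [Real.sq_sqrt hu.le]; ring
  · simp only [h, if_false]
    by_cases ha : G.Adj u w
    · simp only [ha, if_true]
      rw [Real.sqrt_mul hu.le]
      field_simp
      ring
    · simp [ha]

open scoped Classical in
lemma kfStar_eq {V : Type*} [Fintype V] [DecidableEq V] [Nonempty V] (G : SimpleGraph V)
    (hd : ∀ u, 0 < G.degree u) (N : V → V → ℝ) (τ : V → ℝ)
    (hN : ∀ u v, (G.degree u : ℝ) * N u v - ∑ w, (if G.Adj u w then N w v else 0) =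
      (if u = v then 1 else 0) - τ u) :
    kfStar G = (∑ u, (G.degree u : ℝ)) * (∑ u, (G.degree u : ℝ) * N u u) -
      ∑ u, ∑ v, (G.degree u : ℝ) * (G.degree v : ℝ) * N u v := by
  have hu : ∀ u, (0 : ℝ) < G.degree u := fun u => by exact_mod_cast hd u
  have hu' := fun u => Real.sqrt_pos.2 (hu u)
  have hsq : ∀ u, √(G.degree u : ℝ) * √(G.degree u : ℝ) = G.degree u :=
    fun u => Real.mul_self_sqrt (hu u).le
  have hvol : 0 < ∑ u, (G.degree u : ℝ) := Finset.sum_pos (fun u _ => hu u) Finset.univ_nonempty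
  have hm : 2 * (Nat.card G.edgeSet : ℝ) = ∑ u, (G.degree u : ℝ) := by
    have := G.sum_degrees_eq_twice_card_edges
    rw [Nat.card_eq_fintype_card, ← SimpleGraph.edgeFinset_card]
    exact_mod_cast this.symm
  have hH : (normLap G).IsHermitian := by
    ext u w
    simp only [normLap, conjTranspose_apply, of_apply, star_trivial, G.adj_comm u w,
      eq_comm (a := u) (b := w), mul_comm (G.degree u : ℝ)]
    split_ifs <;> rfl
  have key := sum_inv_roots (normLap G)
    (Matrix.of fun u v => √(G.degree u : ℝ) * N u v * √(G.degree v : ℝ)) hH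
    (fun u => τ u / √(G.degree u : ℝ)) (fun u => √(G.degree u : ℝ)) ?_ ?_ ?_
  · rw [kfStar, hm]
    rw [key]
    have e1 : (fun u => √(G.degree u : ℝ)) ⬝ᵥ (fun u => √(G.degree u : ℝ)) =
        ∑ u, (G.degree u : ℝ) := by
      simp only [dotProduct, hsq]
    have e2 : (Matrix.of fun u v => √(G.degree u : ℝ) * N u v * √(G.degree v : ℝ)).trace =
        ∑ u, (G.degree u : ℝ) * N u u := by
      simp only [Matrix.trace, diag_apply, of_apply]
      refine Finset.sum_congr rfl fun u _ => ?_
      rw [← hsq u]; ring_nf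
      rw [Real.sqrt_sq (hu' u).le]
    have e3 : (fun u => √(G.degree u : ℝ)) ⬝ᵥ
        ((Matrix.of fun u v => √(G.degree u : ℝ) * N u v * √(G.degree v : ℝ)) *ᵥ
          (fun u => √(G.degree u : ℝ))) =
        ∑ u, ∑ v, (G.degree u : ℝ) * (G.degree v : ℝ) * N u v := by
      simp only [dotProduct, mulVec, of_apply, Finset.mul_sum]
      refine Finset.sum_congr rfl fun u _ => Finset.sum_congr rfl fun v _ => ?_
      calc _ = (√(G.degree u : ℝ) * √(G.degree u : ℝ)) * (√(G.degree v : ℝ) * √(G.degree v : ℝ))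
            * N u v := by ring
        _ = _ := by rw [hsq, hsq]
    rw [e1, e2, e3]
    field_simp
  · intro h
    obtain ⟨u⟩ := ‹Nonempty V›
    exact (hu' u).ne' (congrFun h u)
  · funext u
    simp only [mulVec, dotProduct, normLap_mul_sqrt G hd, ← Finset.mul_sum, Finset.sum_sub_distrib]
    rw [Finset.sum_ite_eq, ← SimpleGraph.degree_eq_sum_if_adj]
    simp
  · ext u v
    simp only [Matrix.mul_apply, of_apply, Matrix.sub_apply, Matrix.one_apply, vecMulVec_apply]
    have : ∀ w, normLap G u w * (√(G.degree w : ℝ) * N w v * √(G.degree v : ℝ)) =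
        (√(G.degree v : ℝ) / √(G.degree u : ℝ)) * ((if u = w then (G.degree u : ℝ) * N w v else 0) -
        (if G.Adj u w then N w v else 0)) := by
      intro w
      rw [← mul_assoc, ← mul_assoc, normLap_mul_sqrt G hd]
      split_ifs <;> ring
    rw [Finset.sum_congr rfl fun w _ => this w, ← Finset.mul_sum, Finset.sum_sub_distrib,
      Finset.sum_ite_eq]
    simp only [Finset.mem_univ, if_true]
    rw [hN u v]
    have := (hu' u).ne'
    split_ifs with h
    · subst h; field_simp
    · field_simp; ring

/-- path adjacency indicator -/
def pathInd (n : ℕ) (i j : Fin (n+1)) : ℝ := if i.val + 1 = j.val ∨ j.val + 1 = i.val then 1 else 0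

def pathDeg (n : ℕ) (i : Fin (n+1)) : ℝ := ∑ j, pathInd n i j

lemma pathInd_symm (n : ℕ) (i j : Fin (n+1)) : pathInd n i j = pathInd n j i := by
  simp only [pathInd, or_comm]

lemma pathInd_nonneg (n : ℕ) (i j : Fin (n+1)) : 0 ≤ pathInd n i j := by
  unfold pathInd; split_ifs <;> norm_num

/-- sum over path neighbours -/
lemma sum_pathInd (n : ℕ) (i : Fin (n+1)) (g : ℕ → ℝ) :
    ∑ j : Fin (n+1), pathInd n i j * g j.val =
      (if i.val < n then g (i.val + 1) else 0) + (if 0 < i.val then g (i.val - 1) else 0) := by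
  have h : ∀ j : Fin (n+1), pathInd n i j * g j.val =
    (if i.val + 1 = j.val then g (i.val+1) else 0) + 
    (if 0 < i.val then (if i.val - 1 = j.val then g (i.val - 1) else 0) else 0) := by
    intro j
    unfold pathInd
    by_cases h1 : i.val + 1 = j.val
    · have : ¬ (i.val - 1 = j.val) := by omega
      simp [h1, this]
    · by_cases h2 : j.val + 1 = i.val
      · have h3 : i.val - 1 = j.val := by omega
        have h4 : 0 < i.val := by omega
        simp only [h1, h2, h3, h4]; simp
      · have : ¬ (0 < i.val ∧ i.val - 1 = j.val) := by omega
        by_cases h4 : 0 < i.val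
        · have : ¬ (i.val - 1 = j.val) := by omega
          simp [h1, h2, this]
        · simp [h1, h2, h4]
  rw [Finset.sum_congr rfl fun j _ => h j, Finset.sum_add_distrib]
  congr 1
  · rw [Fin.sum_univ_eq_sum_range (fun j => if i.val + 1 = j then g (i.val+1) else 0) (n+1)]
    simp
  · rw [Fin.sum_univ_eq_sum_range
      (fun j => if 0 < i.val then (if i.val - 1 = j then g (i.val - 1) else 0) else 0) (n+1)]
    split_ifs with h
    · rw [Finset.sum_ite_eq]
      have := i.2
      rw [if_pos]; rw [Finset.mem_range]; omega
    · simp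

lemma pathDeg_eq (n : ℕ) (i : Fin (n+1)) :
    pathDeg n i = (if i.val < n then 1 else 0) + (if 0 < i.val then 1 else 0) := by
  have := sum_pathInd n i (fun _ => 1)
  simpa [pathDeg] using this

lemma pathDeg_le (n : ℕ) (i : Fin (n+1)) : pathDeg n i ≤ 2 := by
  rw [pathDeg_eq]; split_ifs <;> norm_num

lemma pathDeg_nonneg (n : ℕ) (i : Fin (n+1)) : 0 ≤ pathDeg n i := by
  rw [pathDeg_eq]; split_ifs <;> norm_num

lemma path_abs (n : ℕ) (i j : Fin (n+1)) :
    pathDeg n i * |(i.val : ℝ) - j.val| - ∑ k, pathInd n i k * |(k.val : ℝ) - j.val| =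
      (2 - pathDeg n i) - (if i = j then 2 else 0) := by
  rw [sum_pathInd n i (fun k => |(k : ℝ) - j.val|), pathDeg_eq]
  have hi := i.2
  have hj := j.2
  have e2 : 0 < i.val → ((i.val - 1 : ℕ) : ℝ) = (i.val : ℝ) - 1 := by
    intro h; rw [Nat.cast_sub h]; simp
  push_cast
  rcases lt_trichotomy i.val j.val with h | h | h
  · have h1 : (i.val : ℝ) + 1 ≤ j.val := by exact_mod_cast h
    have h2 : i ≠ j := by intro h'; subst h'; omega
    have h3 : i.val < n := by omega
    rw [if_neg h2, if_pos h3, abs_of_nonpos (a := (i.val : ℝ) - j.val) (by linarith),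
      abs_of_nonpos (by linarith)]
    split_ifs with h0
    · rw [e2 h0, abs_of_nonpos (by linarith)]; ring
    · ring
  · have h2 : i = j := Fin.ext h
    subst h2
    split_ifs with h3 h4 <;> simp_all
  · have h1 : (j.val : ℝ) + 1 ≤ i.val := by exact_mod_cast h
    have h2 : i ≠ j := by intro h'; subst h'; omega
    have h3 : 0 < i.val := by omega
    rw [if_neg h2, if_pos h3, abs_of_nonneg (a := (i.val : ℝ) - j.val) (by linarith), e2 h3,
      if_pos h3, abs_of_nonneg (a := (i.val : ℝ) - 1 - j.val) (by linarith)]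
    split_ifs with h0
    · rw [abs_of_nonneg (by linarith)]; ring
    · ring

/-- inverse of 4 + 2 Lap(path), with bounded diagonal -/
lemma exists_inv (n : ℕ) : ∃ F : Fin (n+1) → Fin (n+1) → ℝ,
    (∀ i j, (4 + 2 * pathDeg n i) * F i j - 2 * ∑ k, pathInd n i k * F k j =
      if i = j then 1 else 0) ∧ ∀ i, 0 ≤ F i i ∧ F i i ≤ 1/4 := by
  set T : Matrix (Fin (n+1)) (Fin (n+1)) ℝ :=
    Matrix.of fun i k => (if i = k then 4 + 2 * pathDeg n i else 0) - 2 * pathInd n i k with hT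
  have hTv : ∀ (x : Fin (n+1) → ℝ) i, (T *ᵥ x) i =
      (4 + 2 * pathDeg n i) * x i - 2 * ∑ k, pathInd n i k * x k := by
    intro x i
    simp only [mulVec, dotProduct, hT, of_apply, sub_mul, Finset.sum_sub_distrib, ite_mul, zero_mul,
      Finset.sum_ite_eq, Finset.mem_univ, if_true, Finset.mul_sum, mul_assoc]
  have hq : ∀ x : Fin (n+1) → ℝ, 4 * ∑ i, x i ^ 2 ≤ x ⬝ᵥ T *ᵥ x := by
    intro x
    have e : x ⬝ᵥ T *ᵥ x = 4 * ∑ i, x i ^ 2 + ∑ i, ∑ k, pathInd n i k * (x i - x k)^2 := by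
      have s : ∑ i, ∑ k, pathInd n i k * (x i - x k)^2 = ∑ i, ∑ k, pathInd n i k * x i ^ 2
          + ∑ i, ∑ k, pathInd n i k * x k ^ 2 - 2 * ∑ i, ∑ k, pathInd n i k * (x i * x k) := by
        simp only [Finset.mul_sum, ← Finset.sum_add_distrib, ← Finset.sum_sub_distrib]
        refine Finset.sum_congr rfl fun i _ => Finset.sum_congr rfl fun k _ => by ring
      have s2 : ∑ i, ∑ k, pathInd n i k * x k ^ 2 = ∑ i, ∑ k, pathInd n i k * x i ^ 2 := by
        rw [Finset.sum_comm]
        refine Finset.sum_congr rfl fun i _ => Finset.sum_congr rfl fun k _ => ?_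
        rw [pathInd_symm]
      rw [s, s2]
      simp only [dotProduct, hTv, pathDeg, ← Finset.sum_mul, Finset.mul_sum,
        ← Finset.sum_add_distrib, ← Finset.sum_sub_distrib]
      refine Finset.sum_congr rfl fun i _ => ?_
      rw [mul_sub, Finset.mul_sum]
      have : ∑ k, x i * (2 * (pathInd n i k * x k)) = ∑ k, 2 * (pathInd n i k * (x i * x k)) :=
        Finset.sum_congr rfl fun k _ => by ring
      rw [this]; simp only [← Finset.mul_sum]; ring
    rw [e]
    have : 0 ≤ ∑ i, ∑ k, pathInd n i k * (x i - x k)^2 :=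
      Finset.sum_nonneg fun i _ => Finset.sum_nonneg fun k _ =>
        mul_nonneg (pathInd_nonneg n i k) (sq_nonneg _)
    linarith
  have hinj : Function.Injective T.mulVec := by
    intro x y hxy
    have h0 : T *ᵥ (x - y) = 0 := by rw [mulVec_sub]; exact sub_eq_zero.2 hxy
    have := hq (x - y)
    rw [h0, dotProduct_zero] at this
    have h1 : ∑ i, (x - y) i ^ 2 = 0 := le_antisymm (by linarith) (Finset.sum_nonneg fun i _ => sq_nonneg _)
    rw [Finset.sum_eq_zero_iff_of_nonneg (fun i _ => sq_nonneg _)] at h1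
    funext i
    have := h1 i (Finset.mem_univ i)
    have := pow_eq_zero_iff (two_ne_zero) |>.1 this
    simpa [sub_eq_zero] using this
  have hU : IsUnit T := Matrix.mulVec_injective_iff_isUnit.1 hinj
  have hTi : T * T⁻¹ = 1 := Matrix.mul_nonsing_inv _ ((Matrix.isUnit_iff_isUnit_det _).1 hU)
  have hcol : ∀ i j, (T *ᵥ (fun k => T⁻¹ k j)) i = if i = j then 1 else 0 := by
    intro i j
    have := congrFun (congrFun hTi i) j
    rw [Matrix.one_apply] at this
    rw [← this]; rfl
  refine ⟨fun i j => T⁻¹ i j, fun i j => ?_, fun j => ?_⟩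
  · rw [← hTv (fun k => T⁻¹ k j) i, hcol]
  · have h1 := hq (fun k => T⁻¹ k j)
    have h2 : (fun k => T⁻¹ k j) ⬝ᵥ T *ᵥ (fun k => T⁻¹ k j) = T⁻¹ j j := by
      simp [dotProduct, hcol]
    rw [h2] at h1
    have h3 : (T⁻¹ j j)^2 ≤ ∑ i, (T⁻¹ i j)^2 :=
      Finset.single_le_sum (f := fun i => (T⁻¹ i j)^2) (fun i _ => sq_nonneg _) (Finset.mem_univ j)
    constructor <;> nlinarith

lemma prism_adj (n : ℕ) (i j : Fin (n+1)) (b c s t : Bool) :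
    (strongPrism (Bgraph n)).Adj ((i,b),s) ((j,c),t) ↔
      ((i,b),s) ≠ ((j,c),t) ∧ (i = j ∨ (b = c ∧ (i.val + 1 = j.val ∨ j.val + 1 = i.val))) := by
  simp only [strongPrism, Bgraph, SimpleGraph.fromRel_adj, ne_eq, Prod.mk.injEq]
  constructor
  · rintro ⟨h, h'⟩
    refine ⟨h, ?_⟩
    grind
  · rintro ⟨h, h'⟩
    refine ⟨h, ?_⟩
    have : i = j → i.val = j.val := fun h => by rw [h]
    grind

open scoped Classical in
lemma prism_adj_sum (n : ℕ) (i : Fin (n+1)) (b s : Bool) (g : (Fin (n+1) × Bool) × Bool → ℝ) :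
    ∑ w, (if (strongPrism (Bgraph n)).Adj ((i,b),s) w then g w else 0) =
      (∑ c, ∑ t, g ((i,c),t)) - g ((i,b),s) +
        ∑ j, pathInd n i j * (g ((j,b),true) + g ((j,b),false)) := by
  have h : ∀ w : (Fin (n+1) × Bool) × Bool,
      (if (strongPrism (Bgraph n)).Adj ((i,b),s) w then g w else 0) =
      (if i = w.1.1 then g w else 0) - (if ((i,b),s) = w then g w else 0) +
        (if b = w.1.2 then pathInd n i w.1.1 * g w else 0) := by
    rintro ⟨⟨j, c⟩, t⟩
    simp only [prism_adj, pathInd]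
    have hij : i = j → i.val = j.val := fun h => by rw [h]
    by_cases h1 : i = j
    · have h2 := hij h1
      have h3 : ¬ (i.val + 1 = j.val ∨ j.val + 1 = i.val) := by omega
      by_cases h4 : ((i,b),s) = ((j,c),t)
      · rw [if_neg (fun h => h.1 h4), if_pos h1, if_pos h4, if_neg h3]; simp
      · rw [if_pos ⟨h4, Or.inl h1⟩, if_pos h1, if_neg h4, if_neg h3]; simp
    · have h4 : ((i,b),s) ≠ ((j,c),t) := by simp [h1]
      simp only [h1, h4, ne_eq, not_false_eq_true, true_and, false_or, if_false]
      by_cases h5 : b = c <;> simp [h5]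
  rw [Finset.sum_congr rfl fun w _ => h w, Finset.sum_add_distrib, Finset.sum_sub_distrib]
  congr 1
  · congr 1
    · simp only [Fintype.sum_prod_type, Fintype.sum_bool, Finset.sum_add_distrib, Finset.sum_ite_eq,
        Finset.mem_univ, if_true]
    · rw [Finset.sum_ite_eq]; simp
  · simp only [Fintype.sum_prod_type, Fintype.sum_bool]
    refine Finset.sum_congr rfl fun j _ => ?_
    cases b <;> simp <;> ring

open scoped Classical in
lemma prism_degree (n : ℕ) (i : Fin (n+1)) (b s : Bool) :
    ((strongPrism (Bgraph n)).degree ((i,b),s) : ℝ) = 3 + 2 * pathDeg n i := by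
  rw [SimpleGraph.degree_eq_sum_if_adj, prism_adj_sum n i b s (fun _ => 1)]
  simp only [Fintype.sum_bool, pathDeg, Finset.mul_sum]
  congr 1
  · norm_num
  · refine Finset.sum_congr rfl fun j _ => by ring

def sgn2 (b c : Bool) : ℝ := if b = c then 1 else -1

/-- Green kernel -/
noncomputable def greenN (n : ℕ) (F : Fin (n+1) → Fin (n+1) → ℝ)
    (u v : (Fin (n+1) × Bool) × Bool) : ℝ :=
  -|(u.1.1.val : ℝ) - v.1.1.val| / 16 + sgn2 u.1.2 v.1.2 * F u.1.1 v.1.1 / 4 +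
    (if u.1 = v.1 then sgn2 u.2 v.2 / 2 * (4 + 2 * pathDeg n u.1.1)⁻¹ else 0)

open scoped Classical in
lemma greenN_eq (n : ℕ) (F : Fin (n+1) → Fin (n+1) → ℝ)
    (hF : ∀ i j, (4 + 2 * pathDeg n i) * F i j - 2 * ∑ k, pathInd n i k * F k j =
      if i = j then 1 else 0) (u v : (Fin (n+1) × Bool) × Bool) :
    ((strongPrism (Bgraph n)).degree u : ℝ) * greenN n F u v -
      ∑ w, (if (strongPrism (Bgraph n)).Adj u w then greenN n F w v else 0) =
      (if u = v then 1 else 0) - (2 - pathDeg n u.1.1) / 8 := by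
  obtain ⟨⟨i, b⟩, s⟩ := u
  obtain ⟨⟨j, c⟩, t⟩ := v
  rw [prism_degree, prism_adj_sum n i b s (fun w => greenN n F w ((j,c),t))]
  have h1 : ∀ k : Fin (n+1), greenN n F ((k,b),true) ((j,c),t) + greenN n F ((k,b),false) ((j,c),t)
      = -|(k.val : ℝ) - j.val| / 8 + sgn2 b c * F k j / 2 := by
    intro k
    simp only [greenN]
    have : sgn2 true t + sgn2 false t = 0 := by cases t <;> simp [sgn2]
    split_ifs
    · have h2 : sgn2 true t = - sgn2 false t := by linarith
      rw [h2]; ring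
    · ring
  have h2 : ∑ c', ∑ t', greenN n F ((i,c'),t') ((j,c),t) = -|(i.val : ℝ) - j.val| / 4 := by
    simp only [Fintype.sum_bool, greenN, Prod.mk.injEq]
    cases c <;> cases t <;> simp [sgn2] <;> split_ifs <;> ring
  rw [h2, Finset.sum_congr rfl fun k _ => by rw [h1 k]]
  have h3 : ∑ k, pathInd n i k * (-|(k.val : ℝ) - j.val| / 8 + sgn2 b c * F k j / 2) =
      - (∑ k, pathInd n i k * |(k.val : ℝ) - j.val|) / 8 +
        sgn2 b c / 2 * ∑ k, pathInd n i k * F k j := by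
    rw [neg_div, Finset.sum_div, Finset.mul_sum, ← Finset.sum_neg_distrib, ← Finset.sum_add_distrib]
    exact Finset.sum_congr rfl fun k _ => by ring
  rw [h3]
  have hp := path_abs n i j
  have hf := hF i j
  have hd := pathDeg_nonneg n i
  have hd' : (4 + 2 * pathDeg n i) ≠ 0 := by linarith
  generalize ∑ k, pathInd n i k * |(k.val : ℝ) - j.val| = X at *
  generalize ∑ k, pathInd n i k * F k j = Y at *
  have hX : X = pathDeg n i * |(i.val : ℝ) - j.val| - ((2 - pathDeg n i) - (if i = j then 2 else 0)) := by
    linarith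
  have hY : Y = ((4 + 2 * pathDeg n i) * F i j - if i = j then 1 else 0) / 2 := by linarith
  rw [hX, hY]
  simp only [greenN, Prod.mk.injEq]
  by_cases hij : i = j
  · cases b <;> cases c <;> cases s <;> cases t <;> simp [hij, sgn2] <;> (subst hij; field_simp; ring)
  · simp only [hij, false_and, if_false]; ring

lemma prism_adj_dist (n : ℕ) (u v : (Fin (n+1) × Bool) × Bool)
    (h : (strongPrism (Bgraph n)).Adj u v) : |(u.1.1.val : ℝ) - v.1.1.val| ≤ 1 := by
  obtain ⟨⟨i, b⟩, s⟩ := u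
  obtain ⟨⟨j, c⟩, t⟩ := v
  rw [prism_adj] at h
  rcases h.2 with h | ⟨_, h | h⟩
  · subst h; simp
  · have : (i.val : ℝ) + 1 = j.val := by exact_mod_cast h
    rw [abs_le]; constructor <;> simp <;> linarith
  · have : (j.val : ℝ) + 1 = i.val := by exact_mod_cast h
    rw [abs_le]; constructor <;> simp <;> linarith

lemma prism_walk_length (n : ℕ) (u v : (Fin (n+1) × Bool) × Bool)
    (p : (strongPrism (Bgraph n)).Walk u v) : |(u.1.1.val : ℝ) - v.1.1.val| ≤ p.length := by
  induction p with
  | nil => simp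
  | @cons u w v h p ih =>
    have h1 := prism_adj_dist n u w h
    have h2 := abs_sub_le (u.1.1.val : ℝ) w.1.1.val v.1.1.val
    push_cast [SimpleGraph.Walk.length_cons]
    linarith

lemma prism_walk_straight (n : ℕ) (b s : Bool) (k : ℕ) : ∀ (i j : Fin (n+1)), i.val + k = j.val →
    ∃ p : (strongPrism (Bgraph n)).Walk ((i,b),s) ((j,b),s), p.length = k := by
  induction k with
  | zero =>
    intro i j h
    have : i = j := Fin.ext (by omega)
    subst this
    exact ⟨SimpleGraph.Walk.nil, rfl⟩
  | succ k ih =>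
    intro i j h
    have hi : i.val + 1 < n + 1 := by have := j.2; omega
    obtain ⟨p, hp⟩ := ih ⟨i.val + 1, hi⟩ j (by simp; omega)
    have ha : (strongPrism (Bgraph n)).Adj ((i,b),s) ((⟨i.val + 1, hi⟩,b),s) := by
      rw [prism_adj]
      refine ⟨?_, Or.inr ⟨rfl, Or.inl rfl⟩⟩
      intro h
      simp [Fin.ext_iff] at h
    exact ⟨SimpleGraph.Walk.cons ha p, by simp [hp]⟩

lemma prism_walk (n : ℕ) (u v : (Fin (n+1) × Bool) × Bool) :
    ∃ p : (strongPrism (Bgraph n)).Walk u v, (p.length : ℝ) ≤ |(u.1.1.val : ℝ) - v.1.1.val| + 1 := by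
  obtain ⟨⟨i, b⟩, s⟩ := u
  obtain ⟨⟨j, c⟩, t⟩ := v
  have h1 : ∃ p : (strongPrism (Bgraph n)).Walk ((i,b),s) ((j,b),s),
      (p.length : ℝ) = |(i.val : ℝ) - j.val| := by
    rcases le_total i.val j.val with h | h
    · obtain ⟨k, hk⟩ := Nat.exists_eq_add_of_le h
      obtain ⟨p, hp⟩ := prism_walk_straight n b s k i j hk.symm
      refine ⟨p, ?_⟩
      rw [hp, hk]; push_cast
      rw [abs_of_nonpos] <;> simp
    · obtain ⟨k, hk⟩ := Nat.exists_eq_add_of_le h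
      obtain ⟨p, hp⟩ := prism_walk_straight n b s k j i hk.symm
      refine ⟨p.reverse, ?_⟩
      rw [SimpleGraph.Walk.length_reverse, hp, hk]; push_cast
      rw [abs_of_nonneg] <;> simp
  obtain ⟨p, hp⟩ := h1
  by_cases h : ((j,b),s) = ((j,c),t)
  · rw [← h]
    exact ⟨p, by rw [hp]; simp⟩
  · have ha : (strongPrism (Bgraph n)).Adj ((j,b),s) ((j,c),t) := by
      rw [prism_adj]; exact ⟨h, Or.inl rfl⟩
    refine ⟨p.append (SimpleGraph.Walk.cons ha SimpleGraph.Walk.nil), ?_⟩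
    simp [hp]

lemma prism_dist (n : ℕ) (u v : (Fin (n+1) × Bool) × Bool) :
    |(u.1.1.val : ℝ) - v.1.1.val| ≤ (strongPrism (Bgraph n)).dist u v ∧
    ((strongPrism (Bgraph n)).dist u v : ℝ) ≤ |(u.1.1.val : ℝ) - v.1.1.val| + 1 := by
  obtain ⟨p, hp⟩ := prism_walk n u v
  constructor
  · obtain ⟨q, hq⟩ := (SimpleGraph.Walk.reachable p).exists_walk_length_eq_dist
    rw [← hq]
    exact prism_walk_length n u v q
  · have : ((strongPrism (Bgraph n)).dist u v : ℝ) ≤ p.length := by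
      exact_mod_cast SimpleGraph.dist_le p
    linarith

lemma sum_abs_row (m : ℕ) : ∑ i ∈ Finset.range m, |(m : ℝ) - i| = m * (m + 1) / 2 := by
  have : ∀ i ∈ Finset.range m, |(m : ℝ) - i| = m - i := by
    intro i hi
    have : (i : ℝ) ≤ m := by exact_mod_cast (Finset.mem_range.1 hi).le
    rw [abs_of_nonneg]; linarith
  rw [Finset.sum_congr rfl this, Finset.sum_sub_distrib]
  have h : ∀ k : ℕ, ∑ i ∈ Finset.range k, (i : ℝ) = k * (k - 1) / 2 := by
    intro k
    induction k with
    | zero => simp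
    | succ k ih => rw [Finset.sum_range_succ, ih]; push_cast; ring
  rw [h]; simp; ring

lemma sum_abs (m : ℕ) : ∑ i ∈ Finset.range m, ∑ j ∈ Finset.range m, |(i : ℝ) - j| =
    ((m : ℝ)^3 - m) / 3 := by
  induction m with
  | zero => simp
  | succ m ih =>
    rw [Finset.sum_range_succ]
    simp only [Finset.sum_range_succ, Finset.sum_add_distrib]
    rw [ih, sum_abs_row]
    have : ∑ i ∈ Finset.range m, |(i : ℝ) - m| = m * (m + 1) / 2 := by
      rw [← sum_abs_row]
      exact Finset.sum_congr rfl fun i _ => abs_sub_comm _ _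
    rw [this]; simp; ring

open scoped Classical in
lemma main_bound (n : ℕ) (hn : 1 ≤ n) :
    |kfStar (strongPrism (Bgraph n)) / gutmanIndex (strongPrism (Bgraph n)) - 1/8| ≤
      100 / (n : ℝ) := by
  obtain ⟨F, hF, hFb⟩ := exists_inv n
  set G := strongPrism (Bgraph n) with hG
  have hdeg : ∀ u : (Fin (n+1) × Bool) × Bool, (G.degree u : ℝ) = 3 + 2 * pathDeg n u.1.1 :=
    fun u => prism_degree n u.1.1 u.1.2 u.2
  have hd3 : ∀ u, (3 : ℝ) ≤ G.degree u := fun u => by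
    rw [hdeg]; linarith [pathDeg_nonneg n u.1.1]
  have hd7 : ∀ u, (G.degree u : ℝ) ≤ 7 := fun u => by
    rw [hdeg]; linarith [pathDeg_le n u.1.1]
  have hd0 : ∀ u, 0 < G.degree u := fun u => by
    have : (0 : ℝ) < G.degree u := by linarith [hd3 u]
    exact_mod_cast this
  have hk := kfStar_eq G hd0 (greenN n F) (fun u => (2 - pathDeg n u.1.1) / 8) (greenN_eq n F hF)
  have hcard : (Fintype.card ((Fin (n+1) × Bool) × Bool) : ℝ) = 4 * (n + 1) := by
    simp; ring
  set vol := ∑ u, (G.degree u : ℝ) with hvol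
  have hv0 : 0 ≤ vol := Finset.sum_nonneg fun u _ => by linarith [hd3 u]
  have hv1 : vol ≤ 28 * (n + 1) := by
    calc vol ≤ ∑ u : (Fin (n+1) × Bool) × Bool, (7 : ℝ) := Finset.sum_le_sum fun u _ => hd7 u
      _ = _ := by rw [Finset.sum_const, Finset.card_univ, nsmul_eq_mul, hcard]; ring
  set S := ∑ u, ∑ v, (G.degree u : ℝ) * (G.degree v : ℝ) * |(u.1.1.val : ℝ) - v.1.1.val| with hS
  set E := ∑ u, (G.degree u : ℝ) * greenN n F u u with hE
  have hNd : ∀ u, 0 ≤ (G.degree u : ℝ) * greenN n F u u ∧ (G.degree u : ℝ) * greenN n F u u ≤ 2 := by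
    intro u
    have h0 := pathDeg_nonneg n u.1.1
    have hb := hFb u.1.1
    have e : greenN n F u u = F u.1.1 u.1.1 / 4 + 1 / (2 * (4 + 2 * pathDeg n u.1.1)) := by
      simp [greenN, sgn2]; ring
    have h1 : 0 ≤ 1 / (2 * (4 + 2 * pathDeg n u.1.1)) := by positivity
    have h2 : 1 / (2 * (4 + 2 * pathDeg n u.1.1)) ≤ 1 / 8 := by
      apply one_div_le_one_div_of_le <;> linarith
    rw [e]
    have := hd3 u
    have := hd7 u
    constructor
    · apply mul_nonneg <;> linarith
    · nlinarith
  have hE0 : 0 ≤ E := Finset.sum_nonneg fun u _ => (hNd u).1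
  have hE1 : E ≤ 8 * (n + 1) := by
    calc E ≤ ∑ u : (Fin (n+1) × Bool) × Bool, (2 : ℝ) := Finset.sum_le_sum fun u _ => (hNd u).2
      _ = _ := by rw [Finset.sum_const, Finset.card_univ, nsmul_eq_mul, hcard]; ring
  -- symmetric part
  have hNS : ∑ u, ∑ v, (G.degree u : ℝ) * (G.degree v : ℝ) * greenN n F u v = - S / 16 := by
    rw [hS, neg_div, Finset.sum_div, ← Finset.sum_neg_distrib]
    refine Finset.sum_congr rfl fun u _ => ?_
    rw [Finset.sum_div, ← Finset.sum_neg_distrib]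
    simp only [Fintype.sum_prod_type, Fintype.sum_bool]
    refine Finset.sum_congr rfl fun j _ => ?_
    obtain ⟨⟨i, b⟩, s⟩ := u
    simp only [hdeg, greenN, Prod.mk.injEq]
    by_cases hij : i = j
    · cases b <;> cases s <;> simp [hij, sgn2] <;> ring
    · cases b <;> simp [hij, sgn2] <;> ring
  rw [hNS] at hk
  set H := ∑ u, ∑ v, (G.degree u : ℝ) * (G.degree v : ℝ) * (G.dist u v : ℝ) with hH
  have hgut : gutmanIndex G = H / 2 := rfl
  have hSH : S ≤ H := by
    refine Finset.sum_le_sum fun u _ => Finset.sum_le_sum fun v _ => ?_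
    exact mul_le_mul_of_nonneg_left (prism_dist n u v).1 (by positivity)
  have hHS : H ≤ S + vol * vol := by
    have : S + vol * vol = ∑ u, ∑ v, (G.degree u : ℝ) * (G.degree v : ℝ) *
        (|(u.1.1.val : ℝ) - v.1.1.val| + 1) := by
      rw [hS, hvol, Finset.sum_mul_sum, ← Finset.sum_add_distrib]
      refine Finset.sum_congr rfl fun u _ => ?_
      rw [← Finset.sum_add_distrib]
      exact Finset.sum_congr rfl fun v _ => by ring
    rw [this]
    refine Finset.sum_le_sum fun u _ => Finset.sum_le_sum fun v _ => ?_
    exact mul_le_mul_of_nonneg_left (prism_dist n u v).2 (by positivity)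
  have hSlow : 48 * (((n : ℝ) + 1)^3 - (n + 1)) ≤ S := by
    have h1 : ∑ u : (Fin (n+1) × Bool) × Bool, ∑ v : (Fin (n+1) × Bool) × Bool,
        9 * |(u.1.1.val : ℝ) - v.1.1.val| ≤ S := by
      refine Finset.sum_le_sum fun u _ => Finset.sum_le_sum fun v _ => ?_
      apply mul_le_mul_of_nonneg_right _ (abs_nonneg _)
      nlinarith [hd3 u, hd3 v]
    refine le_trans (le_of_eq ?_) h1
    have h2 := sum_abs (n+1)
    push_cast at h2
    simp only [Fintype.sum_prod_type, Fintype.sum_bool, ← Finset.mul_sum, ← two_mul, ← mul_assoc]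
    rw [Finset.sum_congr rfl fun (i : Fin (n+1)) _ =>
      Fin.sum_univ_eq_sum_range (fun j => |(i.val : ℝ) - j|) (n+1),
      Fin.sum_univ_eq_sum_range (fun i => ∑ j ∈ Finset.range (n+1), |(i : ℝ) - j|) (n+1), h2]
    ring
  have hn1 : (1 : ℝ) ≤ n := by exact_mod_cast hn
  have hSpos : 48 * ((n : ℝ) * (n + 1)^2) ≤ S := by
    refine le_trans ?_ hSlow
    nlinarith
  have hHpos : 0 < H := lt_of_lt_of_le (by positivity) (hSpos.trans hSH)
  have hvE : vol * E ≤ 224 * (n + 1)^2 := by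
    calc vol * E ≤ (28 * (n + 1)) * (8 * (n + 1)) := mul_le_mul hv1 hE1 hE0 (by positivity)
      _ = _ := by ring
  have hvv : vol * vol ≤ 784 * (n + 1)^2 := by
    calc vol * vol ≤ (28 * (n + 1)) * (28 * (n + 1)) := mul_le_mul hv1 hv1 hv0 (by positivity)
      _ = _ := by ring
  have hvE0 : 0 ≤ vol * E := mul_nonneg hv0 hE0
  have hfin : kfStar G / gutmanIndex G - 1/8 = (2 * (vol * E) + (S - H) / 8) / H := by
    rw [hgut, hk]; field_simp; ring
  rw [hfin, abs_div, abs_of_pos hHpos, div_le_div_iff₀ hHpos (by linarith)]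
  have habs : |2 * (vol * E) + (S - H) / 8| ≤ 448 * (n + 1)^2 := by
    rw [abs_le]; constructor <;> nlinarith
  calc |2 * (vol * E) + (S - H) / 8| * n ≤ 448 * (n + 1)^2 * n :=
        mul_le_mul_of_nonneg_right habs (by linarith)
    _ ≤ 100 * (48 * ((n : ℝ) * (n + 1)^2)) := by nlinarith [mul_nonneg (by linarith : (0:ℝ) ≤ n) (sq_nonneg ((n : ℝ) + 1))]
    _ ≤ 100 * H := by linarith

/-- `lim_{n→∞} Kf*(B_n²)/Gut(B_n²) = 1/8`. -/
theorem tendsto_kfStar_div_gutmanIndex :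
    Filter.Tendsto
      (fun n : ℕ => kfStar (strongPrism (Bgraph n)) / gutmanIndex (strongPrism (Bgraph n)))
      Filter.atTop (nhds (1/8)) := by
  rw [tendsto_iff_dist_tendsto_zero]
  refine squeeze_zero' (Filter.Eventually.of_forall fun n => dist_nonneg)
    ((Filter.eventually_ge_atTop 1).mono fun n hn => ?_) (tendsto_const_div_atTop_nhds_zero_nat 100)
  rw [Real.dist_eq]
  exact main_bound n hn
end
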